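/- arXiv:1911.12858 — 3 statements merged into one kernel-verified Lean document; each statement's English description precedes it below -/
import Mathlib

section
/- Let x ≥ 1 and y ≥ 3 be integers and let s ≥ 1 satisfy (s-1)s(y/2 - 1) + s - 1 < x ≤ s(s+1)(y/2 - 1) + s. Then for all integers m, n with x ≥ m ≥ 1 and 2 ≤ n ≤ y/3 + 1, we have (x/m + y/n - 1)(m+n-1) ≥ (x/s + y/2 - 1)(s+1) - 1/s, and hence ⌈(x/m + y/n - 1)(m+n-1)⌉ ≥ ⌈(x/s + y/2 - 1)(s+1)⌉. -/
/-- The reduced inequality for `n = 2`. -/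
theorem core_two (x m s : ℤ) (c : ℚ) (hm : 1 ≤ m) (hs : 1 ≤ s) (hc : 1 / 2 ≤ c)
    (hs1 : ((s : ℚ) - 1) * s * c + s - 1 < x) (hs2 : (x : ℚ) ≤ s * (s + 1) * c + s) :
    0 < ((m : ℚ) - s) * (c * m * s - x) + m := by
  have hmQ : (1 : ℚ) ≤ m := by exact_mod_cast hm
  have hsQ : (1 : ℚ) ≤ s := by exact_mod_cast hs
  have hcs : 0 < c * s := by positivity
  rcases lt_trichotomy m s with h | h | h
  · have h1 : (m : ℚ) + 1 ≤ s := by exact_mod_cast h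
    have h2 : 0 ≤ c * s * ((s : ℚ) - 1 - m) := mul_nonneg hcs.le (by linarith)
    have h3 : 0 ≤ ((s : ℚ) - m) * (x - c * m * s) := mul_nonneg (by linarith) (by nlinarith)
    nlinarith
  · subst h
    nlinarith
  · have h1 : (s : ℚ) + 1 ≤ m := by exact_mod_cast h
    have h2 : 0 ≤ ((m : ℚ) - s) * (s * (s + 1) * c + s - x) :=
      mul_nonneg (by linarith) (by linarith)
    suffices h : 0 < ((m : ℚ) - s) * (c * m * s - (s * (s + 1) * c + s)) + m by nlinarith
    obtain ⟨d, rfl⟩ : ∃ d, m = s + d := ⟨m - s, by ring⟩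
    push_cast at *
    have hd : 1 ≤ d := by omega
    have key : 0 ≤ ((d : ℚ) - 1) * (d * c - 1) := by
      rcases hd.eq_or_lt with h | h
      · rw [← h]; norm_num
      · have : (2 : ℚ) ≤ d := by exact_mod_cast h
        exact mul_nonneg (by linarith) (by nlinarith)
    have := mul_nonneg (show (0 : ℚ) ≤ s by linarith) key
    nlinarith

/-- The reduced inequality for `n ≥ 3`, with `u = m / (n - 1) ≥ 1`, or `u ≤ s - 1`. -/
theorem core_big (x u s c D : ℚ) (hu : 0 < u) (hs : 1 ≤ s) (hc : 1 ≤ c) (hD : 0 ≤ D)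
    (hcD : c ≤ 6 * D + 2)
    (hs1 : (s - 1) * s * c + s - 1 < x) (hs2 : x ≤ s * (s + 1) * c + s)
    (hlow : u < s → u ≤ s - 1 ∨ 2 ≤ s)
    (hex : s ≤ u → u < s + 1 → 1 / 4 ≤ D ∨ 0 ≤ (1 - (u - s)) * (1 - 2 * (u - s))) :
    0 < D * (u + 1) * u * s + (u - s) * (c * u * s - x) + u := by
  have hcs : 0 < c * s := by positivity
  have hDu : 0 ≤ D * (u + 1) * u * s := by positivity
  rcases lt_or_ge u s with h | h
  · by_cases h1 : u ≤ s - 1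
    · have h2 : 0 ≤ c * s * (s - 1 - u) := mul_nonneg hcs.le (by linarith)
      have h3 : 0 ≤ (s - u) * (x - c * u * s) := mul_nonneg (by linarith) (by nlinarith)
      nlinarith
    · have hs2' : 2 ≤ s := (hlow h).resolve_left h1
      push Not at h1
      have h2 : 0 ≤ (s - u) * (x - ((s - 1) * s * c + s - 1)) :=
        mul_nonneg (by linarith) (by linarith)
      obtain ⟨d, rfl⟩ : ∃ d, u = s - 1 + d := ⟨u - s + 1, by ring⟩
      have d0 : 0 < d := by linarith
      have d1 : d < 1 := by linarith
      have h3 : 0 ≤ D * ((s - 1 + d + 1) * (s - 1 + d) - (2 + d) * (1 + d)) :=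
        mul_nonneg hD (by nlinarith)
      have h4 : 0 ≤ d * (1 - d) * (6 * D + 2 - c) :=
        mul_nonneg (mul_nonneg d0.le (by linarith)) (by linarith)
      have h5 : 0 ≤ D * (2 - 3 * d + 7 * d ^ 2) :=
        mul_nonneg hD (by nlinarith [sq_nonneg (d - 3 / 14)])
      have h6 : 0 < D * (s - 1 + d + 1) * (s - 1 + d) - c * d * (1 - d) + 1 := by
        nlinarith [sq_nonneg (d - 1 / 2)]
      have h7 := mul_pos (show 0 < s by linarith) h6
      have h8 : 0 ≤ (1 - d) * (s - 2) := mul_nonneg (by linarith) (by linarith)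
      nlinarith
  · have h2 : 0 ≤ (u - s) * (s * (s + 1) * c + s - x) :=
      mul_nonneg (by linarith) (by linarith)
    obtain ⟨d, rfl⟩ : ∃ d, u = s + d := ⟨u - s, by ring⟩
    have d0 : 0 ≤ d := by linarith
    rcases le_or_gt 1 d with d1 | d1
    · have key : 0 ≤ s * ((d - 1) * (d * c - 1)) :=
        mul_nonneg (by linarith) (mul_nonneg (by linarith) (by nlinarith))
      nlinarith
    · have h3 : 0 ≤ D * ((s + d + 1) * (s + d) - (2 + d) * (1 + d)) :=
        mul_nonneg hD (by nlinarith)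
      have h4 : 0 ≤ d * (1 - d) * (6 * D + 2 - c) :=
        mul_nonneg (mul_nonneg d0 (by linarith)) (by linarith)
      have h5 : 0 ≤ D * (2 - 3 * d + 7 * d ^ 2 - 1) :=
        mul_nonneg hD (by nlinarith [sq_nonneg (d - 3 / 14)])
      have h6 : 0 ≤ D * (s + d + 1) * (s + d) - c * d * (1 - d) + (1 - d) := by
        have h7 : 0 ≤ D + (1 - d) * (1 - 2 * d) := by
          rcases hex h (by linarith) with h | h
          · nlinarith [sq_nonneg (d - 3 / 4)]
          · have : s + d - s = d := by ring
            rw [this] at h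
            linarith
        nlinarith
      have h7 := mul_nonneg (show 0 ≤ s by linarith) h6
      rcases d0.eq_or_lt with h8 | h8
      · subst h8
        nlinarith
      · nlinarith

/-- The strict form of the first inequality. -/
theorem strict_form (x y s : ℤ) (hy : 3 ≤ y) (hs : 1 ≤ s)
    (hs1 : ((s : ℚ) - 1) * s * ((y : ℚ) / 2 - 1) + s - 1 < x)
    (hs2 : (x : ℚ) ≤ s * (s + 1) * ((y : ℚ) / 2 - 1) + s)
    (m n : ℤ) (hm : 1 ≤ m) (hmx : m ≤ x) (hn : 2 ≤ n) (hny : (n : ℚ) ≤ (y : ℚ) / 3 + 1) :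
    ((x : ℚ) / s + (y : ℚ) / 2 - 1) * (s + 1) - 1 / s
      < ((x : ℚ) / m + (y : ℚ) / n - 1) * (m + n - 1) := by
  have hmQ : (1 : ℚ) ≤ m := by exact_mod_cast hm
  have hsQ : (1 : ℚ) ≤ s := by exact_mod_cast hs
  have hyQ : (3 : ℚ) ≤ y := by exact_mod_cast hy
  have hnQ : (2 : ℚ) ≤ n := by exact_mod_cast hn
  have hmxQ : (m : ℚ) ≤ x := by exact_mod_cast hmx
  have hm0 : (m : ℚ) ≠ 0 := by positivity
  have hs0 : (s : ℚ) ≠ 0 := by positivity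
  have hn0 : (n : ℚ) ≠ 0 := by positivity
  have hk : (0 : ℚ) < n - 1 := by linarith
  have hk0 : (n : ℚ) - 1 ≠ 0 := hk.ne'
  obtain ⟨c, hcdef⟩ : ∃ c : ℚ, c = (y : ℚ) / 2 - 1 := ⟨_, rfl⟩
  obtain ⟨D, hDdef⟩ : ∃ D : ℚ, D = ((n : ℚ) - 2) * (y / (2 * n) - 1) := ⟨_, rfl⟩
  obtain ⟨u, hudef⟩ : ∃ u : ℚ, u = (m : ℚ) / (n - 1) := ⟨_, rfl⟩
  have hu : 0 < u := by rw [hudef]; positivity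
  have hum : u * (n - 1) = m := by rw [hudef]; field_simp
  have hDn : 2 * n * D = ((n : ℚ) - 2) * (y - 2 * n) := by rw [hDdef]; field_simp
  rw [← hcdef] at hs1 hs2
  have hP : 0 < D * (u + 1) * u * s + (u - s) * (c * u * s - x) + u := by
    rcases hn.eq_or_lt with h2 | h3
    · have hD0 : D = 0 := by rw [hDdef, ← h2]; norm_num
      have hu' : u = m := by rw [hudef, ← h2]; norm_num
      have := core_two x m s c hm hs (by rw [hcdef]; linarith) hs1 hs2
      rw [hD0, hu']
      linarith
    · have hn3 : (3 : ℚ) ≤ n := by exact_mod_cast h3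
      have hD : 0 ≤ D := by
        have : 0 ≤ 2 * n * D := by
          rw [hDn]; exact mul_nonneg (by linarith) (by linarith)
        by_contra hneg
        push Not at hneg
        nlinarith
      by_cases hlow : u < 1 ∧ s = 1
      · obtain ⟨hu1, rfl⟩ := hlow
        have e : D * (u + 1) + (1 - u) * ((n - 1) - c) = ((m : ℚ) - 1) * (y / n - 2) := by
          rw [hDdef, hudef, hcdef]; field_simp; ring
        have hyn : 0 ≤ (y : ℚ) / n - 2 := by
          rw [sub_nonneg, le_div_iff₀ (by linarith)]; linarith
        have h4 : 0 ≤ ((m : ℚ) - 1) * (y / n - 2) := mul_nonneg (by linarith) hyn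
        rw [← e] at h4
        have h5 := mul_nonneg hu.le h4
        have h6 : 0 ≤ (1 - u) * (x - u * (n - 1)) :=
          mul_nonneg (by linarith) (by rw [hum]; linarith)
        push_cast
        nlinarith
      · have hD4 : 4 ≤ n → (n : ℚ) - 3 + (y - 3 * (n - 1)) ≤ 4 * D := by
          intro h4
          have h4 : (4 : ℚ) ≤ n := by exact_mod_cast h4
          have h5 : 0 ≤ ((n : ℚ) - 4) * (y - 2 * n) := mul_nonneg (by linarith) (by linarith)
          have h6 : 0 ≤ (n : ℚ) * (4 * D - (y - 2 * n)) := by nlinarith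
          have := nonneg_of_mul_nonneg_right h6 (by linarith)
          linarith
        have hcD : c ≤ 6 * D + 2 := by
          rcases (show n = 3 ∨ 4 ≤ n by omega) with h | h
          · subst h
            push_cast at hDn
            rw [hcdef]; linarith
          · have := hD4 h
            rw [hcdef]; linarith
        apply core_big x u s c D hu hsQ (by rw [hcdef]; linarith) hD hcD hs1 hs2
        · intro hus
          rcases (show s = 1 ∨ 2 ≤ s by omega) with h | h
          · subst h
            exfalso
            push_cast at hus
            exact hlow ⟨hus, rfl⟩
          · right; exact_mod_cast h
        · intro h1 h2
          rcases (show n = 3 ∨ 4 ≤ n by omega) with h | h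
          · right
            subst h
            have hu2 : u = m / 2 := by rw [hudef]; norm_num
            rw [hu2] at h1 h2 ⊢
            have a1 : 2 * s ≤ m := by
              have : (2 : ℚ) * s ≤ m := by linarith
              exact_mod_cast this
            have a2 : m < 2 * s + 2 := by
              have : (m : ℚ) < 2 * s + 2 := by linarith
              exact_mod_cast this
            rcases (show m = 2 * s ∨ m = 2 * s + 1 by omega) with h | h
            · rw [h]; push_cast; ring_nf; norm_num
            · rw [h]; push_cast; ring_nf; norm_num
          · left
            have := hD4 h
            have h4 : (4 : ℚ) ≤ n := by exact_mod_cast h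
            linarith
  have hfin : ((x : ℚ) / m + (y : ℚ) / n - 1) * (m + n - 1)
      - (((x : ℚ) / s + (y : ℚ) / 2 - 1) * (s + 1) - 1 / s)
      = (D * (u + 1) * u * s + (u - s) * (c * u * s - x) + u) / (u * s) := by
    rw [hDdef, hcdef, hudef]
    field_simp
    ring
  have : 0 < (D * (u + 1) * u * s + (u - s) * (c * u * s - x) + u) / (u * s) := by positivity
  linarith


theorem stmt_3 (x y s : ℤ) (hx : 1 ≤ x) (hy : 3 ≤ y) (hs : 1 ≤ s)
    (hs1 : ((s : ℚ) - 1) * s * ((y : ℚ) / 2 - 1) + s - 1 < x)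
    (hs2 : (x : ℚ) ≤ s * (s + 1) * ((y : ℚ) / 2 - 1) + s) :
    ∀ m n : ℤ, 1 ≤ m → m ≤ x → 2 ≤ n → (n : ℚ) ≤ (y : ℚ) / 3 + 1 →
      ((x : ℚ) / m + (y : ℚ) / n - 1) * (m + n - 1)
          ≥ ((x : ℚ) / s + (y : ℚ) / 2 - 1) * (s + 1) - 1 / s ∧
      ⌈((x : ℚ) / m + (y : ℚ) / n - 1) * (m + n - 1)⌉
          ≥ ⌈((x : ℚ) / s + (y : ℚ) / 2 - 1) * (s + 1)⌉ := by
 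
  intro m n hm hmx hn hny
  have h := strict_form x y s hy hs hs1 hs2 m n hm hmx hn hny
  refine ⟨h.le, ?_⟩
  have hsQ : (1 : ℚ) ≤ s := by exact_mod_cast hs
  obtain ⟨t, ht⟩ : ∃ t : ℤ, s * (s + 1) = 2 * t := by
    obtain ⟨t, ht⟩ := Int.even_mul_succ_self s
    exact ⟨t, by omega⟩
  have htQ : (s : ℚ) * (s + 1) = 2 * t := by exact_mod_cast ht
  -- `s` times the right-hand side is an integer
  have hR : s * (((x : ℚ) / s + (y : ℚ) / 2 - 1) * (s + 1))
      = ((x * (s + 1) + t * (y - 2) : ℤ) : ℚ) := by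
    have : s * (((x : ℚ) / s + (y : ℚ) / 2 - 1) * (s + 1))
      = x * (s + 1) + (s * (s + 1)) * (y / 2 - 1) := by
      field_simp
      ring
    rw [this, htQ]; push_cast; ring
  generalize ((x : ℚ) / s + (y : ℚ) / 2 - 1) * (s + 1) = R at h hR ⊢
  generalize ((x : ℚ) / m + (y : ℚ) / n - 1) * (m + n - 1) = L at h ⊢
  generalize x * (s + 1) + t * (y - 2) = j at hR
  apply Int.ceil_le.mpr
  have hL := Int.le_ceil L
  generalize ⌈L⌉ = p at hL ⊢
  have h1 : R - 1 / s < p := lt_of_lt_of_le h hL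
  have h2 : s * R - 1 < s * p := by
    have := mul_lt_mul_of_pos_left h1 (show (0 : ℚ) < s by linarith)
    rwa [mul_sub, mul_one_div_cancel (by positivity)] at this
  rw [hR] at h2
  have h3 : j - 1 < s * p := by exact_mod_cast h2
  have h4 : j ≤ s * p := by omega
  have h5 : (s : ℚ) * R ≤ s * p := by rw [hR]; exact_mod_cast h4
  exact le_of_mul_le_mul_left h5 (by linarith)
end

section
/- Let A, B ⊆ ℤ be finite nonempty subsets with |B| ≥ 3, and let s ≥ 1 be the unique integer with (s-1)s(|B|/2 - 1) + s - 1 < |A| ≤ s(s+1)(|B|/2 - 1) + s. Suppose |A + B| = |A| + |B| + r < (|A|/s + |B|/2 - 1)(s+1). Then there exists an arithmetic progression P_B ⊆ ℤ with B ⊆ P_B and |P_B| ≤ |B| + r + 1. -/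
open Pointwise

section PartOne

variable {F L : Type*} [Field F] [Field L] [Algebra F L] [FiniteDimensional F L]

open Module

/-- Duality: the orthogonal complement of `X * U`. -/
lemma dual_fragment (X U : Submodule F L) :
    ∃ Y : Submodule F L, finrank F Y + finrank F ↥(X * U) = finrank F L ∧
      finrank F ↥(Y * U) + finrank F X ≤ finrank F L := by
  obtain ⟨lam, hlam⟩ : ∃ f : Module.Dual F L, f 1 ≠ 0 := by
    by_contra! h
    exact one_ne_zero ((Module.forall_dual_apply_eq_zero_iff F (1 : L)).1 h)
  let β : LinearMap.BilinForm F L := (LinearMap.mul F L).compr₂ lam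
  have hβ : ∀ x y, β x y = lam (x * y) := fun x y => rfl
  have hnd : β.Nondegenerate := by
    constructor
    · intro x hx
      by_contra hne
      have := hx (x⁻¹)
      rw [hβ, mul_inv_cancel₀ hne] at this
      exact hlam this
    · intro x hx
      by_contra hne
      have := hx (x⁻¹)
      rw [hβ, inv_mul_cancel₀ hne] at this
      exact hlam this
  refine ⟨β.orthogonal (X * U), ?_, ?_⟩
  · rw [LinearMap.BilinForm.finrank_orthogonal hnd]
    have := Submodule.finrank_le (X * U)
    omega
  · have h1 : β.orthogonal (X * U) * U ≤ β.orthogonal X := by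
      rw [Submodule.mul_le]
      intro y hy u hu
      rw [LinearMap.BilinForm.mem_orthogonal_iff] at hy ⊢
      intro x hx
      have := hy (x * u) (Submodule.mul_mem_mul hx hu)
      rw [hβ] at this ⊢
      rw [← this]
      congr 1
      ring
    have h2 := Submodule.finrank_mono h1
    rw [LinearMap.BilinForm.finrank_orthogonal hnd] at h2
    have := Submodule.finrank_le X
    omega

lemma finrank_scale (u : L) (hu : u ≠ 0) (X : Submodule F L) :
    finrank F ↥(X.map (LinearMap.mulLeft F u)) = finrank F X :=
  (LinearEquiv.finrank_eq (Submodule.equivMapOfInjective (LinearMap.mulLeft F u)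
    (fun _ _ h => mul_left_cancel₀ hu h) X)).symm

lemma scale_mul (u : L) (X U : Submodule F L) :
    (X.map (LinearMap.mulLeft F u)) * U = (X * U).map (LinearMap.mulLeft F u) := by
  apply le_antisymm
  · rw [Submodule.mul_le]
    rintro _ ⟨x, hx, rfl⟩ v hv
    exact ⟨x * v, Submodule.mul_mem_mul hx hv, by simp [mul_assoc]⟩
  · rw [Submodule.map_le_iff_le_comap, Submodule.mul_le]
    intro x hx v hv
    rw [Submodule.mem_comap, LinearMap.mulLeft_apply, ← mul_assoc]
    exact Submodule.mul_mem_mul ⟨x, hx, rfl⟩ hv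

lemma eq_top_iff_finrank (X : Submodule F L) : X = ⊤ ↔ finrank F L ≤ finrank F X := by
  constructor
  · rintro rfl; simp
  · intro h
    by_contra hne
    have := Submodule.finrank_lt hne
    omega

lemma ne_bot_iff_finrank (X : Submodule F L) : X ≠ ⊥ ↔ 0 < finrank F X := by
  rw [Nat.pos_iff_ne_zero, Ne, Ne, Submodule.finrank_eq_zero]

/-- Linear Cauchy-Davenport. -/
theorem linear_cauchy_davenport
    (hint : ∀ K : IntermediateField F L, K = ⊥ ∨ K = ⊤)
    (U : Submodule F L) (hU : (1 : L) ∈ U) (W : Submodule F L) (hW : W ≠ ⊥)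
    (hWU : W * U ≠ ⊤) : finrank F W + finrank F U ≤ finrank F ↥(W * U) + 1 := by
  have hle : ∀ X : Submodule F L, X ≤ X * U := fun X x hx => by
    simpa using Submodule.mul_mem_mul hx hU
  have hled : ∀ X : Submodule F L, finrank F X ≤ finrank F ↥(X * U) := fun X =>
    Submodule.finrank_mono (hle X)
  obtain ⟨N, hN⟩ : ∃ N, N = finrank F L := ⟨_, rfl⟩
  -- choice of an atom
  obtain ⟨A, ⟨hA0, hA1⟩, hAmin⟩ : ∃ A : Submodule F L, (A ≠ ⊥ ∧ A * U ≠ ⊤) ∧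
      ∀ X : Submodule F L, X ≠ ⊥ → X * U ≠ ⊤ →
        (finrank F ↥(A * U) - finrank F A < finrank F ↥(X * U) - finrank F X) ∨
        (finrank F ↥(A * U) - finrank F A = finrank F ↥(X * U) - finrank F X ∧
          finrank F A ≤ finrank F X) := by
    let f : Submodule F L → ℕ ×ₗ ℕ := fun X =>
      toLex (finrank F ↥(X * U) - finrank F X, finrank F X)
    obtain ⟨A, hA, hmin⟩ := WellFounded.has_min (InvImage.wf f wellFounded_lt)
      {X : Submodule F L | X ≠ ⊥ ∧ X * U ≠ ⊤} ⟨W, hW, hWU⟩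
    refine ⟨A, hA, fun X h1 h2 => ?_⟩
    have h3 := hmin X ⟨h1, h2⟩
    have h4 : f A ≤ f X := not_lt.1 h3
    rcases (Prod.Lex.le_iff).1 h4 with h | h
    · left; exact h
    · right; exact h
  obtain ⟨κ, hκ⟩ : ∃ κ, κ = finrank F ↥(A * U) - finrank F A := ⟨_, rfl⟩
  obtain ⟨α, hα⟩ : ∃ α, α = finrank F A := ⟨_, rfl⟩
  rw [← hκ, ← hα] at hAmin
  have hAU : finrank F ↥(A * U) = α + κ := by
    have := hled A; omega
  have hdual : 2 * α + κ ≤ N := by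
    obtain ⟨Y, hY1, hY2⟩ := dual_fragment A U
    have h1 := Submodule.finrank_lt hA1
    have h2 := (ne_bot_iff_finrank A).1 hA0
    have hY0 : Y ≠ ⊥ := by rw [ne_bot_iff_finrank]; omega
    have hYt : Y * U ≠ ⊤ := by rw [Ne, eq_top_iff_finrank]; omega
    have := hled Y
    rcases hAmin Y hY0 hYt with h | h <;> omega
  -- distinct atoms meet trivially
  have hatoms : ∀ Y : Submodule F L, finrank F Y = α → finrank F ↥(Y * U) = α + κ →
      A ⊓ Y ≠ ⊥ → A = Y := by
    intro Y hY1 hY2 hne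
    by_contra hAY
    have hlt : A ⊓ Y < A := by
      refine lt_of_le_of_ne inf_le_left fun h => hAY ?_
      have : A ≤ Y := by rw [← h]; exact inf_le_right
      exact Submodule.eq_of_le_of_finrank_eq this (by omega)
    have hi := Submodule.finrank_lt_finrank_of_lt hlt
    have hi0 := (ne_bot_iff_finrank _).1 hne
    have hsub : (A ⊓ Y) * U ≤ (A * U) ⊓ (Y * U) :=
      le_inf (mul_le_mul_left inf_le_left U) (mul_le_mul_left inf_le_right U)
    have hAUlt := Submodule.finrank_lt hA1
    have hd1 := Submodule.finrank_mono hsub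
    have hd2 := Submodule.finrank_mono (inf_le_left : (A * U) ⊓ (Y * U) ≤ A * U)
    have hm1 := hAmin (A ⊓ Y) hne (by rw [Ne, eq_top_iff_finrank]; omega)
    have hl1 := hled (A ⊓ Y)
    have hs1 := Submodule.finrank_sup_add_finrank_inf_eq A Y
    have hs2 := Submodule.finrank_sup_add_finrank_inf_eq (A * U) (Y * U)
    rw [← Submodule.sup_mul] at hs2
    have hl2 := hled (A ⊔ Y)
    by_cases ht : (A ⊔ Y) * U = ⊤
    · rw [eq_top_iff_finrank] at ht
      omega
    · have hm2 := hAmin (A ⊔ Y) (by rw [ne_bot_iff_finrank]; omega) ht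
      omega
  -- scale the atom
  obtain ⟨a0, ha0, ha0'⟩ := Submodule.exists_mem_ne_zero_of_ne_bot hA0
  have key : ∀ u v : L, u ∈ A → u ≠ 0 → v ∈ A → v ≠ 0 →
      ∀ z ∈ A, v * u⁻¹ * z ∈ A := by
    intro u v hu hu0 hv hv0 z hz
    have hvu : v * u⁻¹ ≠ 0 := mul_ne_zero hv0 (inv_ne_zero hu0)
    have := hatoms (A.map (LinearMap.mulLeft F (v * u⁻¹))) (by rw [finrank_scale _ hvu, hα])
      (by rw [scale_mul, finrank_scale _ hvu, hAU]) (by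
        rw [Submodule.ne_bot_iff]
        refine ⟨v, ⟨hv, u, hu, ?_⟩, hv0⟩
        simp [inv_mul_cancel₀ hu0])
    rw [this]
    exact ⟨z, hz, rfl⟩
  let S : Subalgebra F L :=
    { carrier := {x | a0 * x ∈ A}
      mul_mem' := by
        intro x y hx hy
        by_cases hx0 : x = 0
        · simp [hx0]
        have := key a0 (a0 * x) ha0 ha0' hx (mul_ne_zero ha0' hx0) (a0 * y) hy
        have e : a0 * x * a0⁻¹ * (a0 * y) = a0 * (x * y) := by field_simp
        rw [e] at this
        exact this
      add_mem' := by
        intro x y hx hy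
        change a0 * (x + y) ∈ A
        rw [mul_add]; exact A.add_mem hx hy
      algebraMap_mem' := by
        intro t
        change a0 * _ ∈ A
        rw [mul_comm, ← Algebra.smul_def]
        exact A.smul_mem _ ha0 }
  have hS : ∀ x, x ∈ S ↔ a0 * x ∈ A := fun x => Iff.rfl
  let K : IntermediateField F L := S.toIntermediateField (by
    intro x hx
    by_cases hx0 : x = 0
    · simp [hx0]
    have := key (a0 * x) a0 hx (mul_ne_zero ha0' hx0) ha0 ha0' a0 ha0
    rw [hS]
    have e : a0 * (a0 * x)⁻¹ * a0 = a0 * x⁻¹ := by field_simp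
    rw [e] at this
    exact this)
  have hK : ∀ x, x ∈ K ↔ a0 * x ∈ A := fun x => Iff.rfl
  have hα1 : A = Submodule.span F {a0} := by
    rcases hint K with h | h
    · apply le_antisymm
      · intro z hz
        have : a0⁻¹ * z ∈ K := by rw [hK, mul_inv_cancel_left₀ ha0']; exact hz
        rw [h, IntermediateField.mem_bot] at this
        obtain ⟨t, ht⟩ := this
        rw [Submodule.mem_span_singleton]
        refine ⟨t, ?_⟩
        rw [Algebra.smul_def, ht]; field_simp
      · rw [Submodule.span_le]; simpa using ha0
    · exfalso
      apply hA1
      rw [eq_top_iff]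
      refine le_trans ?_ (hle A)
      intro z _
      have : a0⁻¹ * z ∈ K := by rw [h]; trivial
      rwa [hK, mul_inv_cancel_left₀ ha0'] at this
  have hα2 : α = 1 := by rw [hα, hα1, finrank_span_singleton ha0']
  have hUA : finrank F U ≤ finrank F ↥(A * U) := by
    rw [← finrank_scale a0 ha0' U]
    apply Submodule.finrank_mono
    rintro _ ⟨x, hx, rfl⟩
    exact Submodule.mul_mem_mul ha0 hx
  have hlW := hled W
  rcases hAmin W hW hWU with h | h <;> omega

end PartOne
section PartTwo

open Module Polynomial

lemma rank_split {F P L : Type*} [Field F] [AddCommGroup P] [Module F P] [AddCommGroup L]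
    [Module F L] (ev : P →ₗ[F] L) (μ : P →ₗ[F] P) (hμ : Function.Injective μ)
    (hk : LinearMap.ker ev = LinearMap.range μ) (W : Submodule F P) [FiniteDimensional F W] :
    finrank F W = finrank F (W.map ev) + finrank F (W.comap μ) := by
  have h1 := LinearMap.finrank_range_add_finrank_ker (ev.domRestrict W)
  rw [LinearMap.range_domRestrict] at h1
  rw [← h1]
  congr 1
  have h2 : finrank F ↥((W.comap μ).map μ) = finrank F (W.comap μ) :=
    (LinearEquiv.finrank_eq (Submodule.equivMapOfInjective μ hμ _)).symm
  rw [← h2, Submodule.map_comap_eq, ← hk, LinearMap.ker_domRestrict,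
    ← Submodule.finrank_map_subtype_eq, Submodule.map_comap_subtype, inf_comm]

lemma comap_finite {F P : Type*} [Field F] [AddCommGroup P] [Module F P]
    (μ : P →ₗ[F] P) (hμ : Function.Injective μ)
    (W : Submodule F P) [FiniteDimensional F W] : FiniteDimensional F (W.comap μ) := by
  refine Module.Finite.of_injective
    (μ.restrict (p := W.comap μ) (q := W) (fun x hx => hx)) ?_
  intro a b h
  apply Subtype.ext
  apply hμ
  exact congrArg Subtype.val h

/-- The span of the monomials with exponents in `S`. -/
noncomputable def monoSpan (F : Type*) [Field F] (S : Finset ℕ) : Submodule F F[X] :=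
  Submodule.span F ((fun b : ℕ => (X : F[X]) ^ b) '' (S : Set ℕ))

lemma monoSpan_finite (F : Type*) [Field F] (S : Finset ℕ) :
    FiniteDimensional F (monoSpan F S) :=
  FiniteDimensional.span_of_finite F (S.finite_toSet.image _)

lemma monoSpan_finrank (F : Type*) [Field F] (S : Finset ℕ) :
    finrank F (monoSpan F S) = S.card := by
  have hli : LinearIndependent F (fun b : ℕ => (X : F[X]) ^ b) := by
    have := (Polynomial.basisMonomials F).linearIndependent
    convert this using 2 with b
    simp [Polynomial.X_pow_eq_monomial]
  have h2 : LinearIndependent F (fun b : S => (X : F[X]) ^ (b : ℕ)) :=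
    hli.comp _ Subtype.val_injective
  have h3 := finrank_span_eq_card h2
  rw [Fintype.card_coe] at h3
  have h4 : ((fun b : ℕ => (X : F[X]) ^ b) '' (S : Set ℕ)) =
      Set.range (fun b : S => (X : F[X]) ^ (b : ℕ)) := by
    ext; simp
  rw [← h3, monoSpan, h4]

lemma monoSpan_mul (F : Type*) [Field F] (S T : Finset ℕ) :
    monoSpan F S * monoSpan F T = monoSpan F (S + T) := by
  rw [monoSpan, monoSpan, monoSpan, Submodule.span_mul_span]
  congr 1
  ext f
  simp only [Set.mem_mul, Set.mem_image, Finset.mem_coe, Finset.mem_add]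
  constructor
  · rintro ⟨_, ⟨a, ha, rfl⟩, _, ⟨b, hb, rfl⟩, rfl⟩
    exact ⟨a + b, ⟨a, ha, b, hb, rfl⟩, pow_add _ _ _⟩
  · rintro ⟨_, ⟨a, ha, b, hb, rfl⟩, rfl⟩
    exact ⟨_, ⟨a, ha, rfl⟩, _, ⟨b, hb, rfl⟩, (pow_add _ _ _).symm⟩

lemma mem_monoSpan_of_support {F : Type*} [Field F] (S : Finset ℕ) (f : F[X])
    (hf : f.support ⊆ S) : f ∈ monoSpan F S := by
  rw [f.as_sum_support_C_mul_X_pow]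
  refine Submodule.sum_mem _ fun i hi => ?_
  rw [← smul_eq_C_mul]
  exact Submodule.smul_mem _ _ (Submodule.subset_span ⟨i, hf hi, rfl⟩)

lemma monoSpan_le_degreeLT {F : Type*} [Field F] (S : Finset ℕ) (n : ℕ)
    (h : ∀ b ∈ S, b < n) : monoSpan F S ≤ degreeLT F n := by
  rw [monoSpan, Submodule.span_le]
  rintro _ ⟨b, hb, rfl⟩
  simp only [SetLike.mem_coe, mem_degreeLT]
  rw [degree_X_pow]
  exact_mod_cast h b hb

variable {F L : Type*} [Field F] [Field L] [Algebra F L] [FiniteDimensional F L]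

theorem section_induction
    (hint : ∀ K : IntermediateField F L, K = ⊥ ∨ K = ⊤) (τ : L) (l : F[X]) (S : Finset ℕ)
    (h0 : 0 ∈ S) (n : ℕ) (hn : finrank F L = n) (hn1 : 1 ≤ n) (hdeg : l.natDegree = n)
    (hSn : ∀ b ∈ S, b ≤ n) (hsupp : l.support ⊆ S) (hker : ∀ f : F[X], aeval τ f = 0 ↔ l ∣ f)
    (c : ℕ) (hc : S.card = c + 2) :
    ∀ m : ℕ, ∀ V : Submodule F F[X], V ≤ degreeLT F m → ∀ E : ℕ,
      finrank F ↥(V * monoSpan F S) ≤ finrank F V + E → E < n →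
      ∃ J : ℕ, 2 * finrank F V + c * (J * (J + 1)) ≤ 2 * (J * E) := by
  have hl0 : l ≠ 0 := by rintro rfl; simp at hdeg; omega
  let μ : F[X] →ₗ[F] F[X] := LinearMap.mulLeft F l
  have hμ : Function.Injective μ := fun _ _ h => mul_left_cancel₀ hl0 h
  let ev : F[X] →ₗ[F] L := (aeval τ : F[X] →ₐ[F] L).toLinearMap
  have hk : LinearMap.ker ev = LinearMap.range μ := by
    ext f
    rw [LinearMap.mem_ker, LinearMap.mem_range]
    change aeval τ f = 0 ↔ _
    rw [hker]
    constructor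
    · rintro ⟨g, rfl⟩; exact ⟨g, rfl⟩
    · rintro ⟨g, rfl⟩; exact ⟨g, rfl⟩
  set U := monoSpan F S with hU
  haveI hUf : FiniteDimensional F U := monoSpan_finite F S
  have hlU : l ∈ U := mem_monoSpan_of_support S l hsupp
  have h1U : (1 : L) ∈ U.map ev := by
    refine ⟨1, Submodule.subset_span ⟨0, h0, by simp⟩, ?_⟩
    exact map_one (aeval τ)
  have hevU : c + 1 ≤ finrank F (U.map ev) := by
    have h1 := rank_split ev μ hμ hk U
    have h2 : U.comap μ ≤ Submodule.span F {1} := by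
      intro g hg
      have h3 : l * g ∈ degreeLT F (n + 1) :=
        monoSpan_le_degreeLT S (n + 1) (fun b hb => Nat.lt_succ_of_le (hSn b hb)) hg
      rw [mem_degreeLT] at h3
      by_cases hg0 : g = 0
      · rw [hg0]; exact Submodule.zero_mem _
      have h4 : (l * g).natDegree < n + 1 := by
        rw [natDegree_lt_iff_degree_lt (mul_ne_zero hl0 hg0)]; exact h3
      rw [natDegree_mul hl0 hg0, hdeg] at h4
      have h5 : g.natDegree = 0 := by omega
      rw [eq_C_of_natDegree_eq_zero h5, Submodule.mem_span_singleton]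
      exact ⟨g.coeff 0, by rw [smul_eq_C_mul, mul_one]⟩
    have h3 := Submodule.finrank_mono h2
    rw [finrank_span_singleton one_ne_zero] at h3
    rw [monoSpan_finrank] at h1
    omega
  intro m
  induction m with
  | zero =>
    intro V hV E _ _
    have : V = ⊥ := by
      rw [eq_bot_iff]
      intro f hf
      have := hV hf
      rw [mem_degreeLT] at this
      simpa using this
    subst this
    exact ⟨0, by rw [finrank_bot]; simp⟩
  | succ m ih =>
    intro V hV E hE hEn
    haveI : FiniteDimensional F V := Submodule.finiteDimensional_of_le hV
    haveI hDf : FiniteDimensional F ↥(V * U) := by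
      have h1 : V.FG := Module.Finite.iff_fg.1 inferInstance
      have h2 : U.FG := Module.Finite.iff_fg.1 inferInstance
      exact Module.Finite.iff_fg.2 (h1.mul h2)
    haveI : FiniteDimensional F (V.comap μ) := comap_finite μ hμ V
    haveI : FiniteDimensional F ((V * U).comap μ) := comap_finite μ hμ (V * U)
    have hVr := rank_split ev μ hμ hk V
    have hDr := rank_split ev μ hμ hk (V * U)
    have hVD : V ≤ (V * U).comap μ := by
      intro v hv
      change l * v ∈ V * U
      rw [mul_comm l v]; exact Submodule.mul_mem_mul hv hlU
    have hVD' := Submodule.finrank_mono hVD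
    have hV'D : V.comap μ * U ≤ (V * U).comap μ := by
      rw [Submodule.mul_le]
      intro v hv u hu
      change l * (v * u) ∈ V * U
      rw [← mul_assoc]; exact Submodule.mul_mem_mul hv hu
    have hV'D' := Submodule.finrank_mono hV'D
    have hevD : (V * U).map ev = V.map ev * U.map ev := Submodule.map_mul _ _ _
    have hV' : V.comap μ ≤ degreeLT F m := by
      intro f hf
      have h1 : l * f ∈ degreeLT F (m + 1) := hV hf
      rw [mem_degreeLT] at h1 ⊢
      by_cases hf0 : f = 0
      · rw [hf0, degree_zero]; exact WithBot.bot_lt_coe _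
      rw [← natDegree_lt_iff_degree_lt (mul_ne_zero hl0 hf0), natDegree_mul hl0 hf0, hdeg] at h1
      rw [← natDegree_lt_iff_degree_lt hf0]
      omega
    by_cases hw : V.map ev = ⊥
    · have hw0 : finrank F (V.map ev) = 0 := by rw [hw]; simp
      obtain ⟨J, hJ⟩ := ih (V.comap μ) hV' E (by omega) hEn
      exact ⟨J, by rw [hVr, hw0, zero_add]; exact hJ⟩
    · have hcd := linear_cauchy_davenport hint (U.map ev) h1U (V.map ev) hw (by
        rw [← hevD, Ne, eq_top_iff_finrank]; omega)
      rw [← hevD] at hcd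
      obtain ⟨e, rfl⟩ : ∃ e, E = e + c := ⟨E - c, by omega⟩
      obtain ⟨J, hJ⟩ := ih (V.comap μ) hV' e (by omega) (by omega)
      refine ⟨J + 1, ?_⟩
      have hwe : finrank F (V.map ev) ≤ e := by omega
      rw [hVr]
      nlinarith

end PartTwo
section PartThree

open Module Polynomial

lemma natDegree_minpoly_of_factor {F K L : Type*} [Field F] [Field K] [Field L] [Algebra F K]
    [Algebra F L] [Algebra K L] [IsScalarTower F K L] (τ : L) (l : F[X]) (n : ℕ)
    (hl : l.Monic) (hdeg : l.natDegree = n) (M : L[X])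
    (hM : l.map (algebraMap F L) = (X - C τ) * M) (hMirr : Irreducible M)
    (hτ : τ ∉ (algebraMap K L).range) : (minpoly K τ).natDegree = n := by
  have hroot : aeval τ l = 0 := by
    rw [aeval_def, ← eval_map, hM]; simp
  have hint : IsIntegral F τ := ⟨l, hl, hroot⟩
  have hintK : IsIntegral K τ := hint.tower_top
  have h1 : minpoly K τ ∣ l.map (algebraMap F K) := minpoly.dvd _ _ (by simpa using hroot)
  have h2 : (minpoly K τ).map (algebraMap K L) ∣ (X - C τ) * M := by
    rw [← hM, IsScalarTower.algebraMap_eq F K L, ← Polynomial.map_map]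
    exact Polynomial.map_dvd _ h1
  have h3 : (X - C τ) ∣ (minpoly K τ).map (algebraMap K L) := by
    rw [dvd_iff_isRoot, IsRoot.def, eval_map_algebraMap, minpoly.aeval]
  obtain ⟨q, hq⟩ := h3
  have hX : (X - C τ) ≠ 0 := X_sub_C_ne_zero τ
  have hq2 : q ∣ M := by
    rw [hq] at h2
    exact (mul_dvd_mul_iff_left hX).1 h2
  have hndeg : (minpoly K τ).natDegree = ((X - C τ) * q).natDegree := by
    rw [← hq, natDegree_map]
  have hMdeg : n = ((X - C τ) * M).natDegree := by
    rw [← hM, natDegree_map, hdeg]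
  have hq0 : q ≠ 0 := by
    rintro rfl
    exact hMirr.ne_zero (zero_dvd_iff.1 hq2)
  rcases hMirr.dvd_iff.1 hq2 with h | h
  · exfalso
    apply hτ
    rw [RingHom.mem_range]
    have h5 : (minpoly K τ).natDegree = 1 := by
      rw [hndeg, natDegree_mul hX hq0, natDegree_X_sub_C, natDegree_eq_zero_of_isUnit h]
    exact minpoly.natDegree_eq_one_iff.1 h5
  · rw [hndeg, hMdeg, natDegree_mul hX hq0, natDegree_mul hX hMirr.ne_zero,
      natDegree_eq_of_degree_eq (degree_eq_degree_of_associated h)]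

lemma simple_ext {F L : Type*} [Field F] [Field L] [Algebra F L] (τ : L)
    (hgen : IntermediateField.adjoin F {τ} = ⊤) (l : F[X]) (n : ℕ) (hn : 1 ≤ n)
    (hl : l.Monic) (hdeg : l.natDegree = n) (M : L[X])
    (hM : l.map (algebraMap F L) = (X - C τ) * M) (hMirr : Irreducible M)
    (hτ : τ ∉ (algebraMap F L).range) :
    FiniteDimensional F L ∧ finrank F L = n ∧
      (∀ K : IntermediateField F L, K = ⊥ ∨ K = ⊤) ∧
      ∀ f : F[X], aeval τ f = 0 ↔ l ∣ f := by
  have hroot : aeval τ l = 0 := by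
    rw [aeval_def, ← eval_map, hM]; simp
  have hint : IsIntegral F τ := ⟨l, hl, hroot⟩
  have hdegF := natDegree_minpoly_of_factor (K := F) τ l n hl hdeg M hM hMirr hτ
  have hmin : minpoly F τ = l := by
    symm
    refine eq_of_monic_of_dvd_of_natDegree_le (minpoly.monic hint) hl (minpoly.dvd _ _ hroot) ?_
    omega
  have hfin : finrank F L = n := by
    have := IntermediateField.adjoin.finrank hint
    rw [hgen, IntermediateField.finrank_top', hdegF] at this
    exact this
  have hfd : FiniteDimensional F L := Module.finite_of_finrank_pos (by omega)
  refine ⟨hfd, hfin, ?_, ?_⟩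
  · intro K
    by_cases hK : τ ∈ K
    · right
      rw [eq_top_iff, ← hgen, IntermediateField.adjoin_le_iff]
      simpa using hK
    · left
      have h1 := natDegree_minpoly_of_factor (K := K) τ l n hl hdeg M hM hMirr (by
        rintro ⟨x, hx⟩
        exact hK (hx ▸ x.2))
      have h2 : IntermediateField.adjoin K {τ} = ⊤ := by
        rw [eq_top_iff]
        intro x _
        have hx : x ∈ IntermediateField.adjoin F {τ} := by rw [hgen]; trivial
        have : IntermediateField.adjoin F {τ} ≤
            (IntermediateField.adjoin K {τ}).restrictScalars F := by
          rw [IntermediateField.adjoin_le_iff]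
          rintro y hy
          exact IntermediateField.subset_adjoin K _ hy
        exact this hx
      have h3 := IntermediateField.adjoin.finrank (K := K) (hint.tower_top : IsIntegral K τ)
      rw [h2, IntermediateField.finrank_top', h1] at h3
      have h4 := Module.finrank_mul_finrank F K L
      rw [h3, hfin] at h4
      rw [← IntermediateField.finrank_eq_one_iff]
      exact Nat.eq_of_mul_eq_mul_right (show 0 < n by omega) (by rw [h4, one_mul])
  · intro f
    rw [← hmin, minpoly.dvd_iff]

/-- Main claim, given a suitable field extension. -/
theorem star_of_field {F Q : Type*} [Field F] [Field Q] [Algebra F Q] (τ : Q)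
    (l : F[X]) (n : ℕ) (hn : 1 ≤ n)
    (hl : l.Monic) (hdeg : l.natDegree = n) (M : Q[X])
    (hM : l.map (algebraMap F Q) = (X - C τ) * M) (hMirr : Irreducible M)
    (hτ : τ ∉ (algebraMap F Q).range)
    (S : Finset ℕ) (h0 : 0 ∈ S) (hSn : ∀ b ∈ S, b ≤ n) (hsupp : l.support ⊆ S)
    (c : ℕ) (hc : S.card = c + 2) (A : Finset ℕ) (E : ℕ) (hE : (A + S).card ≤ A.card + E)
    (hEn : E < n) : ∃ J : ℕ, 2 * A.card + c * (J * (J + 1)) ≤ 2 * (J * E) := by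
  let t := IntermediateField.AdjoinSimple.gen F τ
  have ht : algebraMap (IntermediateField.adjoin F {τ}) Q t = τ :=
    IntermediateField.AdjoinSimple.algebraMap_gen F τ
  have hroot : aeval τ l = 0 := by
    rw [aeval_def, ← eval_map, hM]; simp
  have hroot' : aeval t l = 0 := by
    apply (algebraMap (IntermediateField.adjoin F {τ}) Q).injective
    rw [← aeval_algebraMap_apply, ht, hroot, map_zero]
  obtain ⟨M', hM'⟩ : (X - C t) ∣ l.map (algebraMap F (IntermediateField.adjoin F {τ})) := by
    rw [dvd_iff_isRoot, IsRoot.def, eval_map_algebraMap, hroot']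
  have hMM' : M'.map (algebraMap _ Q) = M := by
    apply mul_left_cancel₀ (X_sub_C_ne_zero τ)
    rw [← hM, IsScalarTower.algebraMap_eq F (IntermediateField.adjoin F {τ}) Q,
      ← Polynomial.map_map, hM', Polynomial.map_mul, Polynomial.map_sub, map_X, map_C, ht]
  have hmon : M'.Monic := by
    have : ((X - C t) * M').Monic := hM' ▸ hl.map _
    exact (monic_X_sub_C t).of_mul_monic_left this
  have hM'irr : Irreducible M' := hmon.irreducible_of_irreducible_map _ _ (hMM' ▸ hMirr)
  have hgen : IntermediateField.adjoin F {t} = ⊤ := by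
    apply IntermediateField.map_injective (IntermediateField.val _)
    rw [IntermediateField.adjoin_map, Set.image_singleton, ← AlgHom.fieldRange_eq_map,
      IntermediateField.fieldRange_val]
    congr 1
  obtain ⟨hfd, hfin, hint, hker⟩ := simple_ext t hgen l n hn hl hdeg M' hM' hM'irr (by
      rintro ⟨x, hx⟩
      apply hτ
      refine ⟨x, ?_⟩
      rw [IsScalarTower.algebraMap_apply F (IntermediateField.adjoin F {τ}) Q, hx, ht])
  have := section_induction hint t l S h0 n hfin hn hdeg hSn hsupp hker c hc
    (A.sup id + 1) (monoSpan F A) (monoSpan_le_degreeLT A _ fun b hb =>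
      Nat.lt_succ_of_le (Finset.le_sup (f := id) hb)) E (by
        rw [monoSpan_mul, monoSpan_finrank, monoSpan_finrank]; exact hE) hEn
  rwa [monoSpan_finrank] at this

end PartThree
section PartFour

open Module Polynomial

theorem star_of_hom {F Q : Type*} [Field F] [Field Q] (φ : F →+* Q) (τ : Q)
    (l : F[X]) (n : ℕ) (hn : 1 ≤ n)
    (hl : l.Monic) (hdeg : l.natDegree = n) (M : Q[X])
    (hM : l.map φ = (X - C τ) * M) (hMirr : Irreducible M)
    (hτ : τ ∉ φ.range)
    (S : Finset ℕ) (h0 : 0 ∈ S) (hSn : ∀ b ∈ S, b ≤ n) (hsupp : l.support ⊆ S)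
    (c : ℕ) (hc : S.card = c + 2) (A : Finset ℕ) (E : ℕ) (hE : (A + S).card ≤ A.card + E)
    (hEn : E < n) : ∃ J : ℕ, 2 * A.card + c * (J * (J + 1)) ≤ 2 * (J * E) := by
  letI := φ.toAlgebra
  exact star_of_field τ l n hn hl hdeg M hM hMirr hτ S h0 hSn hsupp c hc A E hE hEn

/-- The homogeneous geometric sum `(x^b - y^b)/(x - y)`. -/
def hgeom {R : Type*} [CommRing R] (b : ℕ) (x y : R) : R :=
  ∑ i ∈ Finset.range b, x ^ i * y ^ (b - 1 - i)

lemma mul_hgeom {R : Type*} [CommRing R] (b : ℕ) (x y : R) :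
    (x - y) * hgeom b x y = x ^ b - y ^ b := by
  rw [mul_comm]; exact (Commute.all x y).geom_sum₂_mul b

lemma map_hgeom {R R' : Type*} [CommRing R] [CommRing R'] (f : R →+* R') (b : ℕ) (x y : R) :
    f (hgeom b x y) = hgeom b (f x) (f y) := by
  simp [hgeom]

lemma C_hgeom {R : Type*} [CommRing R] (b : ℕ) (x y : R) :
    (C (hgeom b x y) : R[X]) = hgeom b (C x) (C y) :=
  map_hgeom C b x y

lemma factor_aux {R : Type*} [CommRing R] (a t : R) (n : ℕ) (T : Finset ℕ) :
    (X ^ n + C a * ∑ b ∈ T, X ^ b - C (t ^ n + a * ∑ b ∈ T, t ^ b) : R[X]) =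
      (X - C t) * (hgeom n X (C t) + C a * ∑ b ∈ T, hgeom b X (C t)) := by
  have h1 : (X - C t) * (hgeom n X (C t) + C a * ∑ b ∈ T, hgeom b X (C t)) =
      (X - C t) * hgeom n X (C t) + C a * ∑ b ∈ T, (X - C t) * hgeom b X (C t) := by
    rw [← Finset.mul_sum]; ring
  rw [h1]
  simp only [mul_hgeom, Finset.sum_sub_distrib, C_add, C_mul, C_pow, map_sum]
  ring

lemma shape {R : Type*} [CommRing R] [Nontrivial R] (a x : R) (n : ℕ) (hn : 1 ≤ n) (T : Finset ℕ)
    (hT : ∀ b ∈ T, b < n) :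
    (X ^ n + C a * ∑ b ∈ T, X ^ b - C x : R[X]).Monic ∧
    (X ^ n + C a * ∑ b ∈ T, X ^ b - C x : R[X]).natDegree = n ∧
    (X ^ n + C a * ∑ b ∈ T, X ^ b - C x : R[X]).support ⊆ insert 0 (insert n T) := by
  have hd : (C a * ∑ b ∈ T, X ^ b - C x : R[X]).degree < n := by
    rw [← mem_degreeLT]
    refine Submodule.sub_mem _ ?_ ?_
    · rw [← smul_eq_C_mul]
      refine Submodule.smul_mem _ _ (Submodule.sum_mem _ fun b hb => ?_)
      rw [mem_degreeLT, degree_X_pow]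
      exact_mod_cast hT b hb
    · rw [mem_degreeLT]
      refine lt_of_le_of_lt degree_C_le ?_
      exact_mod_cast hn
  rw [add_sub_assoc]
  refine ⟨monic_X_pow_add hd, ?_, ?_⟩
  · exact natDegree_eq_of_degree_eq_some (by
      rw [degree_add_eq_left_of_degree_lt (by rwa [degree_X_pow]), degree_X_pow])
  · intro k hk
    rw [Polynomial.mem_support_iff] at hk
    by_contra hne
    simp only [Finset.mem_insert, not_or] at hne
    apply hk
    obtain ⟨h1, h2, h3⟩ := hne
    simp only [coeff_add, coeff_sub, coeff_X_pow, coeff_C_mul, finset_sum_coeff, coeff_C]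
    rw [if_neg h2, if_neg h1, Finset.sum_eq_zero]
    · simp
    · intro b hb
      rw [if_neg]
      rintro rfl
      exact h3 hb

lemma relprime_aux (n : ℕ) (hn : 1 ≤ n) (T : Finset ℕ)
    (hgcd : ∀ k : ℕ, k ∣ n → (∀ b ∈ T, k ∣ b) → k = 1) :
    IsRelPrime (hgeom n (X : ℂ[X][X]) (C X)) (∑ b ∈ T, hgeom b (X : ℂ[X][X]) (C X)) := by
  intro d hd1 hd2
  have hmon : (hgeom n (X : ℂ[X][X]) (C X)).Monic := by
    have h := mul_hgeom n (X : ℂ[X][X]) (C X)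
    rw [← C_pow] at h
    exact (monic_X_sub_C X).of_mul_monic_left (h ▸ monic_X_pow_sub_C _ (by omega))
  have hlead : IsUnit d.leadingCoeff := by
    obtain ⟨e, he⟩ := hd1
    have : d.leadingCoeff * e.leadingCoeff = 1 := by
      rw [← leadingCoeff_mul, ← he]; exact hmon
    exact IsUnit.of_mul_eq_one _ this
  by_cases hdeg : d.natDegree = 0
  · rw [eq_C_of_natDegree_eq_zero hdeg]
    rw [leadingCoeff, hdeg] at hlead
    exact hlead.map C
  exfalso
  let K := AlgebraicClosure (FractionRing ℂ[X])
  let j : ℂ[X] →+* K := (algebraMap (FractionRing ℂ[X]) K).comp (algebraMap ℂ[X] _)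
  have hj : Function.Injective j :=
    (algebraMap (FractionRing ℂ[X]) K).injective.comp (IsFractionRing.injective _ _)
  obtain ⟨ρ, hρ⟩ : ∃ ρ : K, (d.map j).eval ρ = 0 := by
    have : (d.map j).degree ≠ 0 := by
      rw [degree_map_eq_of_injective hj]
      intro h
      exact hdeg (natDegree_eq_of_degree_eq_some h)
    exact IsAlgClosed.exists_root _ this
  rw [eval_map, ← coe_eval₂RingHom] at hρ
  let ψ : ℂ[X][X] →+* K := eval₂RingHom j ρ
  have hψX : ψ X = ρ := by simp [ψ]
  have hψC : ψ (C X) = j X := by simp [ψ]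
  have h1 : hgeom n ρ (j X) = 0 := by
    have h := map_dvd ψ hd1
    change ψ d = 0 at hρ
    rw [hρ, zero_dvd_iff, map_hgeom, hψX, hψC] at h
    exact h
  have h2 : ∑ b ∈ T, hgeom b ρ (j X) = 0 := by
    have h := map_dvd ψ hd2
    change ψ d = 0 at hρ
    rw [hρ, zero_dvd_iff, map_sum] at h
    simpa only [map_hgeom, hψX, hψC] using h
  have hθ : j X ≠ 0 := by
    rw [Ne, map_eq_zero_iff j hj]; exact X_ne_zero
  have h3 : ρ ^ n = (j X) ^ n := by
    have := mul_hgeom n ρ (j X)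
    rw [h1, mul_zero] at this
    exact (sub_eq_zero.1 this.symm)
  have hprim : IsPrimitiveRoot (j (C (Complex.exp (2 * Real.pi * Complex.I / n)))) n :=
    ((Complex.isPrimitiveRoot_exp n (by omega)).map_of_injective (f := (C : ℂ →+* ℂ[X]))
      C_injective).map_of_injective hj
  have : NeZero n := ⟨by omega⟩
  obtain ⟨i, _, hi⟩ := hprim.eq_pow_of_pow_eq_one (ξ := ρ / j X) (by
    rw [div_pow, h3, div_self (pow_ne_zero _ hθ)])
  obtain ⟨z, hz⟩ : ∃ z : ℂ, z = Complex.exp (2 * Real.pi * Complex.I / n) ^ i := ⟨_, rfl⟩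
  have hzn : z ^ n = 1 := by
    rw [hz, ← pow_mul, mul_comm i n, pow_mul, (Complex.isPrimitiveRoot_exp n (by omega)).pow_eq_one,
      one_pow]
  have hzρ : ρ = j (C z * X) := by
    rw [hz, C_pow, map_mul, map_pow, hi, div_mul_cancel₀ _ hθ]
  have h4 : (∑ b ∈ T, C (z ^ b - 1) * X ^ b : ℂ[X]) = 0 := by
    apply hj
    rw [map_zero, map_sum]
    have h5 : (ρ - j X) * ∑ b ∈ T, hgeom b ρ (j X) = 0 := by rw [h2, mul_zero]
    rw [Finset.mul_sum] at h5
    rw [← h5]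
    refine Finset.sum_congr rfl fun b _ => ?_
    rw [mul_hgeom, hzρ, ← map_pow, ← map_pow, ← map_sub]
    congr 1
    rw [mul_pow, C_sub, C_pow, C_1]; ring
  have h5 : ∀ b ∈ T, z ^ b = 1 := by
    intro b hb
    have := congrArg (fun f => coeff f b) h4
    simp only [finset_sum_coeff, coeff_C_mul, coeff_X_pow, coeff_zero] at this
    rw [Finset.sum_eq_single b] at this
    · simp at this
      exact sub_eq_zero.1 this
    · intro b' _ hne
      rw [if_neg (Ne.symm hne), mul_zero]
    · intro h; exact absurd hb h
  have h6 : orderOf z = 1 :=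
    hgcd _ (orderOf_dvd_of_pow_eq_one hzn) fun b hb => orderOf_dvd_of_pow_eq_one (h5 b hb)
  rw [orderOf_eq_one_iff] at h6
  rw [h6, C_1, one_mul] at hzρ
  rw [hzρ, hgeom] at h1
  have h7 : (n : ℂ[X]) * X ^ (n - 1) = 0 := by
    apply hj
    rw [map_zero, ← h1, map_mul, map_natCast, map_pow]
    rw [Finset.sum_congr rfl (g := fun _ => j X ^ (n - 1))]
    · simp
    · intro k hk
      rw [← pow_add]
      congr 1
      have := Finset.mem_range.1 hk
      omega
  have : (n : ℂ[X]) ≠ 0 := by exact_mod_cast (by omega : n ≠ 0)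
  exact (mul_ne_zero this (pow_ne_zero _ X_ne_zero)) h7

lemma irreducible_aux {k : Type*} [Field k] (n : ℕ) (hn : 2 ≤ n) (T : Finset ℕ)
    (hrel : IsRelPrime (hgeom n (X : k[X][X]) (C X)) (∑ b ∈ T, hgeom b (X : k[X][X]) (C X))) :
    Irreducible (hgeom n (X : k[X][X][X]) (C X) +
      C (C X) * ∑ b ∈ T, hgeom b (X : k[X][X][X]) (C X)) := by
  set g := hgeom n (X : k[X][X]) (C X) with hg
  set w := ∑ b ∈ T, hgeom b (X : k[X][X]) (C X) with hw
  have hw0 : w ≠ 0 := by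
    intro h
    have hu : IsUnit g := hrel dvd_rfl (h ▸ dvd_zero _)
    have h1 := mul_hgeom n (X : k[X][X]) (C X)
    rw [← hg, ← C_pow] at h1
    have h2 := congrArg natDegree h1
    rw [natDegree_X_pow_sub_C, natDegree_mul (X_sub_C_ne_zero _) hu.ne_zero,
      natDegree_X_sub_C, natDegree_eq_zero_of_isUnit hu] at h2
    omega
  have hirr : Irreducible (C w * X + C g : k[X][X][X]) := by
    apply irreducible_of_degree_eq_one_of_isRelPrime_coeff
    · exact degree_linear hw0
    · simpa using hrel
  let e1 : k[X][X][X] ≃+* k[X][X][X] := mapEquiv (Bivariate.swap (R := k)).toRingEquiv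
  let e2 : k[X][X][X] ≃+* k[X][X][X] := (Bivariate.swap (R := k[X])).toRingEquiv
  let e := e1.trans e2
  have e1T : e1 X = X := by simp [e1]
  have e1τ : e1 (C X) = C (C X) := by
    simp only [e1, mapEquiv_apply, map_C]
    congr 1
    exact Bivariate.swap_Y
  have e1c : e1 (C (C X)) = C X := by
    simp only [e1, mapEquiv_apply, map_C]
    congr 1
    exact Bivariate.swap_X
  have eT : e X = C X := by
    change e2 (e1 X) = _
    rw [e1T]; exact Bivariate.swap_Y
  have eτ : e (C X) = C (C X) := by
    change e2 (e1 _) = _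
    rw [e1τ]; exact Bivariate.swap_C_C _
  have ec : e (C (C X)) = X := by
    change e2 (e1 _) = _
    rw [e1c]; exact Bivariate.swap_X
  rw [← MulEquiv.irreducible_iff e]
  convert hirr using 1
  have hge : ∀ b, e (hgeom b (X : k[X][X][X]) (C X)) =
      C (hgeom b (X : k[X][X]) (C X)) := by
    intro b
    rw [C_hgeom b (X : k[X][X]) (C X)]
    simp only [hgeom, map_sum, map_mul, map_pow, eT, eτ]
  rw [map_add, map_mul, map_sum, ec, hge, hw, map_sum]
  simp only [hge]
  ring

theorem star_aux {k : Type*} [Field k] (S : Finset ℕ) (n : ℕ) (hn : 2 ≤ n) (h0 : 0 ∈ S) (hnS : n ∈ S)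
    (hSn : ∀ b ∈ S, b ≤ n) 
    (hrel : IsRelPrime (hgeom n (X : k[X][X]) (C X))
      (∑ b ∈ S.erase n, hgeom b (X : k[X][X]) (C X)))
    (c : ℕ) (hc : S.card = c + 2) (A : Finset ℕ) (E : ℕ) (hE : (A + S).card ≤ A.card + E)
    (hEn : E < n) : ∃ J : ℕ, 2 * A.card + c * (J * (J + 1)) ≤ 2 * (J * E) := by
  set T := S.erase n with hT
  have hTn : ∀ b ∈ T, b < n := fun b hb =>
    lt_of_le_of_ne (hSn b (Finset.mem_of_mem_erase hb)) (Finset.ne_of_mem_erase hb)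
  have hins : insert 0 (insert n T) = S := by
    rw [hT, Finset.insert_erase hnS, Finset.insert_eq_of_mem h0]
  have hirr := irreducible_aux n hn T hrel
  set M3 := (hgeom n (X : k[X][X][X]) (C X) +
      C (C X) * ∑ b ∈ T, hgeom b (X : k[X][X][X]) (C X)) with hM3
  let Q := FractionRing k[X][X]
  let ι : k[X][X] →+* Q := algebraMap _ _
  have hι : Function.Injective ι := IsFractionRing.injective _ _
  let p : k[X][X] := X ^ n + C X * ∑ b ∈ T, X ^ b
  have hpdeg : p.natDegree = n := by
    have := (shape (X : k[X]) 0 n (by omega) T hTn).2.1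
    simpa using this
  have hfac : (X ^ n + C (C X) * ∑ b ∈ T, X ^ b - C p : k[X][X][X]) = (X - C X) * M3 :=
    factor_aux (C X : k[X][X]) (X : k[X][X]) n T
  have hM3deg : M3.natDegree ≠ 0 := by
    intro h
    have h1 := congrArg natDegree hfac
    rw [(shape (C X : k[X][X]) p n (by omega) T hTn).2.1,
      natDegree_mul (X_sub_C_ne_zero _) hirr.ne_zero, h, natDegree_X_sub_C] at h1
    omega
  have hMirr : Irreducible (M3.map ι) :=
    (hirr.isPrimitive hM3deg).irreducible_iff_irreducible_map_fraction_map.1 hirr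
  let Φ : k[X][X] →+* k[X][X] := compRingHom p
  have hΦ0 : ∀ q, Φ q = 0 → q = 0 := by
    intro q hq
    rcases comp_eq_zero_iff.1 (show q.comp p = 0 from hq) with h | h
    · exact h
    · exfalso
      have := h.2
      rw [this, natDegree_C] at hpdeg
      omega
  have hΦ : Function.Injective Φ := (injective_iff_map_eq_zero Φ).2 hΦ0
  let φ : Q →+* Q := IsFractionRing.map hΦ
  have hφ : ∀ q, φ (ι q) = ι (Φ q) := fun q => IsLocalization.map_eq _ q
  obtain ⟨l1, l2, l3⟩ := shape (ι (C X)) (ι X) n (by omega) T hTn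
  refine star_of_hom φ (ι X) _ n (by omega) l1 l2 (M3.map ι) ?_ hMirr ?_ S h0 hSn
    (by rw [← hins]; exact l3) c hc A E hE hEn
  · have h1 := congrArg (Polynomial.map ι) hfac
    simp only [Polynomial.map_mul, Polynomial.map_sub, Polynomial.map_add, Polynomial.map_pow,
      map_X, map_C, Polynomial.map_sum] at h1 ⊢
    rw [← h1, hφ, hφ]
    simp [Φ]
  · rintro ⟨x, hx⟩
    obtain ⟨a, b, hb, rfl⟩ := IsFractionRing.div_surjective (A := k[X][X]) x
    have hb0 : b ≠ 0 := nonZeroDivisors.ne_zero hb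
    change φ (ι a / ι b) = _ at hx
    have hΦb : Φ b ≠ 0 := fun h => hb0 (hΦ0 b h)
    rw [map_div₀, hφ, hφ, div_eq_iff (by rwa [Ne, map_eq_zero_iff ι hι]), ← map_mul] at hx
    have h1 := congrArg natDegree (hι hx)
    rw [natDegree_mul X_ne_zero hΦb, natDegree_X] at h1
    change (a.comp p).natDegree = 1 + (b.comp p).natDegree at h1
    rw [natDegree_comp, natDegree_comp, hpdeg] at h1
    have h2 : n ∣ 1 := (Nat.dvd_add_left (Dvd.intro_left _ rfl)).1 (h1 ▸ Dvd.intro_left _ rfl)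
    have := Nat.le_of_dvd one_pos h2
    omega

/-- Main claim. -/
theorem star (S : Finset ℕ) (n : ℕ) (hn : 2 ≤ n) (h0 : 0 ∈ S) (hnS : n ∈ S)
    (hSn : ∀ b ∈ S, b ≤ n) (hgcd : ∀ k : ℕ, (∀ b ∈ S, k ∣ b) → k = 1)
    (c : ℕ) (hc : S.card = c + 2) (A : Finset ℕ) (E : ℕ) (hE : (A + S).card ≤ A.card + E)
    (hEn : E < n) : ∃ J : ℕ, 2 * A.card + c * (J * (J + 1)) ≤ 2 * (J * E) := by
  refine star_aux S n hn h0 hnS hSn (relprime_aux n (by omega) (S.erase n) ?_) c hc A E hE hEn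
  intro k hk hk2
  refine hgcd k fun b hb => ?_
  by_cases h : b = n
  · exact h ▸ hk
  · exact hk2 b (Finset.mem_erase.2 ⟨h, hb⟩)

end PartFour
section PartFive

lemma final_arith (a c s E J : ℤ) (hs : 1 ≤ s) (hc : 0 ≤ c) (hJ0 : 0 ≤ J)
    (h1 : (s - 1) * s * c + 2 * s - 2 < 2 * a) (h2 : 2 * a ≤ s * (s + 1) * c + 2 * s)
    (h3 : 2 * s * E < 2 * a + s * (s + 1) * c) (hJ : 2 * a + c * (J * (J + 1)) ≤ 2 * (J * E)) :
    False := by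
  rcases lt_trichotomy J s with h | h | h
  · have e1 := mul_le_mul_of_nonneg_left hJ (by omega : 0 ≤ s)
    have e2 := mul_le_mul_of_nonneg_left h3.le hJ0
    have e3 : (2 * a) * (s - J) ≤ (c * s * J) * (s - J) := by linarith
    have e4 : 2 * a ≤ c * s * J := le_of_mul_le_mul_right e3 (by omega)
    have e5 : c * s * J ≤ c * s * (s - 1) :=
      mul_le_mul_of_nonneg_left (by omega) (mul_nonneg hc (by omega))
    linarith
  · subst h
    linarith
  · have e1 : E ≤ (s + 1) * c := by
      by_contra hne
      have : (s + 1) * c + 1 ≤ E := by omega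
      have := mul_le_mul_of_nonneg_left this (by omega : 0 ≤ 2 * s)
      linarith
    have e2 := mul_le_mul_of_nonneg_left e1 (by omega : 0 ≤ 2 * (J - s))
    have e3 : 0 ≤ (J - s) * c * (J - s - 1) :=
      mul_nonneg (mul_nonneg (by omega) hc) (by omega)
    linarith

lemma reduce_gcd (A S : Finset ℕ) (g : ℕ) (hg : 0 < g) :
    ∃ A1 : Finset ℕ, A1.card = A.card ∧
      (A1 + S).card ≤ (A + S.image (fun t => g * t)).card := by
  obtain ⟨M, hM⟩ : ∃ M, M = A.sup id + 1 := ⟨_, rfl⟩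
  let φ : ℕ → ℕ := fun z => z / g + M * (z % g)
  refine ⟨A.image φ, Finset.card_image_of_injOn ?_, ?_⟩
  · intro x hx y hy hxy
    have hlt : ∀ z ∈ A, z / g < M := fun z hz => by
      have h1 : z ≤ A.sup id := Finset.le_sup (f := id) hz
      have h2 := Nat.div_le_self z g
      omega
    have hx' := hlt x hx
    have hy' := hlt y hy
    change x / g + M * (x % g) = y / g + M * (y % g) at hxy
    have h1 := congrArg (· % M) hxy
    simp only [Nat.add_mul_mod_self_left, Nat.mod_eq_of_lt hx', Nat.mod_eq_of_lt hy'] at h1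
    have h2 : M * (x % g) = M * (y % g) := by omega
    have h3 := Nat.eq_of_mul_eq_mul_left (by omega) h2
    rw [← Nat.div_add_mod x g, ← Nat.div_add_mod y g, h1, h3]
  · have : A.image φ + S ⊆ (A + S.image (fun t => g * t)).image φ := by
      intro z hz
      obtain ⟨_, hx, t, ht, rfl⟩ := Finset.mem_add.1 hz
      obtain ⟨x, hxA, rfl⟩ := Finset.mem_image.1 hx
      refine Finset.mem_image.2 ⟨x + g * t, Finset.add_mem_add hxA
        (Finset.mem_image_of_mem _ ht), ?_⟩
      simp only [φ, Nat.add_mul_div_left _ _ hg, Nat.add_mul_mod_self_left]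
      ring
    exact (Finset.card_le_card this).trans Finset.card_image_le

end PartFive

theorem stmt_8 (A B : Finset ℤ) (hA : A.Nonempty) (hB : 3 ≤ B.card)
    (s : ℤ) (hs : 1 ≤ s)
    (hs1 : ((s : ℚ) - 1) * s * ((B.card : ℚ) / 2 - 1) + s - 1 < (A.card : ℚ))
    (hs2 : (A.card : ℚ) ≤ s * (s + 1) * ((B.card : ℚ) / 2 - 1) + s)
    (r : ℤ) (hr : ((A + B).card : ℤ) = A.card + B.card + r)
    (hsmall : (((A + B).card : ℚ)) < ((A.card : ℚ) / s + (B.card : ℚ) / 2 - 1) * (s + 1)) :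
    ∃ (x d : ℤ) (k : ℕ), 1 ≤ d ∧
      B ⊆ (Finset.range k).image (fun i : ℕ => x + (i : ℤ) * d) ∧
      (k : ℤ) ≤ B.card + r + 1 := by
  have hBne : B.Nonempty := Finset.card_pos.1 (by omega)
  obtain ⟨m, hm⟩ : ∃ m, m = B.min' hBne := ⟨_, rfl⟩
  have hmB : m ∈ B := hm ▸ B.min'_mem hBne
  have hmle : ∀ b ∈ B, m ≤ b := fun b hb => hm ▸ B.min'_le b hb
  obtain ⟨a0, ha0⟩ : ∃ m, m = A.min' hA := ⟨_, rfl⟩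
  have hale : ∀ b ∈ A, a0 ≤ b := fun b hb => ha0 ▸ A.min'_le b hb
  obtain ⟨D, hD⟩ : ∃ D, D = B.image (fun b => (b - m).toNat) := ⟨_, rfl⟩
  obtain ⟨A0, hA0⟩ : ∃ D, D = A.image (fun b => (b - a0).toNat) := ⟨_, rfl⟩
  have hDcard : D.card = B.card := by
    rw [hD]
    refine Finset.card_image_of_injOn fun x hx y hy h => ?_
    have := hmle x hx
    have := hmle y hy
    omega
  have hA0card : A0.card = A.card := by
    rw [hA0]
    refine Finset.card_image_of_injOn fun x hx y hy h => ?_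
    have := hale x hx
    have := hale y hy
    omega
  have hsum : (A0 + D).card ≤ (A + B).card := by
    have : A0 + D ⊆ (A + B).image (fun z => (z - a0 - m).toNat) := by
      intro z hz
      obtain ⟨x, hx, y, hy, rfl⟩ := Finset.mem_add.1 hz
      rw [hA0] at hx
      rw [hD] at hy
      obtain ⟨a, ha, rfl⟩ := Finset.mem_image.1 hx
      obtain ⟨b, hb, rfl⟩ := Finset.mem_image.1 hy
      refine Finset.mem_image.2 ⟨a + b, Finset.add_mem_add ha hb, ?_⟩
      have := hale a ha
      have := hmle b hb
      omega
    exact (Finset.card_le_card this).trans Finset.card_image_le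
  have hD0 : 0 ∈ D := by
    rw [hD]; exact Finset.mem_image.2 ⟨m, hmB, by simp⟩
  obtain ⟨g, hg⟩ : ∃ g, g = D.gcd id := ⟨_, rfl⟩
  have hgD : ∀ b ∈ D, g ∣ b := fun b hb => hg ▸ Finset.gcd_dvd (f := id) hb
  have hgpos : 0 < g := by
    rw [Nat.pos_iff_ne_zero]
    intro h
    have : D ⊆ {0} := by
      intro b hb
      have := hgD b hb
      rw [h, zero_dvd_iff] at this
      simpa using this
    have := Finset.card_le_card this
    simp at this
    omega
  obtain ⟨S, hS⟩ : ∃ S, S = D.image (fun b => b / g) := ⟨_, rfl⟩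
  have hSD : S.image (fun t => g * t) = D := by
    rw [hS, Finset.image_image]
    conv_rhs => rw [← Finset.image_id (s := D)]
    refine Finset.image_congr fun b hb => ?_
    simp only [Function.comp, id]
    exact Nat.mul_div_cancel' (hgD b hb)
  have hScard : S.card = B.card := by
    rw [← hDcard, ← hSD]
    exact (Finset.card_image_of_injective _ fun x y h => Nat.eq_of_mul_eq_mul_left hgpos h).symm
  have hS0 : 0 ∈ S := by
    rw [hS]; exact Finset.mem_image.2 ⟨0, hD0, by simp⟩
  have hSne : S.Nonempty := ⟨0, hS0⟩
  obtain ⟨n, hn⟩ : ∃ n, n = S.max' hSne := ⟨_, rfl⟩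
  have hnS : n ∈ S := hn ▸ S.max'_mem hSne
  have hSn : ∀ b ∈ S, b ≤ n := fun b hb => hn ▸ S.le_max' b hb
  have hncard : S.card ≤ n + 1 := by
    have : S ⊆ Finset.range (n + 1) := fun b hb =>
      Finset.mem_range.2 (Nat.lt_succ_of_le (hSn b hb))
    simpa using Finset.card_le_card this
  have hgcd : ∀ k : ℕ, (∀ b ∈ S, k ∣ b) → k = 1 := by
    intro k hk
    have h1 : g * k ∣ g := by
      conv_rhs => rw [hg]
      refine Finset.dvd_gcd fun b hb => ?_
      rw [← hSD] at hb
      obtain ⟨t, ht, rfl⟩ := Finset.mem_image.1 hb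
      exact mul_dvd_mul_left g (hk t ht)
    have h2 : g * k ∣ g * 1 := by rwa [mul_one]
    exact Nat.dvd_one.1 ((Nat.mul_dvd_mul_iff_left hgpos).1 h2)
  by_cases hbig : (n : ℤ) ≤ B.card + r
  · refine ⟨m, g, n + 1, by omega, ?_, by push_cast; omega⟩
    intro b hb
    have hbD : (b - m).toNat ∈ S.image (fun t => g * t) := by
      rw [hSD, hD]; exact Finset.mem_image_of_mem _ hb
    obtain ⟨t, ht, htb⟩ := Finset.mem_image.1 hbD
    refine Finset.mem_image.2 ⟨t, Finset.mem_range.2 (Nat.lt_succ_of_le (hSn t ht)), ?_⟩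
    have h1 := hmle b hb
    have h2 : ((g * t : ℕ) : ℤ) = b - m := by
      rw [htb]; omega
    push_cast at h2
    linarith
  exfalso
  have hAB : A.card ≤ (A + B).card := Finset.card_le_card_add_right hBne
  obtain ⟨E, hE⟩ : ∃ E, (A + B).card = A.card + E := ⟨(A + B).card - A.card, by omega⟩
  obtain ⟨c, hc⟩ : ∃ c, B.card = c + 2 := ⟨B.card - 2, by omega⟩
  obtain ⟨A1, hA1, hA1S⟩ := reduce_gcd A0 S g hgpos
  rw [hSD] at hA1S
  obtain ⟨J, hJ⟩ := star S n (by omega) hS0 hnS hSn hgcd c (by omega) A1 E (by omega) (by omega)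
  rw [hA1, hA0card] at hJ
  have hsq : (1 : ℚ) ≤ s := by exact_mod_cast hs
  rw [hc] at hs1 hs2 hsmall
  rw [hE] at hsmall
  push_cast at hs1 hs2 hsmall
  refine final_arith A.card c s E J hs (by omega) (by omega) ?_ ?_ ?_ (by exact_mod_cast hJ)
  · have : ((s : ℚ) - 1) * s * c + 2 * s - 2 < 2 * A.card := by linarith
    exact_mod_cast this
  · have : (2 : ℚ) * A.card ≤ s * (s + 1) * c + 2 * s := by linarith
    exact_mod_cast this
  · have h1 := mul_lt_mul_of_pos_left hsmall (by linarith : (0 : ℚ) < s)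
    have h2 : (s : ℚ) * (((A.card : ℚ) / s + ((c : ℚ) + 2) / 2 - 1) * (s + 1)) =
        (A.card + s * c / 2) * (s + 1) := by
      have : (s : ℚ) ≠ 0 := by linarith
      field_simp
      ring
    rw [h2] at h1
    have : (2 : ℚ) * s * E < 2 * A.card + s * (s + 1) * c := by linarith
    exact_mod_cast this
end

section
/- Let A, B ⊆ ℤ be finite nonempty subsets. Suppose |A + B| = |A| + |B| + r < |A| + |B|/2 - 1 + 2√(|A|(|B|/2 - 1)). Then there exists an arithmetic progression P_B ⊆ ℤ with B ⊆ P_B and |P_B| ≤ |B| + r + 1. -/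
open Pointwise

set_option linter.unusedSectionVars false

section Kneser
variable {G : Type*} [AddCommGroup G] [Fintype G] [DecidableEq G]

/-- The stabilizer of a finite set. -/
def stb (C : Finset G) : AddSubgroup G where
  carrier := {g | ∀ x, x + g ∈ C ↔ x ∈ C}
  zero_mem' := by intro x; simp
  add_mem' := by
    intro a b ha hb x
    rw [← add_assoc, hb, ha]
  neg_mem' := by
    intro a ha x
    have := ha (x + -a)
    rw [neg_add_cancel_right] at this
    exact this.symm

lemma mem_stb {C : Finset G} {g : G} : g ∈ stb C ↔ ∀ x, x + g ∈ C ↔ x ∈ C := Iff.rfl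

lemma mem_stb_of_le {C : Finset G} {g : G} (h : ∀ x ∈ C, x + g ∈ C) : g ∈ stb C := by
  have h1 : C.image (· + g) = C := by
    apply Finset.eq_of_subset_of_card_le
    · intro y hy
      obtain ⟨x, hx, rfl⟩ := Finset.mem_image.1 hy
      exact h x hx
    · rw [Finset.card_image_of_injective _ (add_left_injective g)]
  intro x
  refine ⟨fun hx => ?_, h x⟩
  rw [← h1] at hx
  obtain ⟨y, hy, hxy⟩ := Finset.mem_image.1 hx
  have : y = x := add_right_cancel hxy
  exact this ▸ hy

open scoped Classical in
/-- A subgroup as a finite set. -/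
noncomputable def hs (H : AddSubgroup G) : Finset G := Finset.univ.filter (· ∈ H)

lemma mem_hs {H : AddSubgroup G} {g : G} : g ∈ hs H ↔ g ∈ H := by simp [hs]

lemma hs_pos (H : AddSubgroup G) : 0 < (hs H).card :=
  Finset.card_pos.2 ⟨0, mem_hs.2 H.zero_mem⟩

lemma union_aux (C1 C2 : Finset G) (x : G) (hx1 : x ∈ C1) (hx2 : x ∉ C2)
    (h1 : (C2 \ C1).card + (hs (stb C1 ⊓ stb C2)).card < (hs (stb C1)).card)
    (h2 : (C1 \ C2).card + (hs (stb C1 ⊓ stb C2)).card < (hs (stb C2)).card) :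
    (hs (stb C1)).card < (hs (stb C2)).card := by
  set H1 := stb C1 with hH1
  set H2 := stb C2 with hH2
  set M := hs (H1 ⊓ H2) with hM
  have hMpos : 0 < M.card := hs_pos _
  have memM : ∀ g, g ∈ M ↔ g ∈ H1 ∧ g ∈ H2 := by
    intro g; rw [hM, mem_hs, AddSubgroup.mem_inf]
  set U := (hs H2).filter (fun g => x + g ∈ C1) with hU
  set q := (hs H2).filter (fun g => ¬ (x + g ∈ C1)) with hq
  set V := (hs H1).filter (fun g => x + g ∈ C2) with hV
  set P := (hs H1).filter (fun g => ¬ (x + g ∈ C2)) with hP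
  have e1 : V.card + P.card = (hs H1).card := Finset.card_filter_add_card_filter_not _
  have e2 : U.card + q.card = (hs H2).card := Finset.card_filter_add_card_filter_not _
  have gen : ∀ (S T C : Finset G), S ⊆ hs H2 → T ⊆ hs H1 →
      (∀ g ∈ S, ∀ g' ∈ T, x + g + g' ∈ C) → S.card * T.card ≤ M.card * C.card := by
    intro S T C hS hT h
    have hmap : ∀ y ∈ S ×ˢ T, x + y.1 + y.2 ∈ C := by
      intro y hy
      rw [Finset.mem_product] at hy
      exact h _ hy.1 _ hy.2
    have := Finset.card_le_mul_card_image_of_maps_to (s := S ×ˢ T) (t := C)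
      (f := fun y => x + y.1 + y.2) hmap M.card (by
        intro c hc
        by_cases hne : ((S ×ˢ T).filter (fun y => x + y.1 + y.2 = c)).Nonempty
        · obtain ⟨y0, hy0⟩ := hne
          rw [Finset.mem_filter, Finset.mem_product] at hy0
          apply Finset.card_le_card_of_injOn (fun y => y.1 - y0.1)
          · intro y hy
            simp only [Finset.coe_filter, Finset.mem_product, Set.mem_ofPred_eq] at hy
            rw [Finset.mem_coe, memM]
            have e : y.1 - y0.1 = y0.2 - y.2 := by
              have h3 := hy.2.trans hy0.2.symm
              have : y.1 + y.2 = y0.1 + y0.2 := by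
                rw [add_assoc, add_assoc] at h3; exact add_left_cancel h3
              rw [sub_eq_sub_iff_add_eq_add, this, add_comm]
            refine ⟨?_, ?_⟩
            · show y.1 - y0.1 ∈ H1
              rw [e]; exact H1.sub_mem (mem_hs.1 (hT hy0.1.2)) (mem_hs.1 (hT hy.1.2))
            · exact H2.sub_mem (mem_hs.1 (hS hy.1.1)) (mem_hs.1 (hS hy0.1.1))
          · intro y hy z hz hyz
            simp only [Finset.coe_filter, Finset.mem_product, Set.mem_ofPred_eq] at hy hz
            have h1 : y.1 = z.1 := sub_left_injective hyz
            have h3 := hy.2.trans hz.2.symm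
            rw [h1] at h3
            exact Prod.ext h1 (add_left_cancel h3)
        · rw [Finset.not_nonempty_iff_eq_empty] at hne
          rw [hne]; simp)
    rw [Finset.card_product] at this
    exact this
  have i1 : U.card * P.card ≤ M.card * (C1 \ C2).card := by
    apply gen U P _ (Finset.filter_subset _ _) (Finset.filter_subset _ _)
    intro g hg g' hg'
    rw [hU, Finset.mem_filter, mem_hs] at hg
    rw [hP, Finset.mem_filter, mem_hs] at hg'
    rw [Finset.mem_sdiff]
    refine ⟨(hg'.1 _).2 hg.2, fun h => hg'.2 ?_⟩
    rw [add_right_comm] at h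
    exact (hg.1 _).1 h
  have i2 : q.card * V.card ≤ M.card * (C2 \ C1).card := by
    apply gen q V _ (Finset.filter_subset _ _) (Finset.filter_subset _ _)
    intro g hg g' hg'
    rw [hq, Finset.mem_filter, mem_hs] at hg
    rw [hV, Finset.mem_filter, mem_hs] at hg'
    rw [Finset.mem_sdiff]
    refine ⟨?_, fun h => hg.2 ((hg'.1 _).1 h)⟩
    rw [add_right_comm]
    exact (hg.1 _).2 hg'.2
  have big : ∀ (S : Finset G) (g : G), (∀ m ∈ M, g + m ∈ S) → M.card ≤ S.card := by
    intro S g h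
    exact Finset.card_le_card_of_injOn (fun m => g + m) (fun m hm => h m hm)
      (fun a _ b _ hab => add_left_cancel hab)
  have l1 : M.card ≤ U.card := by
    apply big U 0
    intro m hm
    rw [memM] at hm
    rw [hU, Finset.mem_filter, mem_hs, zero_add]
    exact ⟨hm.2, (hm.1 _).2 hx1⟩
  have l2 : M.card ≤ P.card := by
    apply big P 0
    intro m hm
    rw [memM] at hm
    rw [hP, Finset.mem_filter, mem_hs, zero_add]
    exact ⟨hm.1, fun h => hx2 ((hm.2 _).1 h)⟩
  have l3 : V.card = 0 ∨ M.card ≤ V.card := by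
    rcases V.eq_empty_or_nonempty with h | ⟨g, hg⟩
    · left; rw [h]; rfl
    · right
      apply big V g
      intro m hm
      rw [memM] at hm
      rw [hV, Finset.mem_filter, mem_hs] at hg ⊢
      refine ⟨H1.add_mem hg.1 hm.1, ?_⟩
      rw [← add_assoc]
      exact (hm.2 _).2 hg.2
  have l4 : q.card = 0 ∨ M.card ≤ q.card := by
    rcases q.eq_empty_or_nonempty with h | ⟨g, hg⟩
    · left; rw [h]; rfl
    · right
      apply big q g
      intro m hm
      rw [memM] at hm
      rw [hq, Finset.mem_filter, mem_hs] at hg ⊢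
      refine ⟨H2.add_mem hg.1 hm.2, ?_⟩
      rw [← add_assoc]
      exact fun h => hg.2 ((hm.1 _).1 h)
  rw [← e1] at h1 ⊢
  rw [← e2] at h2 ⊢
  generalize U.card = u at *
  generalize V.card = v at *
  generalize P.card = p at *
  generalize q.card = q' at *
  generalize M.card = m at *
  have j1 : u * p + m * m < m * (u + q') := by
    have := Nat.mul_lt_mul_of_pos_left h2 hMpos
    rw [mul_add] at this; omega
  have j2 : q' * v + m * m < m * (v + p) := by
    have := Nat.mul_lt_mul_of_pos_left h1 hMpos
    rw [mul_add] at this; omega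
  rcases l4 with h4 | h4
  · exfalso; subst h4; nlinarith
  rcases l3 with h3 | h3
  · subst h3; nlinarith
  · exfalso
    have k1 : p < q' := by nlinarith
    have k2 : q' < p := by nlinarith
    omega

lemma union_stb (C1 C2 : Finset G) (t : ℕ) (h1 : t ≤ C1.card + (hs (stb C1)).card)
    (h2 : t ≤ C2.card + (hs (stb C2)).card) :
    t ≤ (C1 ∪ C2).card + (hs (stb (C1 ∪ C2))).card := by
  by_contra hcon
  push Not at hcon
  have hM : (hs (stb C1 ⊓ stb C2)).card ≤ (hs (stb (C1 ∪ C2))).card := by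
    apply Finset.card_le_card
    intro g hg
    rw [mem_hs, AddSubgroup.mem_inf] at hg
    rw [mem_hs, mem_stb]
    intro x
    rw [Finset.mem_union, Finset.mem_union, hg.1 x, hg.2 x]
  have c1 : (C1 ∪ C2).card = C1.card + (C2 \ C1).card := by
    rw [← Finset.union_sdiff_self_eq_union, Finset.card_union_of_disjoint Finset.disjoint_sdiff]
  have c2 : (C1 ∪ C2).card = C2.card + (C1 \ C2).card := by
    rw [Finset.union_comm, ← Finset.union_sdiff_self_eq_union,
      Finset.card_union_of_disjoint Finset.disjoint_sdiff]
  by_cases s1 : C1 ⊆ C2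
  · rw [Finset.union_eq_right.2 s1] at hcon; omega
  by_cases s2 : C2 ⊆ C1
  · rw [Finset.union_eq_left.2 s2] at hcon; omega
  obtain ⟨x, hx1, hx2⟩ := Finset.not_subset.1 s1
  obtain ⟨y, hy1, hy2⟩ := Finset.not_subset.1 s2
  have a1 := union_aux C1 C2 x hx1 hx2 (by omega) (by omega)
  have a2 := union_aux C2 C1 y hy1 hy2 (by rw [inf_comm]; omega) (by rw [inf_comm]; omega)
  omega

lemma kneser_pt (A B : Finset G) (a0 b0 : G) (ha : a0 ∈ A) (hb : b0 ∈ B) :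
    ∃ D ⊆ A + B, a0 + b0 ∈ D ∧ A.card + B.card ≤ D.card + (hs (stb D)).card := by
  classical
  set S := (Finset.univ : Finset (Finset G × Finset G)).filter
    (fun z => A ⊆ z.1 ∧ b0 ∈ z.2 ∧ z.1 + z.2 ⊆ A + B ∧ z.1.card + z.2.card = A.card + B.card)
    with hS
  have hne : S.Nonempty := ⟨(A, B), by simp [hS, hb]⟩
  obtain ⟨⟨A', B'⟩, hz, hmax⟩ := Finset.exists_max_image S (fun z => z.1.card) hne
  simp only [hS, Finset.mem_filter, Finset.mem_univ, true_and] at hz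
  obtain ⟨z1, z2, z3, z4⟩ := hz
  have key : ∀ a ∈ A', ∀ b ∈ B', a + (b - b0) ∈ A' := by
    intro a haA
    set e := a - b0 with he
    set A'' := A' ∪ B'.image (· + e) with hA''
    set B'' := B'.filter (fun b => b + e ∈ A') with hB''
    have hcard : A''.card + B''.card = A'.card + B'.card := by
      have h1 : A''.card = A'.card + (B'.filter (fun b => ¬ (b + e ∈ A'))).card := by
        rw [hA'', ← Finset.union_sdiff_self_eq_union,
          Finset.card_union_of_disjoint Finset.disjoint_sdiff]
        have e0 : (B'.image (· + e)) \ A' = (B'.filter (fun b => ¬ (b + e ∈ A'))).image (· + e) := by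
          ext y
          simp only [Finset.mem_sdiff, Finset.mem_image, Finset.mem_filter]
          constructor
          · rintro ⟨⟨b, hb, rfl⟩, h⟩; exact ⟨b, ⟨hb, h⟩, rfl⟩
          · rintro ⟨b, ⟨hb, h⟩, rfl⟩; exact ⟨⟨b, hb, rfl⟩, h⟩
        rw [e0, Finset.card_image_of_injective _ (add_left_injective e)]
      have h2 : B''.card + (B'.filter (fun b => ¬ (b + e ∈ A'))).card = B'.card :=
        Finset.card_filter_add_card_filter_not _
      omega
    have hmem : (A'', B'') ∈ S := by
      simp only [hS, Finset.mem_filter, Finset.mem_univ, true_and]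
      refine ⟨z1.trans Finset.subset_union_left, ?_, ?_, by omega⟩
      · rw [hB'', Finset.mem_filter]
        refine ⟨z2, ?_⟩
        rw [he]; simpa using haA
      · intro y hy
        obtain ⟨u, hu, v, hv, rfl⟩ := Finset.mem_add.1 hy
        rw [hB'', Finset.mem_filter] at hv
        rw [hA'', Finset.mem_union] at hu
        apply z3
        rcases hu with hu | hu
        · exact Finset.add_mem_add hu hv.1
        · obtain ⟨b, hb, rfl⟩ := Finset.mem_image.1 hu
          have : b + e + v = (v + e) + b := by abel
          rw [this]
          exact Finset.add_mem_add hv.2 hb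
    have hle := hmax _ hmem
    simp only at hle
    have heq : A' = A'' := Finset.eq_of_subset_of_card_le Finset.subset_union_left hle
    intro b hbB
    rw [heq, hA'', Finset.mem_union]
    right
    rw [Finset.mem_image]
    exact ⟨b, hbB, by rw [he]; abel⟩
  refine ⟨A'.image (· + b0), ?_, ?_, ?_⟩
  · intro y hy
    obtain ⟨a, ha, rfl⟩ := Finset.mem_image.1 hy
    exact z3 (Finset.add_mem_add ha z2)
  · exact Finset.mem_image.2 ⟨a0, z1 ha, rfl⟩
  · rw [← z4, Finset.card_image_of_injective _ (add_left_injective b0)]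
    apply Nat.add_le_add_left
    apply Finset.card_le_card_of_injOn (fun b => b - b0)
    · intro b hbB
      rw [Finset.mem_coe, mem_hs]
      apply mem_stb_of_le
      intro x hx
      obtain ⟨a, ha, rfl⟩ := Finset.mem_image.1 hx
      refine Finset.mem_image.2 ⟨a + (b - b0), key a ha b hbB, ?_⟩
      simp only
      abel
    · intro b _ c _ h
      exact sub_left_injective h

lemma kneser_weak (A B : Finset G) (hA : A.Nonempty) (hB : B.Nonempty) :
    A.card + B.card ≤ (A + B).card + (hs (stb (A + B))).card := by
  classical
  set S := (A + B).powerset.filter (fun D => A.card + B.card ≤ D.card + (hs (stb D)).card) with hS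
  obtain ⟨a0, ha⟩ := hA
  obtain ⟨b0, hb⟩ := hB
  obtain ⟨D0, h1, h2, h3⟩ := kneser_pt A B a0 b0 ha hb
  have hne : S.Nonempty := ⟨D0, by simp only [hS, Finset.mem_filter, Finset.mem_powerset]; exact ⟨h1, h3⟩⟩
  obtain ⟨D, hD, hmax⟩ := Finset.exists_max_image S Finset.card hne
  simp only [hS, Finset.mem_filter, Finset.mem_powerset] at hD
  have : A + B ⊆ D := by
    intro y hy
    obtain ⟨a, ha, b, hb, rfl⟩ := Finset.mem_add.1 hy
    obtain ⟨E, e1, e2, e3⟩ := kneser_pt A B a b ha hb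
    have hm : D ∪ E ∈ S := by
      simp only [hS, Finset.mem_filter, Finset.mem_powerset]
      exact ⟨Finset.union_subset hD.1 e1, union_stb D E _ hD.2 e3⟩
    have := Finset.eq_of_subset_of_card_le Finset.subset_union_left (hmax _ hm)
    rw [this]
    exact Finset.mem_union_right _ e2
  rw [← Finset.Subset.antisymm hD.1 this]
  exact hD.2

end Kneser

open Pointwise
set_option linter.unusedSectionVars false

section Quot
variable {G : Type*} [AddCommGroup G] [Fintype G] [DecidableEq G]

noncomputable instance decQ (H : AddSubgroup G) : DecidableEq (G ⧸ H) := Classical.decEq _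
noncomputable instance finQ (H : AddSubgroup G) : Fintype (G ⧸ H) := Fintype.ofFinite _

/-- The quotient map. -/
def qm (H : AddSubgroup G) : G →+ G ⧸ H := QuotientAddGroup.mk' H

lemma qm_surj (H : AddSubgroup G) : Function.Surjective (qm H) := QuotientAddGroup.mk'_surjective H

lemma qm_eq {H : AddSubgroup G} {x y : G} : qm H x = qm H y ↔ y - x ∈ H := by
  unfold qm
  rw [QuotientAddGroup.mk'_eq_mk']
  constructor
  · rintro ⟨z, hz, rfl⟩; simpa using hz
  · intro h; exact ⟨_, h, by abel⟩

/-- Image in the quotient. -/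
noncomputable def im (H : AddSubgroup G) (S : Finset G) : Finset (G ⧸ H) := S.image (qm H)

/-- Preimage from the quotient. -/
noncomputable def pre (H : AddSubgroup G) (W : Finset (G ⧸ H)) : Finset G :=
  Finset.univ.filter (fun x => qm H x ∈ W)

lemma mem_pre {H : AddSubgroup G} {W : Finset (G ⧸ H)} {x : G} : x ∈ pre H W ↔ qm H x ∈ W := by
  simp [pre]

lemma mem_im {H : AddSubgroup G} {S : Finset G} {y : G ⧸ H} :
    y ∈ im H S ↔ ∃ x ∈ S, qm H x = y := by
  simp [im]

lemma im_add (H : AddSubgroup G) (S T : Finset G) : im H (S + T) = im H S + im H T := by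
  unfold im; exact Finset.image_add (qm H)

lemma card_row (H : AddSubgroup G) (y : G ⧸ H) :
    (Finset.univ.filter (fun x => qm H x = y)).card = (hs H).card := by
  obtain ⟨x0, rfl⟩ := qm_surj H y
  symm
  apply Finset.card_bij (fun h _ => x0 + h)
  · intro h hh
    rw [Finset.mem_filter]
    refine ⟨Finset.mem_univ _, ?_⟩
    rw [eq_comm, qm_eq]
    simpa using mem_hs.1 hh
  · intro a _ b _ h; exact add_left_cancel h
  · intro x hx
    rw [Finset.mem_filter, eq_comm, qm_eq] at hx
    exact ⟨x - x0, mem_hs.2 hx.2, by abel⟩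

lemma card_pre (H : AddSubgroup G) (W : Finset (G ⧸ H)) :
    (pre H W).card = (hs H).card * W.card := by
  rw [Finset.card_eq_sum_card_fiberwise (s := pre H W) (t := W) (f := qm H)
    (fun x hx => mem_pre.1 hx)]
  rw [Finset.sum_const_nat (m := (hs H).card), mul_comm]
  intro y hy
  rw [← card_row H y]
  congr 1
  ext x
  simp only [Finset.mem_filter, mem_pre, Finset.mem_univ, true_and]
  constructor
  · rintro ⟨_, h⟩; exact h
  · rintro rfl; exact ⟨hy, rfl⟩

lemma subset_pre_im (H : AddSubgroup G) (S : Finset G) : S ⊆ pre H (im H S) :=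
  fun x hx => mem_pre.2 (mem_im.2 ⟨x, hx, rfl⟩)

lemma im_pre (H : AddSubgroup G) (W : Finset (G ⧸ H)) : im H (pre H W) = W := by
  ext y
  rw [mem_im]
  constructor
  · rintro ⟨x, hx, rfl⟩; exact mem_pre.1 hx
  · intro hy
    obtain ⟨x, rfl⟩ := qm_surj H y
    exact ⟨x, mem_pre.2 hy, rfl⟩

lemma pre_im {H : AddSubgroup G} {S : Finset G} (h : H ≤ stb S) : pre H (im H S) = S := by
  apply Finset.Subset.antisymm _ (subset_pre_im H S)
  intro x hx
  obtain ⟨y, hy, hxy⟩ := mem_im.1 (mem_pre.1 hx)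
  rw [qm_eq] at hxy
  have := (mem_stb.1 (h hxy) y).2 hy
  simpa using this

lemma card_le_im (H : AddSubgroup G) (S : Finset G) : S.card ≤ (hs H).card * (im H S).card := by
  rw [← card_pre]; exact Finset.card_le_card (subset_pre_im H S)

lemma card_eq_im {H : AddSubgroup G} {S : Finset G} (h : H ≤ stb S) :
    S.card = (hs H).card * (im H S).card := by
  rw [← card_pre, pre_im h]

lemma pre_add (H : AddSubgroup G) (W : Finset (G ⧸ H)) (B : Finset G) :
    pre H W + B = pre H (W + im H B) := by
  ext x
  rw [mem_pre, Finset.mem_add, Finset.mem_add]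
  constructor
  · rintro ⟨a, ha, b, hb, rfl⟩
    exact ⟨_, mem_pre.1 ha, _, mem_im.2 ⟨b, hb, rfl⟩, (map_add _ _ _).symm⟩
  · rintro ⟨w, hw, c, hc, h⟩
    obtain ⟨b, hb, rfl⟩ := mem_im.1 hc
    refine ⟨x - b, mem_pre.2 ?_, b, hb, by abel⟩
    rw [map_sub, ← h]; simpa using hw

lemma le_stb_pre (H : AddSubgroup G) (W : Finset (G ⧸ H)) : H ≤ stb (pre H W) := by
  intro g hg
  apply mem_stb_of_le
  intro x hx
  rw [mem_pre] at hx ⊢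
  have : qm H (x + g) = qm H x := by rw [eq_comm, qm_eq]; simpa using hg
  rwa [this]

lemma le_stb_add {H : AddSubgroup G} {W : Finset G} (B : Finset G) (h : H ≤ stb W) :
    H ≤ stb (W + B) := by
  rw [← pre_im h, pre_add]; exact le_stb_pre _ _

lemma le_stb_neg {H : AddSubgroup G} {W : Finset G} (h : H ≤ stb W) : H ≤ stb (-W) := by
  intro g hg
  apply mem_stb_of_le
  intro x hx
  rw [Finset.mem_neg'] at hx ⊢
  have := (mem_stb.1 (h (H.neg_mem hg)) (-x)).2 hx
  rwa [neg_add]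

lemma card_hs_mul (H : AddSubgroup G) :
    (hs H).card * Fintype.card (G ⧸ H) = Fintype.card G := by
  have := card_pre H Finset.univ
  rw [Finset.card_univ] at this
  rw [← this]
  have : pre H Finset.univ = Finset.univ := by ext; simp [mem_pre]
  rw [this, Finset.card_univ]

lemma hs_dvd {K H : AddSubgroup G} (h : K ≤ H) : (hs K).card ∣ (hs H).card := by
  have : K ≤ stb (hs H) := by
    intro g hg
    apply mem_stb_of_le
    intro x hx
    rw [mem_hs] at hx ⊢
    exact H.add_mem hx (h hg)
  rw [card_eq_im this]; exact Dvd.intro _ rfl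

lemma hs_card_le {K H : AddSubgroup G} (h : K ≤ H) : (hs K).card ≤ (hs H).card :=
  Finset.card_le_card (fun x hx => mem_hs.2 (h (mem_hs.1 hx)))

lemma eq_of_hs {K H : AddSubgroup G} (h : K ≤ H) (hc : (hs H).card ≤ (hs K).card) : K = H := by
  have : hs K = hs H :=
    Finset.eq_of_subset_of_card_le (fun x hx => mem_hs.2 (h (mem_hs.1 hx))) hc
  ext x; rw [← mem_hs, this, mem_hs]

/-- Kneser, quotient form. -/
lemma kneser_q (W B : Finset G) (hW : W.Nonempty) (hB : B.Nonempty) {T : AddSubgroup G}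
    (hT : T = stb (W + B)) :
    W + B = pre T (im T W + im T B) ∧
    (im T W).card + (im T B).card ≤ (im T W + im T B).card + 1 := by
  have e1 : W + B = pre T (im T W + im T B) := by
    rw [← im_add, pre_im hT.le]
  refine ⟨e1, ?_⟩
  have e2 : pre T (im T W) + pre T (im T B) = W + B := by
    rw [pre_add, im_pre, ← e1]
  have := kneser_weak (pre T (im T W)) (pre T (im T B)) (hW.mono (subset_pre_im _ _))
    (hB.mono (subset_pre_im _ _))
  rw [e2, ← hT, e1, card_pre, card_pre, card_pre] at this
  have h0 := hs_pos T
  have h1 : (hs T).card * ((im T W).card + (im T B).card) ≤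
    (hs T).card * ((im T W + im T B).card + 1) := by linarith
  exact Nat.le_of_mul_le_mul_left h1 h0

end Quot

section Rows
variable {Q : Type*} [AddCommGroup Q] [DecidableEq Q]

lemma peel_card (ρ : ℤ →+ Q) (A : Finset ℤ) (U : Finset Q) (hU : U ⊆ A.image ρ) :
    (A.filter (fun a => ρ a ∈ U → ∃ a' ∈ A, a' < a ∧ ρ a' = ρ a)).card + U.card = A.card := by
  rw [← Finset.card_filter_add_card_filter_not (s := A)
    (fun a => ρ a ∈ U → ∃ a' ∈ A, a' < a ∧ ρ a' = ρ a)]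
  congr 1
  symm
  apply Finset.card_bij (fun a _ => ρ a)
  · intro a ha
    simp only [Finset.mem_filter] at ha
    by_contra h
    exact ha.2 (fun h' => absurd h' h)
  · intro a ha b hb hab
    simp only [Finset.mem_filter] at ha hb
    push Not at ha hb
    rcases lt_trichotomy a b with h | h | h
    · exact absurd hab (hb.2.2 a ha.1 h)
    · exact h
    · exact absurd hab.symm (ha.2.2 b hb.1 h)
  · intro u hu
    have hne : (A.filter (fun a => ρ a = u)).Nonempty := by
      obtain ⟨a, ha, rfl⟩ := Finset.mem_image.1 (hU hu)
      exact ⟨a, by simp [ha]⟩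
    have hm := Finset.min'_mem _ hne
    set m := (A.filter (fun a => ρ a = u)).min' hne with hmdef
    rw [Finset.mem_filter] at hm
    refine ⟨m, ?_, hm.2⟩
    rw [Finset.mem_filter]
    refine ⟨hm.1, ?_⟩
    push Not
    refine ⟨hm.2.symm ▸ hu, fun a' ha' hlt h => ?_⟩
    have := Finset.min'_le (A.filter (fun a => ρ a = u)) a' (by
      rw [Finset.mem_filter]; exact ⟨ha', h.trans hm.2⟩)
    omega

lemma peel_sum (ρ : ℤ →+ Q) (A B : Finset ℤ) (U V : Finset Q)
    (hV : V ⊆ A.image ρ + B.image ρ)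
    (hd : ∀ a ∈ A, ∀ b ∈ B, ρ (a + b) ∈ V → ρ a ∈ U) :
    (A.filter (fun a => ρ a ∈ U → ∃ a' ∈ A, a' < a ∧ ρ a' = ρ a) + B).card + V.card
      ≤ (A + B).card := by
  set A' := A.filter (fun a => ρ a ∈ U → ∃ a' ∈ A, a' < a ∧ ρ a' = ρ a) with hA'
  have hsub : A' + B ⊆ A + B := Finset.add_subset_add_right (Finset.filter_subset _ _)
  have : V.card ≤ ((A + B) \ (A' + B)).card := by
    apply Finset.card_le_card_of_surjOn ρ
    intro z hz
    have hne : ((A + B).filter (fun c => ρ c = z)).Nonempty := by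
      have h := hV hz
      rw [← Finset.image_add, Finset.mem_image] at h
      obtain ⟨c, hc, rfl⟩ := h
      exact ⟨c, by rw [Finset.mem_filter]; exact ⟨hc, rfl⟩⟩
    have hm := Finset.min'_mem _ hne
    set m := ((A + B).filter (fun c => ρ c = z)).min' hne with hmdef
    rw [Finset.mem_filter] at hm
    refine ⟨m, ?_, hm.2⟩
    rw [Finset.mem_coe, Finset.mem_sdiff]
    refine ⟨hm.1, fun h => ?_⟩
    obtain ⟨a, ha, b, hb, hab⟩ := Finset.mem_add.1 h
    rw [hA', Finset.mem_filter] at ha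
    obtain ⟨a', ha', hlt, hr⟩ := ha.2 (hd a ha.1 b hb (by rw [hab, hm.2]; exact hz))
    have := Finset.min'_le ((A + B).filter (fun c => ρ c = z)) (a' + b) (by
      rw [Finset.mem_filter]
      refine ⟨Finset.add_mem_add ha' hb, ?_⟩
      rw [map_add, hr, ← map_add, hab, hm.2])
    omega
  rw [Finset.card_sdiff_of_subset hsub] at this
  have := Finset.card_le_card hsub
  omega

lemma option_lemma (ρ : ℤ →+ Q) (A B : Finset ℤ) (n : ℤ) (hn : 0 < n) (h0 : 0 ∈ B) (hnB : n ∈ B)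
    (hρ : ρ n = 0) (T : Finset Q) (hT : T ⊆ A.image ρ + B.image ρ) :
    (A.filter (fun a => ρ a ∈ T)).card + T.card ≤ ((A + B).filter (fun c => ρ c ∈ T)).card := by
  have hAs : A ⊆ A + B := fun a ha => by
    have := Finset.add_mem_add ha h0
    simpa using this
  have hsub : A.filter (fun a => ρ a ∈ T) ⊆ (A + B).filter (fun c => ρ c ∈ T) :=
    Finset.filter_subset_filter _ hAs
  have : T.card ≤ ((A + B).filter (fun c => ρ c ∈ T) \ A.filter (fun a => ρ a ∈ T)).card := by
    apply Finset.card_le_card_of_surjOn ρ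
    intro z hz
    by_cases hX : z ∈ A.image ρ
    · have hne : (A.filter (fun a => ρ a = z)).Nonempty := by
        obtain ⟨a, ha, rfl⟩ := Finset.mem_image.1 hX
        exact ⟨a, by simp [ha]⟩
      have hm := Finset.max'_mem _ hne
      set m := (A.filter (fun a => ρ a = z)).max' hne with hmdef
      rw [Finset.mem_filter] at hm
      have hr : ρ (m + n) = z := by rw [map_add, hρ, add_zero, hm.2]
      refine ⟨m + n, ?_, hr⟩
      rw [Finset.mem_coe, Finset.mem_sdiff, Finset.mem_filter, Finset.mem_filter]
      refine ⟨⟨Finset.add_mem_add hm.1 hnB, hr.symm ▸ hz⟩, fun h => ?_⟩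
      have := Finset.le_max' (A.filter (fun a => ρ a = z)) (m + n) (by
        rw [Finset.mem_filter]; exact ⟨h.1, hr⟩)
      omega
    · have h := hT hz
      rw [← Finset.image_add, Finset.mem_image] at h
      obtain ⟨c, hc, rfl⟩ := h
      refine ⟨c, ?_, rfl⟩
      rw [Finset.mem_coe, Finset.mem_sdiff, Finset.mem_filter, Finset.mem_filter]
      exact ⟨⟨hc, hz⟩, fun h => hX (Finset.mem_image_of_mem _ h.1)⟩
  rw [Finset.card_sdiff_of_subset hsub] at this
  have := Finset.card_le_card hsub
  omega

lemma row_cd (π : ℤ →+ Q) (A B : Finset ℤ) (j k : Q) (hj : j ∈ A.image π) (hk : k ∈ B.image π) :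
    (A.filter (fun a => π a = j)).card + (B.filter (fun b => π b = k)).card
      ≤ ((A + B).filter (fun c => π c = j + k)).card + 1 := by
  have h1 : (A.filter (fun a => π a = j)).Nonempty := by
    obtain ⟨a, ha, rfl⟩ := Finset.mem_image.1 hj
    exact ⟨a, by simp [ha]⟩
  have h2 : (B.filter (fun b => π b = k)).Nonempty := by
    obtain ⟨a, ha, rfl⟩ := Finset.mem_image.1 hk
    exact ⟨a, by simp [ha]⟩
  have h3 := cauchy_davenport_add_of_linearOrder_isCancelAdd h1 h2
  have h4 : A.filter (fun a => π a = j) + B.filter (fun b => π b = k) ⊆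
      (A + B).filter (fun c => π c = j + k) := by
    intro c hc
    obtain ⟨a, ha, b, hb, rfl⟩ := Finset.mem_add.1 hc
    rw [Finset.mem_filter] at ha hb ⊢
    exact ⟨Finset.add_mem_add ha.1 hb.1, by rw [map_add, ha.2, hb.2]⟩
  have := Finset.card_le_card h4
  omega

end Rows

open Pointwise
set_option linter.unusedSectionVars false
set_option linter.unusedVariables false

section RLemma
variable {Q : Type*} [AddCommGroup Q] [DecidableEq Q]

/-- Size of a row. -/
def row (π : ℤ →+ Q) (A : Finset ℤ) (j : Q) : ℕ := (A.filter (fun a => π a = j)).card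

lemma sum_row (π : ℤ →+ Q) (A : Finset ℤ) : ∑ j ∈ A.image π, row π A j = A.card :=
  (Finset.card_eq_sum_card_image π A).symm

lemma row_pos {π : ℤ →+ Q} {A : Finset ℤ} {j : Q} (h : j ∈ A.image π) : 1 ≤ row π A j := by
  obtain ⟨a, ha, rfl⟩ := Finset.mem_image.1 h
  exact Finset.card_pos.2 ⟨a, by simp [ha]⟩

lemma row_add (π : ℤ →+ Q) (A B : Finset ℤ) (j k : Q) (hj : j ∈ A.image π) (hk : k ∈ B.image π) :
    row π A j + row π B k ≤ row π (A + B) (j + k) + 1 := row_cd π A B j k hj hk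

lemma layer_le (Z : Finset Q) (c : Q → ℕ) (N : ℕ) :
    ∑ l ∈ Finset.range N, (Z.filter (fun z => l < c z)).card ≤ ∑ z ∈ Z, c z := by
  simp_rw [Finset.card_filter]
  rw [Finset.sum_comm]
  apply Finset.sum_le_sum
  intro z _
  rw [← Finset.card_filter]
  have : (Finset.range N).filter (fun l => l < c z) ⊆ Finset.range (c z) := by
    intro l hl
    rw [Finset.mem_filter] at hl
    exact Finset.mem_range.2 hl.2
  simpa using Finset.card_le_card this

lemma layer_eq (Z : Finset Q) (c : Q → ℕ) (N : ℕ) (hN : ∀ z ∈ Z, c z ≤ N) :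
    ∑ l ∈ Finset.range N, (Z.filter (fun z => l < c z)).card = ∑ z ∈ Z, c z := by
  simp_rw [Finset.card_filter]
  rw [Finset.sum_comm]
  apply Finset.sum_congr rfl
  intro z hz
  rw [← Finset.card_filter]
  have : (Finset.range N).filter (fun l => l < c z) = Finset.range (c z) := by
    ext l
    rw [Finset.mem_filter, Finset.mem_range, Finset.mem_range]
    have := hN z hz
    omega
  rw [this, Finset.card_range]

lemma R_basic (π : ℤ →+ Q) (A B : Finset ℤ) (p : ℕ) (hp : (B.image π).card = p + 1)
    (hW : ∀ W ⊆ A.image π, W.Nonempty → W.card + p ≤ (W + B.image π).card)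
    (b Δ : ℕ) (hb1 : 1 ≤ b) (hb : ∀ k ∈ B.image π, b ≤ row π B k) (k1 : Q) (hk1 : k1 ∈ B.image π)
    (hΔ : b + Δ ≤ row π B k1) (j0 : Q) (hj0 : j0 ∈ A.image π) :
    A.card + (b - 1) * ((A.image π).card + p) + p * row π A j0
      + Δ * ((A.image π).filter (fun j => row π A j0 ≤ row π A j)).card ≤ (A + B).card := by
  set X := A.image π with hX
  set Y := B.image π with hY
  set y := row π A j0 with hy
  set M := A.card with hM
  have hle : ∀ j, row π A j ≤ M := fun j => Finset.card_filter_le _ _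
  obtain ⟨t, ht⟩ : ∃ t, M = y + t := ⟨M - y, by have := hle j0; omega⟩
  have hsum : (A + B).card = ∑ z ∈ X + Y, row π (A + B) z := by
    rw [← sum_row π (A + B), Finset.image_add]
  rw [hsum]
  refine le_trans ?_ (layer_le (X + Y) (row π (A + B)) ((b - 1) + y + Δ + t))
  rw [Finset.sum_range_add, Finset.sum_range_add, Finset.sum_range_add]
  have hA : M = ∑ l ∈ Finset.range (y + t), (X.filter (fun z => l < row π A z)).card := by
    rw [layer_eq X (row π A) (y + t) (by intro z _; rw [← ht]; exact hle z), sum_row]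
  rw [Finset.sum_range_add] at hA
  have s1 : (b - 1) * (X.card + p) ≤ ∑ l ∈ Finset.range (b - 1),
      ((X + Y).filter (fun z => l < row π (A + B) z)).card := by
    rw [← smul_eq_mul, ← Finset.card_range (b - 1), ← Finset.sum_const, Finset.card_range]
    apply Finset.sum_le_sum
    intro l hl
    rw [Finset.mem_range] at hl
    refine le_trans (hW X (Finset.Subset.refl _) ⟨_, hj0⟩) (Finset.card_le_card ?_)
    intro z hz
    rw [Finset.mem_filter]
    refine ⟨hz, ?_⟩
    obtain ⟨j, hj, k, hk, rfl⟩ := Finset.mem_add.1 hz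
    have h1 := row_add π A B j k hj hk
    have h2 := row_pos hj
    have h3 := hb k hk
    omega
  have s2 : ∑ l ∈ Finset.range y, (X.filter (fun z => l < row π A z)).card + p * y ≤
      ∑ l ∈ Finset.range y, ((X + Y).filter (fun z => b - 1 + l < row π (A + B) z)).card := by
    have : p * y = ∑ l ∈ Finset.range y, p := by simp [mul_comm]
    rw [this, ← Finset.sum_add_distrib]
    apply Finset.sum_le_sum
    intro l hl
    rw [Finset.mem_range] at hl
    refine le_trans (hW (X.filter (fun z => l < row π A z)) (Finset.filter_subset _ _)
      ⟨j0, by rw [Finset.mem_filter]; exact ⟨hj0, hl⟩⟩) (Finset.card_le_card ?_)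
    intro z hz
    rw [Finset.mem_filter]
    obtain ⟨j, hj, k, hk, rfl⟩ := Finset.mem_add.1 hz
    rw [Finset.mem_filter] at hj
    refine ⟨Finset.add_mem_add hj.1 hk, ?_⟩
    have h1 := row_add π A B j k hj.1 hk
    have h3 := hb k hk
    omega
  have tr : ∀ (W : Finset Q) (l : ℕ), W ⊆ X → (∀ j ∈ W, l + 1 ≤ row π A j + (b + Δ - 1)) →
      W.card ≤ ((X + Y).filter (fun z => l < row π (A + B) z)).card := by
    intro W l hWX hl
    rw [← Finset.card_image_of_injective W (add_left_injective k1)]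
    apply Finset.card_le_card
    intro z hz
    obtain ⟨j, hj, rfl⟩ := Finset.mem_image.1 hz
    rw [Finset.mem_filter]
    refine ⟨Finset.add_mem_add (hWX hj) hk1, ?_⟩
    have h1 := row_add π A B j k1 (hWX hj) hk1
    have h2 := hl j hj
    show l < row π (A + B) (j + k1)
    omega
  have s3 : Δ * (X.filter (fun j => y ≤ row π A j)).card ≤
      ∑ l ∈ Finset.range Δ, ((X + Y).filter (fun z => b - 1 + y + l < row π (A + B) z)).card := by
    have : Δ * (X.filter (fun j => y ≤ row π A j)).card =
      ∑ l ∈ Finset.range Δ, (X.filter (fun j => y ≤ row π A j)).card := by simp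
    rw [this]
    apply Finset.sum_le_sum
    intro l hl
    rw [Finset.mem_range] at hl
    apply tr _ _ (Finset.filter_subset _ _)
    intro j hj
    rw [Finset.mem_filter] at hj
    omega
  have s4 : ∑ l ∈ Finset.range t, (X.filter (fun z => y + l < row π A z)).card ≤
      ∑ l ∈ Finset.range t, ((X + Y).filter
        (fun z => b - 1 + y + Δ + l < row π (A + B) z)).card := by
    apply Finset.sum_le_sum
    intro l hl
    apply tr _ _ (Finset.filter_subset _ _)
    intro j hj
    rw [Finset.mem_filter] at hj
    omega
  generalize (b - 1) * (X.card + p) = e1 at *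
  generalize p * y = e2 at *
  generalize Δ * (X.filter (fun j => y ≤ row π A j)).card = e3 at *
  omega

lemma tri_sum (X : Finset Q) (f : Q → ℕ) :
    X.card * (X.card + 1) ≤ 2 * ∑ j ∈ X, (X.filter (fun j' => f j ≤ f j')).card := by
  have h1 : ∑ j ∈ X, (X.filter (fun j' => f j ≤ f j')).card =
      ∑ j ∈ X, ∑ j' ∈ X, if f j ≤ f j' then 1 else 0 := by
    simp_rw [Finset.card_filter]
  have h2 : ∑ j ∈ X, (X.filter (fun j' => f j ≤ f j')).card =
      ∑ j ∈ X, ∑ j' ∈ X, if f j' ≤ f j then 1 else 0 := by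
    rw [h1, Finset.sum_comm]
  have h3 : X.card * (X.card + 1) = ∑ j ∈ X, ∑ j' ∈ X, (1 + if j = j' then 1 else 0) := by
    simp_rw [Finset.sum_add_distrib]
    simp
    ring
  rw [two_mul]
  nth_rewrite 1 [h1]
  rw [h2, h3, ← Finset.sum_add_distrib]
  apply Finset.sum_le_sum
  intro j _
  rw [← Finset.sum_add_distrib]
  apply Finset.sum_le_sum
  intro j' _
  by_cases h : j = j'
  · subst h; simp
  · rcases le_total (f j) (f j') with h' | h' <;> simp [h, h']

lemma R_avg (π : ℤ →+ Q) (A B : Finset ℤ) (p : ℕ) (hp : (B.image π).card = p + 1)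
    (hW : ∀ W ⊆ A.image π, W.Nonempty → W.card + p ≤ (W + B.image π).card)
    (b Δ : ℕ) (hb1 : 1 ≤ b) (hb : ∀ k ∈ B.image π, b ≤ row π B k) (k1 : Q) (hk1 : k1 ∈ B.image π)
    (hΔ : b + Δ ≤ row π B k1) (α : ℕ) (hα : (A.image π).card = α) :
    2 * α * A.card + 2 * α * ((b - 1) * (α + p)) + 2 * p * A.card + Δ * (α * (α + 1))
      ≤ 2 * α * (A + B).card := by
  have h := Finset.sum_le_sum (fun j0 hj0 => R_basic π A B p hp hW b Δ hb1 hb k1 hk1 hΔ j0 hj0)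
  simp only [Finset.sum_add_distrib, Finset.sum_const, smul_eq_mul, ← Finset.mul_sum, sum_row,
    hα] at h
  have h2 := tri_sum (A.image π) (row π A)
  rw [hα] at h2
  have h3 := Nat.mul_le_mul_left Δ h2
  linarith

lemma amgm (a s Γ : ℝ) (α p : ℝ) (ha : 0 ≤ a) (hs : 0 ≤ s) (hα : 0 < α) (hp : 0 < p)
    (h : 2 * p ^ 2 * a + α * (α + p) * s ≤ 2 * α * p * Γ) :
    s / 2 + Real.sqrt (2 * a * s) ≤ Γ := by
  have h1 : Real.sqrt (2 * a * s) ^ 2 = 2 * a * s := Real.sq_sqrt (by positivity)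
  have h2 : Real.sqrt (2 * a) ^ 2 = 2 * a := Real.sq_sqrt (by positivity)
  have h3 : Real.sqrt s ^ 2 = s := Real.sq_sqrt hs
  have h4 : Real.sqrt (2 * a * s) = Real.sqrt (2 * a) * Real.sqrt s :=
    Real.sqrt_mul (by positivity) _
  have h5 := sq_nonneg (p * Real.sqrt (2 * a) - α * Real.sqrt s)
  rw [h4]
  have h6 : 2 * α * p * (Real.sqrt (2 * a) * Real.sqrt s) ≤ 2 * p ^ 2 * a + α ^ 2 * s := by
    nlinarith
  have h7 : 0 < 2 * α * p := by positivity
  by_contra hc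
  push Not at hc
  have := mul_lt_mul_of_pos_left hc h7
  nlinarith

/-- Row lemma with numeric condition. -/
lemma R_final (π : ℤ →+ Q) (A B : Finset ℤ) (hA : A.Nonempty) (p s : ℕ) (hp1 : 1 ≤ p)
    (hp : (B.image π).card = p + 1)
    (hW : ∀ W ⊆ A.image π, W.Nonempty → W.card + p ≤ (W + B.image π).card)
    (b Δ : ℕ) (hb1 : 1 ≤ b) (hb : ∀ k ∈ B.image π, b ≤ row π B k) (k1 : Q) (hk1 : k1 ∈ B.image π)
    (hΔ : b + Δ ≤ row π B k1) (α : ℕ) (hα : (A.image π).card = α)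
    (hc : ((α : ℤ) + p) * s ≤ 2 * p * (b - 1) * (α + p) + p * Δ * (α + 1)) :
    (s : ℝ) / 2 + Real.sqrt (2 * A.card * s) ≤ (A + B).card - A.card := by
  have h := R_avg π A B p hp hW b Δ hb1 hb k1 hk1 hΔ α hα
  have hα0 : 0 < α := by rw [← hα]; exact Finset.card_pos.2 (hA.image _)
  obtain ⟨b', rfl⟩ : ∃ b', b = b' + 1 := ⟨b - 1, by omega⟩
  rw [Nat.add_sub_cancel] at h
  have hR : (2 * α * A.card + 2 * α * (b' * (α + p)) + 2 * p * A.card + Δ * (α * (α + 1)) : ℝ)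
      ≤ 2 * α * (A + B).card := by exact_mod_cast h
  have hcR : (((α : ℝ) + p) * s ≤ 2 * p * b' * (α + p) + p * Δ * (α + 1)) := by
    have : ((α : ℤ) + p) * s ≤ 2 * p * b' * (α + p) + p * Δ * (α + 1) := by
      push_cast at hc; linarith
    exact_mod_cast this
  have hα' : (0 : ℝ) < α := by exact_mod_cast hα0
  have hp' : (0 : ℝ) < p := by exact_mod_cast hp1
  apply amgm (A.card : ℝ) s _ α p (by positivity) (by positivity) hα' hp'
  have e1 := mul_le_mul_of_nonneg_left hR hp'.le
  have e2 := mul_le_mul_of_nonneg_left hcR hα'.le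
  nlinarith

/-- One-dimensional case. -/
lemma R_one (π : ℤ →+ Q) (A B : Finset ℤ) (hA : A.Nonempty) (s : ℕ) (hs : B.card = s + 2)
    (hp : (B.image π).card = 2)
    (hW : ∀ W ⊆ A.image π, W.Nonempty → W.card + 1 ≤ (W + B.image π).card) :
    (s : ℝ) / 2 + Real.sqrt (2 * A.card * s) ≤ (A + B).card - A.card := by
  obtain ⟨k, k', hne, hkk⟩ := Finset.card_eq_two.1 hp
  have hsum := sum_row π B
  rw [hkk, Finset.sum_pair hne, hs] at hsum
  have main : ∀ k k' : Q, B.image π = {k, k'} → row π B k + row π B k' = s + 2 →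
      row π B k ≤ row π B k' →
      (s : ℝ) / 2 + Real.sqrt (2 * A.card * s) ≤ (A + B).card - A.card := by
    intro k k' hkk hsum hle
    refine R_final π A B hA 1 s le_rfl hp hW (row π B k) (row π B k' - row π B k)
      (row_pos (by rw [hkk]; simp)) ?_ k' (by rw [hkk]; simp) (by omega) _ rfl ?_
    · intro j hj
      rw [hkk, Finset.mem_insert, Finset.mem_singleton] at hj
      rcases hj with rfl | rfl
      · exact le_rfl
      · exact hle
    · push_cast [Nat.cast_sub hle]
      have : (row π B k : ℤ) + row π B k' = s + 2 := by exact_mod_cast hsum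
      have hs' : (s : ℤ) = row π B k + row π B k' - 2 := by linarith
      rw [hs']
      apply le_of_eq
      ring
  rcases le_total (row π B k) (row π B k') with h | h
  · exact main k k' hkk hsum h
  · exact main k' k (by rw [hkk, Finset.pair_comm]) (by omega) h

/-- Higher-dimensional case. -/
lemma R_many (π : ℤ →+ Q) (A B : Finset ℤ) (hA : A.Nonempty) (p s L : ℕ) (hs : B.card = s + 2)
    (hp1 : 1 ≤ p) (hp : (B.image π).card = p + 1)
    (hW : ∀ W ⊆ A.image π, W.Nonempty → W.card + p ≤ (W + B.image π).card)
    (hL : ∀ k ∈ B.image π, k ≠ 0 → row π B k ≤ L) (hL0 : row π B 0 ≤ L + 1)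
    (u : ℤ) (hu : (s : ℤ) = p * L + u) (hu1 : 1 ≤ u) (α : ℕ) (hα : (A.image π).card = α)
    (hc : (p : ℤ) * (L - u) ≤ (α + p) * u) :
    (s : ℝ) / 2 + Real.sqrt (2 * A.card * s) ≤ (A + B).card - A.card := by
  have hne : (B.image π).Nonempty := Finset.card_pos.1 (by omega)
  obtain ⟨k0, hk0, hmin⟩ := Finset.exists_min_image (B.image π) (row π B) hne
  obtain ⟨k1, hk1, hmax⟩ := Finset.exists_max_image (B.image π) (row π B) hne
  have hsum := sum_row π B
  rw [hs, ← Finset.add_sum_erase _ _ hk0] at hsum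
  have hce : ((B.image π).erase k0).card = p := by rw [Finset.card_erase_of_mem hk0]; omega
  have b1 : ∑ k ∈ (B.image π).erase k0, row π B k ≤ p * row π B k1 := by
    have := Finset.sum_le_card_nsmul ((B.image π).erase k0) (row π B) (row π B k1)
      (fun k hk => hmax k (Finset.mem_of_mem_erase hk))
    rwa [hce, smul_eq_mul] at this
  have b2 : ∑ k ∈ (B.image π).erase k0, row π B k ≤ p * L + 1 := by
    by_cases h0 : (0 : Q) ∈ (B.image π).erase k0
    · rw [← Finset.add_sum_erase _ _ h0]
      have : ∑ k ∈ ((B.image π).erase k0).erase 0, row π B k ≤ _ :=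
        Finset.sum_le_card_nsmul (((B.image π).erase k0).erase 0) (row π B) L
        (fun k hk => hL k (Finset.mem_of_mem_erase (Finset.mem_of_mem_erase hk))
          (Finset.ne_of_mem_erase hk))
      rw [Finset.card_erase_of_mem h0, hce, smul_eq_mul] at this
      obtain ⟨p', rfl⟩ : ∃ p', p = p' + 1 := ⟨p - 1, by omega⟩
      rw [Nat.add_sub_cancel] at this
      rw [add_mul]
      omega
    · have : ∑ k ∈ (B.image π).erase k0, row π B k ≤ _ :=
        Finset.sum_le_card_nsmul ((B.image π).erase k0) (row π B) L
        (fun k hk => hL k (Finset.mem_of_mem_erase hk) (fun h => h0 (h ▸ hk)))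
      rw [hce, smul_eq_mul] at this
      omega
  have hle := hmin k1 hk1
  refine R_final π A B hA p s hp1 hp hW (row π B k0) (row π B k1 - row π B k0)
      (row_pos hk0) hmin k1 hk1 (by omega) α hα ?_
  push_cast [Nat.cast_sub hle]
  generalize row π B k0 = b at *
  generalize row π B k1 = m at *
  obtain ⟨Δ, rfl⟩ : ∃ Δ, m = b + Δ := ⟨m - b, by omega⟩
  have c1 : (s : ℤ) + 2 ≤ b + p * (b + Δ) := by
    have : s + 2 ≤ b + p * (b + Δ) := by omega
    exact_mod_cast this
  have c2 : (s : ℤ) + 2 ≤ b + p * L + 1 := by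
    have : s + 2 ≤ b + p * L + 1 := by omega
    exact_mod_cast this
  have hα0 : (1 : ℤ) ≤ α := by
    have : 0 < α := by rw [← hα]; exact Finset.card_pos.2 (hA.image _)
    exact_mod_cast this
  have hp0 : (1 : ℤ) ≤ p := by exact_mod_cast hp1
  rw [hu] at c1 c2 ⊢
  have hbu : u + 1 ≤ b := by linarith
  push_cast
  have e0 : (b : ℤ) + Δ - b = Δ := by ring
  rw [e0]
  generalize (b : ℤ) = b at *
  generalize (Δ : ℤ) = Δ at *
  generalize (p : ℤ) = p at *
  generalize (α : ℤ) = α at *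
  generalize (L : ℤ) = L at *
  have key : 0 ≤ (p - 1) * ((α + p) * u - p * (L - u)) :=
    mul_nonneg (by linarith) (by linarith)
  rcases eq_or_lt_of_le hbu with h | h
  · subst h
    have hD : L - u ≤ Δ := by
      by_contra hcon
      push Not at hcon
      have : Δ + 1 ≤ L - u := by omega
      have := mul_le_mul_of_nonneg_left this (by linarith : (0 : ℤ) ≤ p)
      nlinarith
    have := mul_le_mul_of_nonneg_left hD (by positivity : (0 : ℤ) ≤ p * (α + 1))
    nlinarith
  · have h' : u + 2 ≤ b := by omega
    have t1 : (p * L + u + 2 - (p + 1) * b) * (α + 1) ≤ p * Δ * (α + 1) :=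
      mul_le_mul_of_nonneg_right (by linarith) (by linarith)
    have t2 : 0 ≤ (2 * p * (α + p) - (α + 1) * (p + 1)) * (b - (u + 2)) := by
      apply mul_nonneg _ (by linarith)
      nlinarith
    have t3 : 0 ≤ 2 * p * (p - 1) := mul_nonneg (by linarith) (by linarith)
    nlinarith

end RLemma

open Pointwise
set_option linter.unusedSectionVars false
set_option linter.unusedVariables false

section Ext
variable {G : Type*} [AddCommGroup G] [Fintype G] [DecidableEq G]

/-- Composite with the quotient map. -/
def qp (ρ : ℤ →+ G) (H : AddSubgroup G) : ℤ →+ G ⧸ H := (qm H).comp ρ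

lemma qp_apply (ρ : ℤ →+ G) (H : AddSubgroup G) (a : ℤ) : qp ρ H a = qm H (ρ a) := rfl

lemma image_qp (ρ : ℤ →+ G) (H : AddSubgroup G) (A : Finset ℤ) :
    A.image (qp ρ H) = im H (A.image ρ) := by
  unfold im; rw [Finset.image_image]; rfl

/-- Fibre count. -/
noncomputable def fb (H : AddSubgroup G) (S : Finset G) (y : G ⧸ H) : ℕ :=
  (S.filter (fun x => qm H x = y)).card

lemma fb_le (H : AddSubgroup G) (S : Finset G) (y : G ⧸ H) : fb H S y ≤ (hs H).card := by
  rw [← card_row H y]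
  exact Finset.card_le_card (Finset.filter_subset_filter _ (Finset.subset_univ _))

lemma sum_fb (H : AddSubgroup G) (S : Finset G) : ∑ y ∈ im H S, fb H S y = S.card :=
  (Finset.card_eq_sum_card_image (qm H) S).symm

lemma fb_le_row (ρ : ℤ →+ G) (H : AddSubgroup G) (A : Finset ℤ) (y : G ⧸ H) :
    fb H (A.image ρ) y ≤ row (qp ρ H) A y := by
  unfold fb row
  rw [Finset.filter_image]
  exact Finset.card_image_le

lemma sum_fb_erase (H : AddSubgroup G) (S : Finset G) (W : Finset (G ⧸ H)) (hW : W ⊆ im H S) :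
    S.card ≤ ∑ y ∈ W, fb H S y + ((im H S).card - W.card) * (hs H).card := by
  rw [← sum_fb H S, ← Finset.sum_sdiff hW, add_comm]
  apply Nat.add_le_add_left
  have : ∑ k ∈ im H S \ W, fb H S k ≤ _ :=
    Finset.sum_le_card_nsmul (im H S \ W) (fb H S) (hs H).card (fun y _ => fb_le H S y)
  rwa [Finset.card_sdiff_of_subset hW, smul_eq_mul] at this

lemma row_bound (ρ : ℤ →+ G) (H : AddSubgroup G) (B : Finset ℤ) (n : ℤ) (hnB : n ∈ B)
    (hρ : ρ n = 0) (hinj : Set.InjOn ρ (B.erase n)) :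
    (∀ k, k ≠ 0 → row (qp ρ H) B k ≤ (hs H).card) ∧ row (qp ρ H) B 0 ≤ (hs H).card + 1 := by
  have key : ∀ k, ((B.erase n).filter (fun b => qp ρ H b = k)).card ≤ (hs H).card := by
    intro k
    rw [← card_row H k]
    apply Finset.card_le_card_of_injOn ρ
    · intro b hb
      rw [Finset.mem_coe, Finset.mem_filter] at hb
      rw [Finset.mem_coe, Finset.mem_filter]
      exact ⟨Finset.mem_univ _, hb.2⟩
    · exact hinj.mono (by intro b hb; exact (Finset.mem_filter.1 hb).1)
  constructor
  · intro k hk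
    refine le_trans (Finset.card_le_card ?_) (key k)
    intro b hb
    rw [Finset.mem_filter] at hb ⊢
    refine ⟨Finset.mem_erase.2 ⟨?_, hb.1⟩, hb.2⟩
    rintro rfl
    apply hk
    rw [← hb.2, qp_apply, hρ, map_zero]
  · have : row (qp ρ H) B 0 ≤ (insert n ((B.erase n).filter (fun b => qp ρ H b = 0))).card := by
      apply Finset.card_le_card
      intro b hb
      rw [Finset.mem_filter] at hb
      rw [Finset.mem_insert, Finset.mem_filter, Finset.mem_erase]
      tauto
    have h2 := Finset.card_insert_le n ((B.erase n).filter (fun b => qp ρ H b = 0))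
    have := key 0
    omega

lemma extra (ρ : ℤ →+ G) (A B : Finset ℤ) (n : ℤ) (hn : 0 < n) (h0 : 0 ∈ B) (hnB : n ∈ B)
    (hρ : ρ n = 0) (K : AddSubgroup G) (hK : K = stb (A.image ρ + B.image ρ)) (L α p : ℕ)
    (hL : (hs K).card = L) (hα : (im K (A.image ρ)).card = α)
    (hp : (im K (B.image ρ)).card = p + 1) (hp2 : 2 ≤ p)
    (hZ : (im K (A.image ρ) + im K (B.image ρ)).card = α + p) (E hol v : ℤ)
    (hE : ((B.image ρ).card : ℤ) = (p + 1) * L - E)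
    (hhol : ((A.image ρ).card : ℤ) = α * L - hol) (hv : v = L - 1 - E - hol) :
    (A.card : ℤ) + (α + p) * L + p * v + E ≤ (A + B).card := by
  set X := A.image ρ with hX
  set Bb := B.image ρ with hBb
  set Z := im K X + im K Bb with hZdef
  have hXB : X + Bb = pre K Z := by rw [hZdef, ← im_add, pre_im hK.le]
  have h0Y : (0 : G ⧸ K) ∈ im K Bb := mem_im.2 ⟨0, Finset.mem_image.2 ⟨0, h0, map_zero _⟩, map_zero _⟩
  have hXZ : im K X ⊆ Z := fun j hj => by
    have := Finset.add_mem_add hj h0Y; simpa using this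
  have hTs : pre K (im K X) ⊆ X + Bb := by
    rw [hXB]; intro g hg; rw [mem_pre] at hg ⊢; exact hXZ hg
  have o := option_lemma ρ A B n hn h0 hnB hρ (pre K (im K X)) hTs
  have o1 : A.filter (fun a => ρ a ∈ pre K (im K X)) = A := by
    apply Finset.filter_true_of_mem
    intro a ha
    exact subset_pre_im _ _ (Finset.mem_image_of_mem _ ha)
  rw [o1, card_pre, hL, hα] at o
  have o2 := Finset.card_filter_add_card_filter_not (s := A + B) (fun c => ρ c ∈ pre K (im K X))
  have o3 : ((A + B).filter (fun c => ¬ (ρ c ∈ pre K (im K X)))).card =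
      ∑ c ∈ Z \ im K X, row (qp ρ K) (A + B) c := by
    rw [Finset.card_eq_sum_card_fiberwise (f := qp ρ K) (t := Z \ im K X)]
    · apply Finset.sum_congr rfl
      intro c hc
      unfold row
      rw [Finset.filter_filter]
      congr 1
      apply Finset.filter_congr
      intro z hz
      rw [mem_pre]
      rw [Finset.mem_sdiff] at hc
      constructor
      · exact fun h => h.2
      · intro h; refine ⟨fun h' => hc.2 ?_, h⟩
        rw [← h]; exact h'
    · intro z hz
      rw [Finset.mem_coe, Finset.mem_filter, mem_pre] at hz
      rw [Finset.mem_coe, Finset.mem_sdiff]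
      refine ⟨?_, hz.2⟩
      rw [hZdef, ← im_add, ← Finset.image_add]
      exact mem_im.2 ⟨ρ z, Finset.mem_image_of_mem _ hz.1, rfl⟩
  -- fibres of X
  have ξ : ∀ j ∈ im K X, (L : ℤ) - hol ≤ row (qp ρ K) A j := by
    intro j hj
    have h1 := sum_fb_erase K X {j} (by simpa using hj)
    rw [Finset.sum_singleton, Finset.card_singleton, hα, hL] at h1
    have h2 := fb_le_row ρ K A j
    have hα1 : 1 ≤ α := by rw [← hα]; exact Finset.card_pos.2 ⟨j, hj⟩
    have h3 : (X.card : ℤ) ≤ fb K X j + (α - 1) * L := by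
      have : ((α - 1 : ℕ) : ℤ) = α - 1 := by omega
      rw [← this]; exact_mod_cast h1
    have h4 : (fb K X j : ℤ) ≤ row (qp ρ K) A j := by exact_mod_cast h2
    linarith
  obtain ⟨k0, hk0, hmin⟩ := Finset.exists_min_image (im K Bb) (fb K Bb) ⟨0, h0Y⟩
  set m := fb K Bb k0 with hm
  have f1 : ∀ k ∈ im K Bb, m ≤ row (qp ρ K) B k := fun k hk =>
    (hmin k hk).trans (fb_le_row ρ K B k)
  have f2 : ∀ k ∈ im K Bb, k ≠ k0 → (2 * L : ℤ) - E ≤ m + row (qp ρ K) B k := by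
    intro k hk hne
    have h1 := sum_fb_erase K Bb {k0, k} (by
      intro y hy; rw [Finset.mem_insert, Finset.mem_singleton] at hy
      rcases hy with rfl | rfl
      · exact hk0
      · exact hk)
    rw [Finset.sum_pair hne.symm, Finset.card_pair hne.symm, hp, hL] at h1
    have h2 := fb_le_row ρ K B k
    have h3 : (Bb.card : ℤ) ≤ m + fb K Bb k + (p - 1) * L := by
      have : ((p + 1 - 2 : ℕ) : ℤ) = p - 1 := by omega
      rw [← this]; exact_mod_cast h1
    have h4 : (fb K Bb k : ℤ) ≤ row (qp ρ K) B k := by exact_mod_cast h2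
    linarith
  have f3 : (L : ℤ) - E ≤ m := by
    have h1 := sum_fb_erase K Bb {k0} (by simpa using hk0)
    rw [Finset.sum_singleton, Finset.card_singleton, hp, hL, Nat.add_sub_cancel] at h1
    have h3 : (Bb.card : ℤ) ≤ m + p * L := by exact_mod_cast h1
    linarith
  obtain ⟨k, hk, hkk0, hk00⟩ : ∃ k ∈ im K Bb, k ≠ k0 ∧ k ≠ 0 := by
    have : 0 < (((im K Bb).erase k0).erase 0).card := by
      have h1 := Finset.pred_card_le_card_erase (s := im K Bb) (a := k0)
      have h2 := Finset.pred_card_le_card_erase (s := (im K Bb).erase k0) (a := 0)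
      omega
    obtain ⟨k, hk⟩ := Finset.card_pos.1 this
    rw [Finset.mem_erase, Finset.mem_erase] at hk
    exact ⟨k, hk.2.2, hk.2.1, hk.1⟩
  obtain ⟨j1, hj1, hj1k⟩ : ∃ j ∈ im K X, j + k ∉ im K X := by
    by_contra hcon
    push Not at hcon
    obtain ⟨g, rfl⟩ := qm_surj K k
    apply hk00
    have : g ∈ K := by
      rw [hK]
      apply mem_stb_of_le
      intro z hz
      rw [hXB, mem_pre] at hz ⊢
      obtain ⟨j, hj, y, hy, hjy⟩ := Finset.mem_add.1 hz
      rw [map_add, ← hjy, add_right_comm]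
      exact Finset.add_mem_add (hcon j hj) hy
    rw [← map_zero (qm K), qm_eq]
    simpa using K.neg_mem this
  have g0 : ∀ c ∈ Z \ im K X, (L : ℤ) - hol + m - 1 ≤ row (qp ρ K) (A + B) c := by
    intro c hc
    rw [Finset.mem_sdiff] at hc
    obtain ⟨j, hj, y, hy, rfl⟩ := Finset.mem_add.1 hc.1
    have h1 := row_add (qp ρ K) A B j y (by rw [image_qp]; exact hj) (by rw [image_qp]; exact hy)
    have h2 := ξ j hj
    have h3 := f1 y hy
    omega
  have hc1 : j1 + k ∈ Z \ im K X := Finset.mem_sdiff.2 ⟨Finset.add_mem_add hj1 hk, hj1k⟩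
  have g1 : (3 * L : ℤ) - hol - E - m - 1 ≤ row (qp ρ K) (A + B) (j1 + k) := by
    have h1 := row_add (qp ρ K) A B j1 k (by rw [image_qp]; exact hj1) (by rw [image_qp]; exact hk)
    have h2 := ξ j1 hj1
    have h3 := f2 k hk hkk0
    omega
  have hcard : (Z \ im K X).card = p := by
    rw [Finset.card_sdiff_of_subset hXZ, hZ, hα]; omega
  have hsumZ : ((p : ℤ) - 1) * (L - hol + m - 1) + ((3 * L : ℤ) - hol - E - m - 1) ≤
      ∑ c ∈ Z \ im K X, (row (qp ρ K) (A + B) c : ℤ) := by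
    rw [← Finset.sum_erase_add _ _ hc1]
    apply add_le_add _ g1
    have := Finset.card_nsmul_le_sum ((Z \ im K X).erase (j1 + k))
      (fun c => (row (qp ρ K) (A + B) c : ℤ)) ((L : ℤ) - hol + m - 1)
      (fun c hc => g0 c (Finset.mem_of_mem_erase hc))
    rw [Finset.card_erase_of_mem hc1, hcard, nsmul_eq_mul] at this
    push_cast [Nat.cast_sub (by omega : 1 ≤ p)] at this
    exact this
  have o4 : (A.card : ℤ) + L * α + ∑ c ∈ Z \ im K X, (row (qp ρ K) (A + B) c : ℤ) ≤
      (A + B).card := by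
    have : A.card + L * α + ∑ c ∈ Z \ im K X, row (qp ρ K) (A + B) c ≤ (A + B).card := by omega
    exact_mod_cast this
  have hmL : (m : ℤ) ≤ L := by rw [← hL]; exact_mod_cast fb_le K Bb k0
  have key : 0 ≤ ((p : ℤ) - 2) * (E - (L - m)) :=
    mul_nonneg (by have : (2 : ℤ) ≤ p := by exact_mod_cast hp2
                   linarith) (by linarith)
  subst hv
  nlinarith

end Ext

open Pointwise
set_option linter.unusedSectionVars false
set_option linter.unusedVariables false

section Main
variable {G : Type*} [AddCommGroup G] [Fintype G] [DecidableEq G]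

lemma peel_ineq (ρ : ℤ →+ G) (A B : Finset ℤ) (s : ℕ)
    (hne : A.image ρ + B.image ρ ≠ Finset.univ)
    (IH : ∀ A' : Finset ℤ, A'.card < A.card → A'.Nonempty →
      A'.image ρ + B.image ρ ≠ Finset.univ →
      (s : ℝ) / 2 + Real.sqrt (2 * A'.card * s) ≤ (A' + B).card - A'.card)
    (P : ℝ) (hP2 : P ^ 2 = 2 * A.card * s) (hP0 : 0 ≤ P)
    (hlt : ((A + B).card : ℝ) - A.card < s / 2 + P)
    (U V : Finset G) (hUne : U.Nonempty) (hU : U ⊆ A.image ρ) (hV : V ⊆ A.image ρ + B.image ρ)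
    (hd : ∀ a ∈ A, ∀ b ∈ B, ρ (a + b) ∈ V → ρ a ∈ U) (hUA : U.card < A.card) :
    2 * P * ((V.card : ℝ) - U.card) < 2 * s * U.card + ((V.card : ℝ) - U.card) ^ 2 := by
  have h1 := peel_card ρ A U hU
  have h2 := peel_sum ρ A B U V hV hd
  set A' := A.filter (fun a => ρ a ∈ U → ∃ a' ∈ A, a' < a ∧ ρ a' = ρ a) with hA'
  have hUc := Finset.card_pos.2 hUne
  have h3 := IH A' (by omega) (Finset.card_pos.1 (by omega)) (by
    intro h
    apply hne
    rw [Finset.eq_univ_iff_forall] at h ⊢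
    intro x
    exact Finset.add_subset_add_right (Finset.image_subset_image (Finset.filter_subset _ _)) (h x))
  set P' := Real.sqrt (2 * A'.card * s) with hP'
  have h4 : P' ^ 2 = 2 * A'.card * s := Real.sq_sqrt (by positivity)
  have h5 : 0 ≤ P' := Real.sqrt_nonneg _
  have h1R : (A'.card : ℝ) + U.card = A.card := by exact_mod_cast h1
  have h2R : ((A' + B).card : ℝ) + V.card ≤ (A + B).card := by exact_mod_cast h2
  have h6 : P' < P - ((V.card : ℝ) - U.card) := by linarith
  have h7 : P' ^ 2 < (P - ((V.card : ℝ) - U.card)) ^ 2 := by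
    apply pow_lt_pow_left₀ h6 h5; norm_num
  rw [h4] at h7
  have : (A'.card : ℝ) = A.card - U.card := by linarith
  rw [this] at h7
  nlinarith

lemma amgm2 (a s P : ℝ) (ha : 0 ≤ a) (hs : 0 ≤ s) (hP2 : P ^ 2 = 2 * a * s) (hP0 : 0 ≤ P) :
    P ≤ a + s / 2 := by
  by_contra h
  push Not at h
  nlinarith [sq_nonneg (a - s / 2)]

set_option maxHeartbeats 1000000 in
lemma setup (ρ : ℤ →+ G) (A B : Finset ℤ) (hA : A.Nonempty) (n : ℤ) (hn : 0 < n) (h0 : 0 ∈ B)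
    (hnB : n ∈ B) (hρ : ρ n = 0) (s : ℕ) (hs1 : 1 ≤ s) (hBb : (B.image ρ).card = s + 1)
    (hgen : ∀ H : AddSubgroup G, (∀ b ∈ B, ρ b ∈ H) → H = ⊤)
    (hne : A.image ρ + B.image ρ ≠ Finset.univ)
    (IH : ∀ A' : Finset ℤ, A'.card < A.card → A'.Nonempty →
      A'.image ρ + B.image ρ ≠ Finset.univ →
      (s : ℝ) / 2 + Real.sqrt (2 * A'.card * s) ≤ (A' + B).card - A'.card)
    (P : ℝ) (hP2 : P ^ 2 = 2 * A.card * s) (hP0 : 0 ≤ P)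
    (hlt : ((A + B).card : ℝ) - A.card < s / 2 + P)
    (K : AddSubgroup G) (hK : K = stb (A.image ρ + B.image ρ)) :
    ∃ (α p L : ℕ) (E hol v : ℤ), (hs K).card = L ∧ (im K (A.image ρ)).card = α ∧
      (im K (B.image ρ)).card = p + 1 ∧
      (im K (A.image ρ) + im K (B.image ρ)).card = α + p ∧ 0 ≤ E ∧ 0 ≤ hol ∧ 1 ≤ v ∧
      v = L - 1 - E - hol ∧ ((A.image ρ).card : ℤ) = α * L - hol ∧ (s : ℤ) + 1 = (p + 1) * L - E ∧
      1 ≤ p ∧ 1 ≤ α ∧ (2 ≤ p → (p : ℤ) * ((2 * p - 1) * v + 2 * E) < 2 * v * α ∧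
        (A.card : ℤ) + (A.image ρ).card + s ≤ (A + B).card) := by
  set X := A.image ρ with hX
  set Bb := B.image ρ with hBbd
  have hXne : X.Nonempty := hA.image _
  have hBne : Bb.Nonempty := ⟨ρ 0, Finset.mem_image_of_mem _ h0⟩
  have h0b : (0 : G) ∈ Bb := Finset.mem_image.2 ⟨0, h0, map_zero _⟩
  obtain ⟨k1, k2⟩ := kneser_q X Bb hXne hBne hK
  have hcXB : (X + Bb).card = (hs K).card * (im K X + im K Bb).card := by
    rw [k1, card_pre]
  have hxa : X.card ≤ A.card := Finset.card_image_le
  have hXsub : X ⊆ X + Bb := fun x hx => by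
    have := Finset.add_mem_add hx h0b
    simpa using this
  have hxle := Finset.card_le_card hXsub
  have hxpos : 0 < X.card := Finset.card_pos.2 hXne
  have hsR : (1 : ℝ) ≤ s := by exact_mod_cast hs1
  have hpA := amgm2 A.card s P (by positivity) (by positivity) hP2 hP0
  -- peel with U = X
  have hpeel : X.card < A.card →
      2 * P * (((X + Bb).card : ℝ) - X.card) < 2 * s * X.card + (((X + Bb).card : ℝ) - X.card) ^ 2 :=
    fun h => peel_ineq ρ A B s hne IH P hP2 hP0 hlt X (X + Bb) hXne (Finset.Subset.refl _)
      (Finset.Subset.refl _) (fun a ha b hb _ => Finset.mem_image_of_mem _ ha) h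
  -- option bound
  have hopt : A.card + (X + Bb).card ≤ (A + B).card := by
    have o := option_lemma ρ A B n hn h0 hnB hρ (X + Bb) (Finset.Subset.refl _)
    have o1 : A.filter (fun a => ρ a ∈ X + Bb) = A := by
      apply Finset.filter_true_of_mem
      intro a ha
      exact hXsub (Finset.mem_image_of_mem _ ha)
    rw [o1] at o
    exact o.trans (Finset.card_filter_le _ _)
  have hlossy : (X + Bb).card < X.card + s := by
    by_contra hcon
    push Not at hcon
    have hconR : (X.card : ℝ) + s ≤ (X + Bb).card := by exact_mod_cast hcon
    have hoptR : (A.card : ℝ) + (X + Bb).card ≤ (A + B).card := by exact_mod_cast hopt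
    rcases Nat.lt_or_ge X.card A.card with h | h
    · have h1 := hpeel h
      have hx0 : (0 : ℝ) < X.card := by exact_mod_cast hxpos
      obtain ⟨f, hf⟩ : ∃ f : ℝ, ((X + Bb).card : ℝ) = X.card + f := ⟨_, (add_sub_cancel _ _).symm⟩
      rw [hf] at h1 hconR hoptR
      have hfs : (s : ℝ) ≤ f := by linarith
      have hPl : (X.card : ℝ) + f - s / 2 < P := by linarith
      have e : (X.card : ℝ) + f - X.card = f := by ring
      rw [e] at h1
      have := mul_lt_mul_of_pos_right hPl (by linarith : 0 < f)
      have h5 : 0 ≤ (f - s) * (f + 2 * X.card) := mul_nonneg (by linarith) (by linarith)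
      nlinarith
    · have : (A.card : ℝ) ≤ X.card := by exact_mod_cast h
      linarith
  set L := (hs K).card with hLd
  set α := (im K X).card with hαd
  have hL0 : 0 < L := hs_pos K
  have hα1 : 1 ≤ α := Finset.card_pos.2 (hXne.image _)
  have hY1 : 1 ≤ (im K Bb).card := Finset.card_pos.2 (hBne.image _)
  obtain ⟨p, hp⟩ : ∃ p, (im K Bb).card = p + 1 := ⟨(im K Bb).card - 1, by omega⟩
  have hx1 : X.card ≤ L * α := card_le_im K X
  have hb1 : Bb.card ≤ L * (im K Bb).card := card_le_im K Bb
  rw [hp] at k2 hb1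
  have hZ : (im K X + im K Bb).card = α + p := by
    have lo : α + p ≤ (im K X + im K Bb).card := by omega
    by_contra hcon
    have hi : α + p + 1 ≤ (im K X + im K Bb).card := by omega
    have h1 := Nat.mul_le_mul_left L hi
    rw [← hcXB] at h1
    have e : L * (α + p + 1) = L * α + L * (p + 1) := by ring
    rw [e] at h1
    omega
  have hp1 : 1 ≤ p := by
    by_contra hcon
    have hp0 : p = 0 := by omega
    subst hp0
    apply hne
    have hKtop : K = ⊤ := by
      apply hgen
      intro b hb
      have hb' : qm K (ρ b) ∈ im K Bb := mem_im.2 ⟨_, Finset.mem_image_of_mem _ hb, rfl⟩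
      have h0' : qm K 0 ∈ im K Bb := mem_im.2 ⟨_, h0b, rfl⟩
      have := Finset.card_le_one.1 (by omega : (im K Bb).card ≤ 1) _ h0' _ hb'
      rw [qm_eq] at this
      simpa using this
    rw [Finset.eq_univ_iff_forall]
    obtain ⟨x0, hx0⟩ := hXne
    intro x
    have : x - x0 ∈ stb (X + Bb) := by rw [← hK, hKtop]; trivial
    have := (mem_stb.1 this x0).2 (hXsub hx0)
    simpa using this
  have hcXB' : ((X + Bb).card : ℤ) = L * (α + p) := by
    rw [hcXB, hZ]; push_cast; ring
  have hx1' : (X.card : ℤ) ≤ L * α := by exact_mod_cast hx1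
  have hb1' : (s : ℤ) + 1 ≤ L * (p + 1) := by
    rw [hBb] at hb1; exact_mod_cast hb1
  have hly : ((X + Bb).card : ℤ) < X.card + s := by exact_mod_cast hlossy
  refine ⟨α, p, L, (p + 1) * L - (s + 1), α * L - X.card,
    L - 1 - ((p + 1) * L - (s + 1)) - (α * L - X.card), rfl, rfl, hp, hZ, by linarith, by linarith,
    ?_, rfl, by ring, by ring, hp1, hα1, ?_⟩
  · rw [hcXB'] at hly
    nlinarith
  intro hp2
  set E : ℤ := (p + 1) * L - (s + 1) with hE
  set hol : ℤ := α * L - X.card with hhol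
  set v : ℤ := L - 1 - E - hol with hv
  have hE0 : 0 ≤ E := by rw [hE]; linarith
  have hh0 : 0 ≤ hol := by rw [hhol]; linarith
  have hv1 : 1 ≤ v := by
    rw [hv, hE, hhol]
    rw [hcXB'] at hly
    nlinarith
  have hex := extra ρ A B n hn h0 hnB hρ K hK L α p rfl rfl hp hp2 hZ E hol v
    (by rw [hBb, hE]; push_cast; ring) (by rw [hhol]; ring) hv
  have hp2' : (2 : ℤ) ≤ p := by exact_mod_cast hp2
  have hpv : v ≤ p * v := le_mul_of_one_le_left (by linarith) (by linarith)
  have hsum : (A.card : ℤ) + X.card + s ≤ (A + B).card := by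
    have : (X.card : ℤ) = α * L - hol := by rw [hhol]; ring
    have h2 : (s : ℤ) + 1 = (p + 1) * L - E := by rw [hE]; ring
    linarith
  refine ⟨?_, hsum⟩
  rcases Nat.lt_or_ge X.card A.card with h | h
  · have h1 := hpeel h
    have hxeq : (X.card : ℤ) = α * L - hol := by rw [hhol]; ring
    have hseq : (s : ℤ) = (p + 1) * L - E - 1 := by rw [hE]; ring
    -- move to reals
    have r1 : ((X + Bb).card : ℝ) = L * (α + p) := by exact_mod_cast hcXB'
    have r2 : (X.card : ℝ) = α * L - hol := by exact_mod_cast hxeq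
    have r3 : (s : ℝ) = (p + 1) * L - E - 1 := by exact_mod_cast hseq
    have r4 : (v : ℝ) = L - 1 - E - hol := by rw [hv]; push_cast; ring
    have r5 : (A.card : ℝ) + (α + p) * L + p * v + E ≤ (A + B).card := by exact_mod_cast hex
    have r6 : (0 : ℝ) ≤ hol := by exact_mod_cast hh0
    have r7 : (0 : ℝ) ≤ E := by exact_mod_cast hE0
    have r8 : (1 : ℝ) ≤ v := by exact_mod_cast hv1
    have r9 : (2 : ℝ) ≤ p := by exact_mod_cast hp2
    have r10 : (1 : ℝ) ≤ L := by exact_mod_cast hL0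
    have r11 : (0 : ℝ) < X.card := by exact_mod_cast hxpos
    set f : ℝ := p * L + hol with hf
    have ef : ((X + Bb).card : ℝ) - X.card = f := by rw [r1, r2, hf]; ring
    have esf : (s : ℝ) = f + v := by rw [r3, r4, hf]; ring
    rw [ef] at h1
    have hfpos : 0 < f := by rw [hf]; nlinarith
    have hPl : (X.card : ℝ) + f + (p * v + E) - s / 2 < P := by
      have : (X.card : ℝ) + f = (α + p) * L := by rw [r2, hf]; ring
      linarith
    have h2 := mul_lt_mul_of_pos_right hPl hfpos
    have h3 : f * ((2 * p - 1) * v + 2 * E) < 2 * v * X.card := by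
      rw [esf] at h1 h2; nlinarith
    have h4 : (p * L : ℝ) * ((2 * p - 1) * v + 2 * E) ≤ f * ((2 * p - 1) * v + 2 * E) := by
      apply mul_le_mul_of_nonneg_right (by rw [hf]; linarith)
      have : 0 ≤ (2 * (p : ℝ) - 1) * v := mul_nonneg (by linarith) (by linarith)
      linarith
    have h5 : 2 * v * (X.card : ℝ) ≤ 2 * v * (α * L) := by
      apply mul_le_mul_of_nonneg_left (by linarith) (by linarith)
    have h6 : (L : ℝ) * (p * ((2 * p - 1) * v + 2 * E)) < L * (2 * v * α) := by linarith
    have h7 := lt_of_mul_lt_mul_left h6 (by linarith)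
    exact_mod_cast h7
  · exfalso
    have : (A.card : ℝ) ≤ X.card := by exact_mod_cast h
    have hR : (A.card : ℝ) + X.card + s ≤ (A + B).card := by exact_mod_cast hsum
    linarith

/-- The quantity kappa. -/
noncomputable def kap (Bb : Finset G) (H : AddSubgroup G) : ℕ := ((im H Bb).card - 1) * (hs H).card

lemma exists_min_H (Bb : Finset G) (K : AddSubgroup G) (hK : im K Bb ≠ Finset.univ) :
    ∃ H : AddSubgroup G, K ≤ H ∧ im H Bb ≠ Finset.univ ∧
      (∀ T : AddSubgroup G, K ≤ T → im T Bb ≠ Finset.univ →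
        kap Bb H < kap Bb T ∨ (kap Bb H = kap Bb T ∧ (hs H).card ≤ (hs T).card)) := by
  let S : Set (AddSubgroup G) := {T | K ≤ T ∧ im T Bb ≠ Finset.univ}
  let μ : AddSubgroup G → ℕ := fun T => kap Bb T * (Fintype.card G + 1) + (hs T).card
  obtain ⟨H, hH, hmin⟩ := WellFounded.has_min (measure μ).wf S ⟨K, le_refl _, hK⟩
  refine ⟨H, hH.1, hH.2, fun T h1 h2 => ?_⟩
  have h3 : ¬ (μ T < μ H) := hmin T ⟨h1, h2⟩
  have cT : (hs T).card ≤ Fintype.card G := Finset.card_le_univ _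
  have cH : (hs H).card ≤ Fintype.card G := Finset.card_le_univ _
  rcases lt_trichotomy (kap Bb H) (kap Bb T) with h | h | h
  · exact Or.inl h
  · right
    refine ⟨h, ?_⟩
    simp only [μ] at h3
    rw [h] at h3
    omega
  · exfalso
    apply h3
    simp only [μ]
    have : kap Bb T + 1 ≤ kap Bb H := h
    have := Nat.mul_le_mul_right (Fintype.card G + 1) this
    rw [add_mul] at this
    omega

lemma claimN (Bb W : Finset G) (K : AddSubgroup G) (hW : W.Nonempty) (hB : Bb.Nonempty)
    (hK : K ≤ stb W) (hne : W + Bb ≠ Finset.univ) :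
    ∃ T : AddSubgroup G, K ≤ T ∧ im T Bb ≠ Finset.univ ∧ (hs T).card ≤ (hs T).card * (im T W).card ∧
      (∀ H, H ≤ stb W → H ≤ T) ∧
      W.card ≤ (hs T).card * (im T W).card ∧
      (hs T).card * (im T W).card + kap Bb T ≤ (W + Bb).card := by
  obtain ⟨k1, k2⟩ := kneser_q W Bb hW hB rfl
  set T := stb (W + Bb) with hT
  have h1 : 1 ≤ (im T W).card := Finset.card_pos.2 (hW.image _)
  have h2 : 1 ≤ (im T Bb).card := Finset.card_pos.2 (hB.image _)
  refine ⟨T, le_stb_add Bb hK, ?_, Nat.le_mul_of_pos_right _ h1, fun H hH => le_stb_add Bb hH,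
    card_le_im T W, ?_⟩
  · intro h
    apply hne
    rw [k1, h, Finset.eq_univ_iff_forall]
    intro x
    rw [mem_pre]
    obtain ⟨w, hw⟩ := (hW.image (qm T))
    exact Finset.mem_add.2 ⟨w, hw, qm T x - w, Finset.mem_univ _, by abel⟩
  · rw [k1, card_pre, kap, mul_comm ((im T Bb).card - 1), ← mul_add]
    apply Nat.mul_le_mul_left
    omega

lemma claimM (Bb W : Finset G) (K H : AddSubgroup G) (hW : W.Nonempty) (hB : Bb.Nonempty)
    (hKH : K ≤ H) (hH : H ≤ stb W) (hne : W + Bb ≠ Finset.univ)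
    (hmin : ∀ T : AddSubgroup G, K ≤ T → im T Bb ≠ Finset.univ →
        kap Bb H < kap Bb T ∨ (kap Bb H = kap Bb T ∧ (hs H).card ≤ (hs T).card)) :
    W.card + kap Bb H ≤ (W + Bb).card := by
  obtain ⟨T, t1, t2, _, t3, t4, t5⟩ := claimN Bb W K hW hB (hKH.trans hH) hne
  rcases hmin T t1 t2 with h | h <;> omega

lemma claimAt (Bb W : Finset G) (K H : AddSubgroup G) (hW : W.Nonempty) (hB : Bb.Nonempty)
    (hKH : K ≤ H) (hK : K ≤ stb W) (hne : W + Bb ≠ Finset.univ) (hlt : W.card < (hs H).card)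
    (hmin : ∀ T : AddSubgroup G, K ≤ T → im T Bb ≠ Finset.univ →
        kap Bb H < kap Bb T ∨ (kap Bb H = kap Bb T ∧ (hs H).card ≤ (hs T).card)) :
    W.card + kap Bb H + (hs K).card ≤ (W + Bb).card := by
  obtain ⟨T, t1, t2, t3, _, t4, t5⟩ := claimN Bb W K hW hB hK hne
  have hst : W.card + kap Bb H < (W + Bb).card := by
    rcases hmin T t1 t2 with h | h <;> omega
  have d1 : (hs K).card ∣ W.card := by rw [card_eq_im hK]; exact Dvd.intro _ rfl
  have d2 : (hs K).card ∣ kap Bb H := (hs_dvd hKH).mul_left _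
  have d3 : (hs K).card ∣ (W + Bb).card := by
    rw [card_eq_im (le_stb_add Bb hK)]; exact Dvd.intro _ rfl
  obtain ⟨x, hx⟩ := dvd_add d1 d2
  obtain ⟨y, hy⟩ := d3
  rw [hx, hy] at hst ⊢
  have := Nat.lt_of_mul_lt_mul_left hst
  have := Nat.mul_le_mul_left (hs K).card this
  rw [Nat.mul_succ] at this
  exact this

end Main

open Pointwise
set_option linter.unusedSectionVars false
set_option linter.unusedVariables false

section Main2
variable {G : Type*} [AddCommGroup G] [Fintype G] [DecidableEq G]

lemma nonwrap_hW (ρ : ℤ →+ G) (A B : Finset ℤ) (K H : AddSubgroup G) (hB : B.Nonempty)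
    (hKH : K ≤ H) (pH : ℕ) (hpH : (im H (B.image ρ)).card = pH + 1)
    (hnw : (im H (A.image ρ)).card + pH ≤ Fintype.card (G ⧸ H))
    (hmin : ∀ T : AddSubgroup G, K ≤ T → im T (B.image ρ) ≠ Finset.univ →
        kap (B.image ρ) H < kap (B.image ρ) T ∨
        (kap (B.image ρ) H = kap (B.image ρ) T ∧ (hs H).card ≤ (hs T).card)) :
    ∀ W ⊆ A.image (qp ρ H), W.Nonempty → W.card + pH ≤ (W + B.image (qp ρ H)).card := by
  intro W hW hWne
  rw [image_qp] at hW ⊢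
  by_cases h : pre H W + B.image ρ = Finset.univ
  · rw [pre_add] at h
    have h1 : W + im H (B.image ρ) = Finset.univ := by
      rw [Finset.eq_univ_iff_forall] at h ⊢
      intro y
      obtain ⟨x, rfl⟩ := qm_surj H y
      exact mem_pre.1 (h x)
    rw [h1, Finset.card_univ]
    have := Finset.card_le_card hW
    omega
  · have hne : (pre H W).Nonempty := by
      obtain ⟨w, hw⟩ := hWne
      obtain ⟨x, rfl⟩ := qm_surj H w
      exact ⟨x, mem_pre.2 hw⟩
    have h1 := claimM (B.image ρ) (pre H W) K H hne (hB.image _) hKH (le_stb_pre H W) h hmin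
    rw [pre_add, card_pre, card_pre, kap, hpH, Nat.add_sub_cancel, mul_comm pH, ← mul_add] at h1
    exact Nat.le_of_mul_le_mul_left h1 (hs_pos H)

lemma wrap_UV (X Bb : Finset G) (K H : AddSubgroup G) (hX : X.Nonempty) (hB : Bb.Nonempty)
    (hK : K = stb (X + Bb)) (hne : X + Bb ≠ Finset.univ)
    (hKH : K ≤ H) (pH : ℕ) (hpH : (im H Bb).card = pH + 1)
    (hw : Fintype.card (G ⧸ H) < (im H X).card + pH)
    (hmin : ∀ T : AddSubgroup G, K ≤ T → im T Bb ≠ Finset.univ →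
        kap Bb H < kap Bb T ∨ (kap Bb H = kap Bb T ∧ (hs H).card ≤ (hs T).card)) :
    ∃ U V : Finset G, U.Nonempty ∧ U ⊆ X ∧ V ⊆ X + Bb ∧
      (∀ a ∈ X, ∀ b ∈ Bb, a + b ∈ V → a ∈ U) ∧ U.card + (hs K).card ≤ V.card ∧
      V.card + (hs K).card ≤ (hs H).card := by
  obtain ⟨z0, hz0⟩ : ∃ z0, z0 ∉ X + Bb := by
    by_contra h
    push Not at h
    exact hne (Finset.eq_univ_iff_forall.2 h)
  set c := qm H z0 with hc
  set R := Finset.univ.filter (fun x => qm H x = c) with hR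
  have hRc : R.card = (hs H).card := card_row H c
  set V := R ∩ (X + Bb) with hV
  set Z := R \ (X + Bb) with hZ
  set U := X.filter (fun x => c - qm H x ∈ im H Bb) with hU
  have hVZ : V.card + Z.card = (hs H).card := by
    rw [← hRc]; exact Finset.card_inter_add_card_sdiff _ _
  have hKR : K ≤ stb R := by
    intro g hg
    apply mem_stb_of_le
    intro x hx
    rw [hR, Finset.mem_filter] at hx ⊢
    refine ⟨Finset.mem_univ _, ?_⟩
    rw [← hx.2, eq_comm, qm_eq]
    simpa using hKH hg
  have hKZ : K ≤ stb Z := by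
    intro g hg
    have g1 := mem_stb.1 (hKR hg)
    have g2 := hg
    rw [hK, mem_stb] at g2
    rw [mem_stb]
    intro x
    rw [hZ, Finset.mem_sdiff, Finset.mem_sdiff, g1, g2]
  have hz0Z : z0 ∈ Z := by
    rw [hZ, Finset.mem_sdiff, hR, Finset.mem_filter]
    exact ⟨⟨Finset.mem_univ _, rfl⟩, hz0⟩
  have hZL : (hs K).card ≤ Z.card := by
    rw [card_eq_im hKZ]
    apply Nat.le_mul_of_pos_right
    exact Finset.card_pos.2 ⟨_, mem_im.2 ⟨z0, hz0Z, rfl⟩⟩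
  -- pigeonhole
  have hN : ((im H Bb).image (fun y => c - y)).card = pH + 1 := by
    rw [Finset.card_image_of_injective _ (sub_right_injective), hpH]
  obtain ⟨w, hw1, hw2⟩ : ∃ w, w ∈ im H X ∧ w ∈ (im H Bb).image (fun y => c - y) := by
    by_contra hcon
    push Not at hcon
    have hd : Disjoint (im H X) ((im H Bb).image (fun y => c - y)) :=
      Finset.disjoint_left.2 hcon
    have := Finset.card_le_univ (im H X ∪ (im H Bb).image (fun y => c - y))
    rw [Finset.card_union_of_disjoint hd, hN] at this
    omega
  obtain ⟨x1, hx1, rfl⟩ := mem_im.1 hw1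
  obtain ⟨y1, hy1, hxy⟩ := Finset.mem_image.1 hw2
  obtain ⟨b1, hb1, rfl⟩ := mem_im.1 hy1
  have hUne : U.Nonempty := ⟨x1, by
    rw [hU, Finset.mem_filter]
    refine ⟨hx1, ?_⟩
    rw [← hxy]; simpa using hy1⟩
  have hVne : V.Nonempty := ⟨x1 + b1, by
    rw [hV, Finset.mem_inter, hR, Finset.mem_filter]
    refine ⟨⟨Finset.mem_univ _, ?_⟩, Finset.add_mem_add hx1 hb1⟩
    rw [map_add, ← hxy]; abel⟩
  have hVpos := Finset.card_pos.2 hVne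
  have hZcard : (-Z).card = Z.card := Finset.card_neg Z
  have hdis : ∀ x ∈ X, -x ∉ -Z + Bb := by
    intro x hx h
    obtain ⟨z, hz, b, hb, hzb⟩ := Finset.mem_add.1 h
    rw [Finset.mem_neg'] at hz
    rw [hZ, Finset.mem_sdiff] at hz
    apply hz.2
    have : -z = x + b := by
      have : x = -(z + b) := by rw [hzb, neg_neg]
      rw [this]; abel
    rw [this]
    exact Finset.add_mem_add hx hb
  have hAt := claimAt Bb (-Z) K H (by rw [Finset.neg_nonempty_iff]; exact ⟨z0, hz0Z⟩) hB hKH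
    (le_stb_neg hKZ) (by
      intro h
      obtain ⟨x, hx⟩ := hX
      apply hdis x hx
      rw [h]; exact Finset.mem_univ _) (by omega) hmin
  set N := pre H ((im H Bb).image (fun y => c - y)) with hNd
  have hNc : N.card = (hs H).card * (pH + 1) := by rw [hNd, card_pre, hN]
  have hUN : U ∪ -(-Z + Bb) ⊆ N := by
    intro g hg
    rw [hNd, mem_pre, Finset.mem_image]
    rw [Finset.mem_union] at hg
    rcases hg with hg | hg
    · rw [hU, Finset.mem_filter] at hg
      exact ⟨_, hg.2, by abel⟩
    · rw [Finset.mem_neg'] at hg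
      obtain ⟨z, hz, b, hb, hzb⟩ := Finset.mem_add.1 hg
      rw [Finset.mem_neg', hZ, Finset.mem_sdiff, hR, Finset.mem_filter] at hz
      refine ⟨qm H b, mem_im.2 ⟨b, hb, rfl⟩, ?_⟩
      rw [← hz.1.2, ← map_sub]
      congr 1
      have : g = -(z + b) := by rw [hzb, neg_neg]
      rw [this]; abel
  have hUd : Disjoint U (-(-Z + Bb)) := by
    rw [Finset.disjoint_left]
    intro x hx h
    rw [Finset.mem_neg'] at h
    exact hdis x (Finset.mem_filter.1 hx).1 h
  have hcc := Finset.card_le_card hUN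
  rw [Finset.card_union_of_disjoint hUd, Finset.card_neg, hNc] at hcc
  refine ⟨U, V, hUne, Finset.filter_subset _ _, Finset.inter_subset_right, ?_, ?_, by omega⟩
  · intro a ha b hb h
    rw [hV, Finset.mem_inter, hR, Finset.mem_filter] at h
    rw [hU, Finset.mem_filter]
    refine ⟨ha, ?_⟩
    rw [← h.1.2, map_add, add_sub_cancel_left]
    exact mem_im.2 ⟨b, hb, rfl⟩
  · rw [hZcard, kap, hpH, Nat.add_sub_cancel] at hAt
    rw [mul_comm pH] at hAt
    rw [mul_add, mul_one] at hcc
    omega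

lemma num1 (p pH S L αH α E hol v s : ℤ) (hpH : 1 ≤ pH) (hS : 1 ≤ S) (hL : 1 ≤ L) (hE : 0 ≤ E)
    (hhol : 0 ≤ hol) (hv : 1 ≤ v) (hvd : v = L - 1 - E - hol) (hs : s + 1 = (p + 1) * L - E)
    (hp : pH * S + 1 ≤ p) (hα : α ≤ αH * S)
    (star : p * ((2 * p - 1) * v + 2 * E) < 2 * v * α) :
    1 ≤ s - pH * (L * S) ∧
    pH * (L * S - (s - pH * (L * S))) ≤ (αH + pH) * (s - pH * (L * S)) := by
  have h1 : (pH * S + 1) * L ≤ p * L := mul_le_mul_of_nonneg_right hp (by linarith)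
  have hu : L + 1 ≤ s - pH * (L * S) := by nlinarith
  have hpHS : 1 ≤ pH * S := by nlinarith
  have h2 : p * (2 * p - 1) < 2 * α := by
    have h3 : v * (p * (2 * p - 1)) < v * (2 * α) := by
      have : 0 ≤ p * (2 * E) := mul_nonneg (by linarith) (by linarith)
      linarith
    exact lt_of_mul_lt_mul_left h3 (by linarith)
  have h4 : pH * S ≤ αH := by
    by_contra hcon
    push Not at hcon
    have h5 : (pH * S + 1) * (2 * (pH * S + 1) - 1) ≤ p * (2 * p - 1) :=
      mul_le_mul hp (by linarith) (by linarith) (by linarith)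
    have h6 : αH * S ≤ pH * S * S := mul_le_mul_of_nonneg_right hcon.le (by linarith)
    have h7 : S ≤ pH * S := le_mul_of_one_le_left (by linarith) hpH
    have h8 : pH * S * S ≤ pH * S * (pH * S) := mul_le_mul_of_nonneg_left h7 (by linarith)
    nlinarith
  refine ⟨by linarith, ?_⟩
  generalize s - pH * (L * S) = u at *
  have h9 : pH * S * L ≤ αH * u := mul_le_mul h4 (by linarith) (by linarith) (by linarith)
  have h10 : 0 ≤ pH * u := mul_nonneg (by linarith) (by linarith)
  linarith

lemma num2 (p S L α E hol v s x : ℤ) (hS : 2 ≤ S) (hL : 1 ≤ L) (hE : 0 ≤ E)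
    (hhol : 0 ≤ hol) (hv : 1 ≤ v) (hvd : v = L - 1 - E - hol) (hs : s + 1 = (p + 1) * L - E)
    (hp : S + 1 ≤ p) (hx : x = α * L - hol)
    (star : p * ((2 * p - 1) * v + 2 * E) < 2 * v * α) : s * (S - 2) < x := by
  have h2 : p * (2 * p - 1) < 2 * α := by
    have h3 : v * (p * (2 * p - 1)) < v * (2 * α) := by
      have : 0 ≤ p * (2 * E) := mul_nonneg (by linarith) (by linarith)
      linarith
    exact lt_of_mul_lt_mul_left h3 (by linarith)
  have h3 : s ≤ (p + 1) * L := by linarith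
  have h4 : s * (S - 2) ≤ (p + 1) * L * (S - 2) := mul_le_mul_of_nonneg_right h3 (by linarith)
  have h5 : (p + 1) * L * (S - 2) ≤ (p + 1) * L * (p - 3) := by
    apply mul_le_mul_of_nonneg_left (by linarith)
    exact mul_nonneg (by linarith) (by linarith)
  have h6 : (p + 1) * (p - 3) ≤ α - 1 := by nlinarith
  have h7 : (p + 1) * (p - 3) * L ≤ (α - 1) * L := mul_le_mul_of_nonneg_right h6 (by linarith)
  nlinarith

set_option maxHeartbeats 1000000 in
theorem main_ind (ρ : ℤ →+ G) (B : Finset ℤ) (n : ℤ) (hn : 0 < n) (h0 : 0 ∈ B)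
    (hnB : n ∈ B) (hρ : ρ n = 0) (s : ℕ) (hs1 : 1 ≤ s) (hBc : B.card = s + 2)
    (hBb : (B.image ρ).card = s + 1)
    (hgen : ∀ H : AddSubgroup G, (∀ b ∈ B, ρ b ∈ H) → H = ⊤) :
    ∀ (N : ℕ) (A : Finset ℤ), A.card = N → A.Nonempty →
      A.image ρ + B.image ρ ≠ Finset.univ →
      (s : ℝ) / 2 + Real.sqrt (2 * A.card * s) ≤ (A + B).card - A.card := by
  intro N
  induction N using Nat.strong_induction_on with
  | _ N ih =>
  intro A hAN hA hne
  by_contra hcon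
  have IH : ∀ A' : Finset ℤ, A'.card < A.card → A'.Nonempty →
      A'.image ρ + B.image ρ ≠ Finset.univ →
      (s : ℝ) / 2 + Real.sqrt (2 * A'.card * s) ≤ (A' + B).card - A'.card :=
    fun A' h1 h2 h3 => ih A'.card (by omega) A' rfl h2 h3
  obtain ⟨P, hPd⟩ : ∃ P, P = Real.sqrt (2 * A.card * s) := ⟨_, rfl⟩
  have hP2 : P ^ 2 = 2 * A.card * s := by rw [hPd]; exact Real.sq_sqrt (by positivity)
  have hP0 : 0 ≤ P := by rw [hPd]; exact Real.sqrt_nonneg _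
  have hlt : ((A + B).card : ℝ) - A.card < s / 2 + P := by
    rw [hPd]; exact lt_of_not_ge hcon
  obtain ⟨K, hK⟩ : ∃ K, K = stb (A.image ρ + B.image ρ) := ⟨_, rfl⟩
  obtain ⟨α, p, L, E, hol, v, hL, hα, hp, hZ, hE0, hh0, hv1, hvd, hx, hsd, hp1, hα1, hstar⟩ :=
    setup ρ A B hA n hn h0 hnB hρ s hs1 hBb hgen hne IH P hP2 hP0 hlt K hK
  have hBne : B.Nonempty := ⟨0, h0⟩
  have hXne : (A.image ρ).Nonempty := hA.image _
  have hinj : Set.InjOn ρ (B.erase n) := by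
    apply Finset.injOn_of_card_image_eq
    have : (B.erase n).image ρ = B.image ρ := by
      apply Finset.Subset.antisymm (Finset.image_subset_image (Finset.erase_subset _ _))
      intro y hy
      obtain ⟨b, hb, rfl⟩ := Finset.mem_image.1 hy
      by_cases hbn : b = n
      · subst hbn
        rw [hρ]
        exact Finset.mem_image.2 ⟨0, Finset.mem_erase.2 ⟨by omega, h0⟩, map_zero _⟩
      · exact Finset.mem_image_of_mem _ (Finset.mem_erase.2 ⟨hbn, hb⟩)
    rw [this, hBb, Finset.card_erase_of_mem hnB, hBc]
    rfl
  have hKu : im K (B.image ρ) ≠ Finset.univ := by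
    intro h
    apply hne
    rw [(kneser_q _ _ hXne (hBne.image ρ) hK).1, h, Finset.eq_univ_iff_forall]
    intro x
    rw [mem_pre]
    obtain ⟨w, hw⟩ := (hXne.image (qm K))
    exact Finset.mem_add.2 ⟨w, hw, qm K x - w, Finset.mem_univ _, by abel⟩
  obtain ⟨H, hKH, hHu, hmin⟩ := exists_min_H (B.image ρ) K hKu
  have hYH : 1 ≤ (im H (B.image ρ)).card := Finset.card_pos.2 ((hBne.image _).image _)
  obtain ⟨pH, hpH⟩ : ∃ pH, (im H (B.image ρ)).card = pH + 1 :=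
    ⟨(im H (B.image ρ)).card - 1, by omega⟩
  have h0b : (0 : G) ∈ B.image ρ := Finset.mem_image.2 ⟨0, h0, map_zero _⟩
  have hpH1 : 1 ≤ pH := by
    by_contra hc
    have hp0 : pH = 0 := by omega
    subst hp0
    apply hHu
    have h0' : qm H 0 ∈ im H (B.image ρ) := mem_im.2 ⟨_, h0b, rfl⟩
    have hHt : H = ⊤ := by
      apply hgen
      intro b hb
      have hb' : qm H (ρ b) ∈ im H (B.image ρ) := mem_im.2 ⟨_, Finset.mem_image_of_mem _ hb, rfl⟩
      have := Finset.card_le_one.1 (by omega : (im H (B.image ρ)).card ≤ 1) _ h0' _ hb'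
      rw [qm_eq] at this
      simpa using this
    rw [Finset.eq_univ_iff_forall]
    intro y
    obtain ⟨x, rfl⟩ := qm_surj H y
    have : qm H x = qm H 0 := by rw [qm_eq, hHt]; trivial
    rw [this]; exact h0'
  have hkH : kap (B.image ρ) H = pH * (hs H).card := by rw [kap, hpH, Nat.add_sub_cancel]
  have hkK : kap (B.image ρ) K = p * L := by rw [kap, hp, Nat.add_sub_cancel, hL]
  obtain ⟨S, hS⟩ := hs_dvd hKH
  rw [hL] at hS
  have hL1 : 1 ≤ L := by rw [← hL]; exact hs_pos K
  have hHpos := hs_pos H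
  have hS1 : 1 ≤ S := by
    by_contra hc
    have : S = 0 := by omega
    rw [this] at hS; omega
  have hcase : K = H ∨ pH * S + 1 ≤ p := by
    rcases hmin K le_rfl hKu with h | h
    · right
      rw [hkH, hkK, hS] at h
      have : L * (pH * S) < L * p := by linarith
      exact Nat.lt_of_mul_lt_mul_left this
    · left; exact eq_of_hs hKH h.2
  obtain ⟨αH, hαH⟩ : ∃ αH, (im H (A.image ρ)).card = αH := ⟨_, rfl⟩
  have hααH : α ≤ αH * S := by
    have : pre K (im K (A.image ρ)) ⊆ pre H (im H (A.image ρ)) := by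
      intro g hg
      rw [mem_pre] at hg ⊢
      obtain ⟨x, hx, hxg⟩ := mem_im.1 hg
      refine mem_im.2 ⟨x, hx, ?_⟩
      rw [qm_eq] at hxg ⊢
      exact hKH hxg
    have := Finset.card_le_card this
    rw [card_pre, card_pre, hα, hαH, hL, hS, mul_assoc] at this
    have := Nat.le_of_mul_le_mul_left this hL1
    linarith
  rcases Nat.lt_or_ge (Fintype.card (G ⧸ H)) (αH + pH) with hw | hnw
  · -- wrap
    rcases hcase with hKe | hpS
    · subst hKe
      have e1 : pH = p := by omega
      have e2 : αH = α := by omega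
      rw [e1, e2, ← hZ] at hw
      exact absurd (Finset.card_le_univ _) (not_le.2 hw)
    · obtain ⟨U, V, u1, u2, u3, u4, u5, u6⟩ := wrap_UV (A.image ρ) (B.image ρ) K H hXne
        (hBne.image _) hK hne hKH pH hpH (by rw [hαH]; exact hw) hmin
      rw [hL] at u5 u6
      rw [hS] at u6
      have hS2 : 2 ≤ S := by
        by_contra hc
        have : S = 1 := by omega
        rw [this] at u6; omega
      have hSp : S + 1 ≤ p := le_trans (by nlinarith) hpS
      obtain ⟨star, hbig⟩ := hstar (by omega)
      have hn2 := num2 p S L α E hol v s (A.image ρ).card (by exact_mod_cast hS2)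
        (by exact_mod_cast hL1) hE0 hh0 hv1 hvd hsd (by exact_mod_cast hSp) hx star
      have q1 : (U.card : ℤ) + L ≤ V.card := by exact_mod_cast u5
      have q2 : (V.card : ℤ) + L ≤ L * S := by exact_mod_cast u6
      have q3 : (1 : ℤ) ≤ L := by exact_mod_cast hL1
      have q4 : (2 : ℤ) ≤ S := by exact_mod_cast hS2
      have q5 : (pH * S + 1 : ℤ) * L ≤ p * L :=
        mul_le_mul_of_nonneg_right (by exact_mod_cast hpS) (by linarith)
      have q6 : (S : ℤ) * L ≤ pH * S * L := by
        apply mul_le_mul_of_nonneg_right _ (by linarith)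
        apply le_mul_of_one_le_left (by linarith)
        exact_mod_cast hpH1
      have hLS : (L : ℤ) * S ≤ s := by linarith
      have hUA : U.card < A.card := by
        have h1 : (A.image ρ).card ≤ A.card := Finset.card_image_le
        have h2 : (U.card : ℤ) < (A.image ρ).card := by
          have : (L : ℤ) * (S - 2) ≤ s * (S - 2) :=
            mul_le_mul_of_nonneg_right (by nlinarith) (by linarith)
          linarith
        have : U.card < (A.image ρ).card := by exact_mod_cast h2
        omega
      have hpe := peel_ineq ρ A B s hne IH P hP2 hP0 hlt U V u1 u2 u3 (by
        intro a ha b hb h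
        exact u4 _ (Finset.mem_image_of_mem _ ha) _ (Finset.mem_image_of_mem _ hb)
          (by rw [← map_add]; exact h)) hUA
      have w1 : (U.card : ℝ) + L ≤ V.card := by exact_mod_cast q1
      have w2 : (V.card : ℝ) + L ≤ L * S := by exact_mod_cast q2
      have w3 : (1 : ℝ) ≤ L := by exact_mod_cast q3
      have w4 : (2 : ℝ) ≤ S := by exact_mod_cast q4
      have w5 : (L : ℝ) * S ≤ s := by exact_mod_cast hLS
      have w6 : (s : ℝ) * (S - 2) < (A.image ρ).card := by exact_mod_cast hn2
      have w7 : (A.card : ℝ) + (A.image ρ).card + s ≤ (A + B).card := by exact_mod_cast hbig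
      have w8 : (0 : ℝ) ≤ U.card := by positivity
      obtain ⟨φ, hφ⟩ : ∃ φ : ℝ, (V.card : ℝ) - U.card = φ := ⟨_, rfl⟩
      rw [hφ] at hpe
      have w9 : (L : ℝ) ≤ φ := by linarith
      have w10 : φ ≤ s := by linarith
      have w11 : (U.card : ℝ) ≤ (S - 2) * φ := by
        have : (S - 2 : ℝ) * L ≤ (S - 2) * φ := mul_le_mul_of_nonneg_left w9 (by linarith)
        linarith
      have w12 : (A.image ρ).card + (s : ℝ) / 2 < P := by linarith
      have s0 : (0 : ℝ) ≤ s := by positivity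
      have w13 := mul_le_mul_of_nonneg_left w11 (by linarith : (0 : ℝ) ≤ 2 * s)
      have w14 := mul_le_mul_of_nonneg_right w10 (by linarith : (0 : ℝ) ≤ φ)
      have w15 : φ * (2 * P) < φ * (2 * s * (S - 2) + s) := by nlinarith
      have w16 := lt_of_mul_lt_mul_left w15 (by linarith)
      linarith
  · -- no wrap
    have hW := nonwrap_hW ρ A B K H hBne hKH pH hpH (by rw [hαH]; exact hnw) hmin
    have hpH' : (B.image (qp ρ H)).card = pH + 1 := by rw [image_qp]; exact hpH
    rcases Nat.lt_or_ge 1 pH with hpH2 | hpH2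
    · obtain ⟨rb1, rb0⟩ := row_bound ρ H B n hnB hρ hinj
      have hc : (1 : ℤ) ≤ s - pH * (hs H).card ∧
          (pH : ℤ) * ((hs H).card - (s - pH * (hs H).card)) ≤
            (αH + pH) * (s - pH * (hs H).card) := by
        rcases hcase with hKe | hpS
        · subst hKe
          have e1 : pH = p := by omega
          have e2 : αH = α := by omega
          obtain ⟨star, _⟩ := hstar (by omega)
          rw [e1, e2, hL]
          have hu : (s : ℤ) - p * L = v + hol := by linarith
          rw [hu]
          have e3 : (L : ℤ) - (v + hol) = E + 1 := by linarith
          rw [e3]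
          have p2 : (2 : ℤ) ≤ p := by omega
          have a1 : (1 : ℤ) ≤ α := by exact_mod_cast hα1
          refine ⟨by linarith, ?_⟩
          have t1 : 0 ≤ ((α : ℤ) + p) * hol := mul_nonneg (by linarith) hh0
          have t2 : (p : ℤ) ≤ p * v := le_mul_of_one_le_right (by linarith) hv1
          have t3 : 0 ≤ (p : ℤ) * ((2 * p - 1) * v) :=
            mul_nonneg (by linarith) (mul_nonneg (by linarith) (by linarith))
          nlinarith
        · have : pH ≤ pH * S := Nat.le_mul_of_pos_right _ hS1
          obtain ⟨star, _⟩ := hstar (by omega)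
          have := num1 p pH S L αH α E hol v s (by exact_mod_cast hpH1) (by exact_mod_cast hS1)
            (by exact_mod_cast hL1) hE0 hh0 hv1 hvd hsd (by exact_mod_cast hpS)
            (by exact_mod_cast hααH) star
          rw [hS]; push_cast
          exact this
      exact hcon (R_many (qp ρ H) A B hA pH s (hs H).card hBc hpH1 hpH' hW
        (fun k _ hk => rb1 k hk) rb0 (s - pH * (hs H).card) (by ring) hc.1 αH
        (by rw [image_qp]; exact hαH) hc.2)
    · have e : pH = 1 := by omega
      rw [e] at hW hpH'
      exact hcon (R_one (qp ρ H) A B hA s hBc hpH' hW)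

end Main2

open Pointwise
set_option linter.unusedSectionVars false
set_option linter.unusedVariables false

lemma prim (A B : Finset ℤ) (hA : A.Nonempty) (n : ℤ) (s : ℕ) (hs1 : 1 ≤ s)
    (hBc : B.card = s + 2) (h0 : 0 ∈ B) (hnB : n ∈ B) (hr : ∀ b ∈ B, 0 ≤ b ∧ b ≤ n)
    (hg : ∀ d : ℤ, (∀ b ∈ B, d ∣ b) → IsUnit d) :
    (s : ℝ) / 2 + Real.sqrt (2 * A.card * s) ≤ (A + B).card - A.card ∨
      (A.card : ℤ) + n ≤ (A + B).card := by
  have hn : 0 < n := by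
    by_contra hc
    have : B ⊆ {0} := by
      intro b hb
      have := hr b hb
      rw [Finset.mem_singleton]; omega
    have := Finset.card_le_card this
    rw [Finset.card_singleton] at this
    omega
  obtain ⟨m, rfl⟩ := Int.eq_ofNat_of_zero_le hn.le
  have hm : m ≠ 0 := by omega
  haveI : NeZero m := ⟨hm⟩
  let ρ : ℤ →+ ZMod m := Int.castAddHom (ZMod m)
  have hρ : ρ (m : ℤ) = 0 := by simp [ρ]
  have hker : ∀ x y : ℤ, ρ x = ρ y ↔ (m : ℤ) ∣ y - x := by
    intro x y
    simp only [ρ, Int.coe_castAddHom]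
    exact ZMod.intCast_eq_intCast_iff_dvd_sub x y m
  have hinj : Set.InjOn ρ (B.erase (m : ℤ)) := by
    intro x hx y hy hxy
    rw [hker] at hxy
    rw [Finset.mem_coe, Finset.mem_erase] at hx hy
    have h1 := hr x hx.2
    have h2 := hr y hy.2
    have h3 : x < m := lt_of_le_of_ne h1.2 hx.1
    have h4 : y < m := lt_of_le_of_ne h2.2 hy.1
    have := Int.eq_zero_of_abs_lt_dvd hxy (by rw [abs_lt]; constructor <;> linarith)
    linarith
  have himg : (B.erase (m : ℤ)).image ρ = B.image ρ := by
    apply Finset.Subset.antisymm (Finset.image_subset_image (Finset.erase_subset _ _))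
    intro y hy
    obtain ⟨b, hb, rfl⟩ := Finset.mem_image.1 hy
    by_cases hbn : b = m
    · subst hbn
      rw [hρ]
      exact Finset.mem_image.2 ⟨0, Finset.mem_erase.2 ⟨by omega, h0⟩, map_zero _⟩
    · exact Finset.mem_image_of_mem _ (Finset.mem_erase.2 ⟨hbn, hb⟩)
  have hBb : (B.image ρ).card = s + 1 := by
    rw [← himg, Finset.card_image_of_injOn hinj, Finset.card_erase_of_mem hnB, hBc]; rfl
  have hgen : ∀ H : AddSubgroup (ZMod m), (∀ b ∈ B, ρ b ∈ H) → H = ⊤ := by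
    intro H hH
    obtain ⟨d, hd⟩ := Int.subgroup_cyclic (H.comap ρ)
    have hu : IsUnit d := by
      apply hg
      intro b hb
      have : b ∈ H.comap ρ := hH b hb
      rw [hd, ← AddSubgroup.zmultiples_eq_closure, Int.mem_zmultiples_iff] at this
      exact this
    rw [eq_top_iff]
    intro x _
    obtain ⟨z, rfl⟩ := ZMod.intCast_surjective x
    have : z ∈ H.comap ρ := by
      rw [hd, ← AddSubgroup.zmultiples_eq_closure, Int.mem_zmultiples_iff]
      exact hu.dvd
    exact this
  by_cases hne : A.image ρ + B.image ρ = Finset.univ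
  · right
    have o := option_lemma ρ A B m hn h0 hnB hρ Finset.univ (by rw [hne])
    simp only [Finset.mem_univ, Finset.filter_true, Finset.card_univ, ZMod.card] at o
    exact_mod_cast o
  · left
    exact main_ind ρ B m hn h0 hnB hρ s hs1 hBc hBb hgen A.card A rfl hA hne

lemma card_le_add (A B : Finset ℤ) (hB : B.Nonempty) : A.card ≤ (A + B).card := by
  exact Finset.card_le_card_add_right hB

lemma sqrt_sub (a b s : ℝ) (ha : 0 ≤ a) (hb : 0 ≤ b) (hs : 0 ≤ s) :
    Real.sqrt (2 * (a + b) * s) ≤ Real.sqrt (2 * a * s) + Real.sqrt (2 * b * s) := by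
  have h1 := Real.sq_sqrt (by positivity : 0 ≤ 2 * a * s)
  have h2 := Real.sq_sqrt (by positivity : 0 ≤ 2 * b * s)
  have h3 := Real.sqrt_nonneg (2 * a * s)
  have h4 := Real.sqrt_nonneg (2 * b * s)
  apply Real.sqrt_le_iff.2
  constructor
  · positivity
  · nlinarith [mul_nonneg h3 h4]

lemma scaled (B : Finset ℤ) (n : ℤ) (s : ℕ) (hs1 : 1 ≤ s) (hn : 0 ≤ n)
    (hBc : B.card = s + 2) (h0 : 0 ∈ B) (hnB : n ∈ B) (hr : ∀ b ∈ B, 0 ≤ b ∧ b ≤ n)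
    (hg : ∀ d : ℤ, (∀ b ∈ B, d ∣ b) → IsUnit d) (g : ℤ) (hg0 : g ≠ 0) :
    ∀ (N : ℕ) (A : Finset ℤ), A.card = N → A.Nonempty →
    (s : ℝ) / 2 + Real.sqrt (2 * A.card * s) ≤ (A + B.image (g * ·)).card - A.card ∨
      (A.card : ℤ) + n ≤ (A + B.image (g * ·)).card := by
  intro N
  induction N using Nat.strong_induction_on with
  | _ N ih =>
  intro A hAN hA
  have hBne : (B.image (g * ·)).Nonempty := ⟨_, Finset.mem_image_of_mem _ h0⟩
  obtain ⟨a0, ha0⟩ := hA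
  -- one class
  have one : ∀ A0 : Finset ℤ, A0.Nonempty → (∀ a ∈ A0, g ∣ a - a0) →
      (s : ℝ) / 2 + Real.sqrt (2 * A0.card * s) ≤ (A0 + B.image (g * ·)).card - A0.card ∨
      (A0.card : ℤ) + n ≤ (A0 + B.image (g * ·)).card := by
    intro A0 hA0 hcl
    have hinj : Function.Injective (fun x : ℤ => a0 + g * x) := by
      intro x y h
      exact mul_left_cancel₀ hg0 (add_left_cancel h)
    let A' := A0.image (fun a => (a - a0) / g)
    have e1 : A0 = A'.image (fun x => a0 + g * x) := by
      ext a
      simp only [A', Finset.mem_image, exists_exists_and_eq_and]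
      constructor
      · intro ha
        refine ⟨a, ha, ?_⟩
        rw [Int.mul_ediv_cancel' (hcl a ha)]; ring
      · rintro ⟨b, hb, h⟩
        rw [Int.mul_ediv_cancel' (hcl b hb)] at h
        have : b = a := by linarith
        exact this ▸ hb
    have e2 : A0 + B.image (g * ·) = (A' + B).image (fun x => a0 + g * x) := by
      nth_rewrite 1 [e1]
      ext z
      simp only [Finset.mem_add, Finset.mem_image]
      constructor
      · rintro ⟨_, ⟨x, hx, rfl⟩, _, ⟨b, hb, rfl⟩, rfl⟩
        exact ⟨x + b, ⟨x, hx, b, hb, rfl⟩, by ring⟩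
      · rintro ⟨_, ⟨x, hx, b, hb, rfl⟩, rfl⟩
        exact ⟨_, ⟨x, hx, rfl⟩, _, ⟨b, hb, rfl⟩, by ring⟩
    have e3 : A0.card = A'.card := by
      nth_rewrite 1 [e1]
      exact Finset.card_image_of_injective _ hinj
    rw [e2, Finset.card_image_of_injective _ hinj, e3]
    exact prim A' B (hA0.image _) n s hs1 hBc h0 hnB hr hg
  set A0 := A.filter (fun a => g ∣ a - a0) with hA0
  set A1 := A.filter (fun a => ¬ (g ∣ a - a0)) with hA1
  have hc : A0.card + A1.card = A.card := Finset.card_filter_add_card_filter_not _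
  have hA0ne : A0.Nonempty := ⟨a0, by rw [hA0, Finset.mem_filter]; exact ⟨ha0, by simp⟩⟩
  have hone := one A0 hA0ne (fun a ha => (Finset.mem_filter.1 ha).2)
  rcases A1.eq_empty_or_nonempty with he | hA1ne
  · have : A0 = A := by
      have hle : A.card ≤ A0.card := by
        rw [he, Finset.card_empty] at hc
        omega
      exact Finset.eq_of_subset_of_card_le (fun a ha => (Finset.mem_filter.1 ha).1) hle
    rw [this] at hone
    exact hone
  · have hpos := Finset.card_pos.2 hA0ne
    have htwo := ih A1.card (by omega) A1 rfl hA1ne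
    have hd : Disjoint (A0 + B.image (g * ·)) (A1 + B.image (g * ·)) := by
      rw [Finset.disjoint_left]
      intro z h1 h2
      obtain ⟨x, hx, y, hy, rfl⟩ := Finset.mem_add.1 h1
      obtain ⟨x', hx', y', hy', he⟩ := Finset.mem_add.1 h2
      rw [hA0, Finset.mem_filter] at hx
      rw [hA1, Finset.mem_filter] at hx'
      obtain ⟨b, _, rfl⟩ := Finset.mem_image.1 hy
      obtain ⟨b', _, rfl⟩ := Finset.mem_image.1 hy'
      apply hx'.2
      obtain ⟨t, ht⟩ := hx.2
      refine ⟨t + b - b', ?_⟩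
      have : x' - a0 = (x - a0) + g * b - g * b' := by linarith
      rw [this, ht]; ring
    have hsum : (A0 + B.image (g * ·)).card + (A1 + B.image (g * ·)).card
        ≤ (A + B.image (g * ·)).card := by
      rw [← Finset.card_union_of_disjoint hd]
      apply Finset.card_le_card
      apply Finset.union_subset <;> exact Finset.add_subset_add_right (Finset.filter_subset _ _)
    have l0 := card_le_add A0 _ hBne
    have l1 := card_le_add A1 _ hBne
    rcases hone with h1 | h1
    · rcases htwo with h2 | h2
      · left
        have hs0 : (0 : ℝ) ≤ s := by positivity
        have := sqrt_sub A0.card A1.card s (by positivity) (by positivity) hs0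
        have hcR : (A.card : ℝ) = A0.card + A1.card := by exact_mod_cast hc.symm
        have hsR : ((A0 + B.image (g * ·)).card : ℝ) + (A1 + B.image (g * ·)).card
          ≤ (A + B.image (g * ·)).card := by exact_mod_cast hsum
        rw [hcR]
        linarith
      · right; omega
    · right; omega

lemma small_B (A B : Finset ℤ) (hA : A.Nonempty) (hB : B.Nonempty)
    (hsmall : (((A + B).card : ℝ)) <
      (A.card : ℝ) + (B.card : ℝ) / 2 - 1 + 2 * Real.sqrt ((A.card : ℝ) * ((B.card : ℝ) / 2 - 1))) :
    3 ≤ B.card := by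
  by_contra hc
  have h2 : B.card ≤ 2 := by omega
  have h2R : (B.card : ℝ) ≤ 2 := by exact_mod_cast h2
  have hs : Real.sqrt ((A.card : ℝ) * ((B.card : ℝ) / 2 - 1)) = 0 := by
    apply Real.sqrt_eq_zero_of_nonpos
    apply mul_nonpos_of_nonneg_of_nonpos (by positivity) (by linarith)
  rw [hs] at hsmall
  have h3 := cauchy_davenport_add_of_linearOrder_isCancelAdd hA hB
  have h4 : A.card + B.card ≤ (A + B).card + 1 := by omega
  have h5 : (A.card : ℝ) + B.card ≤ (A + B).card + 1 := by exact_mod_cast h4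
  have : (1 : ℝ) ≤ B.card := by exact_mod_cast Finset.card_pos.2 hB
  linarith

theorem stmt_9 (A B : Finset ℤ) (hA : A.Nonempty) (hB : B.Nonempty)
    (r : ℤ) (hr : ((A + B).card : ℤ) = A.card + B.card + r)
    (hsmall : (((A + B).card : ℝ)) <
      (A.card : ℝ) + (B.card : ℝ) / 2 - 1 + 2 * Real.sqrt ((A.card : ℝ) * ((B.card : ℝ) / 2 - 1))) :
    ∃ (x d : ℤ) (k : ℕ), 1 ≤ d ∧
      B ⊆ (Finset.range k).image (fun i : ℕ => x + (i : ℤ) * d) ∧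
      (k : ℤ) ≤ B.card + r + 1 := by
  have h3 := small_B A B hA hB hsmall
  obtain ⟨s, hs⟩ : ∃ s, B.card = s + 2 := ⟨B.card - 2, by omega⟩
  set m := B.min' hB with hm
  have hmB : m ∈ B := Finset.min'_mem _ _
  set g := B.gcd (fun b => b - m) with hg
  have hgd : ∀ b ∈ B, g ∣ b - m := fun b hb => Finset.gcd_dvd hb
  have hg0 : g ≠ 0 := by
    intro h
    rw [hg, Finset.gcd_eq_zero_iff] at h
    have : B ⊆ {m} := by
      intro b hb
      have := h b hb
      rw [Finset.mem_singleton]; omega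
    have := Finset.card_le_card this
    rw [Finset.card_singleton] at this
    omega
  have hgnn : 0 ≤ g := by
    have : normalize g = g := Finset.normalize_gcd
    rw [← this]
    exact Int.nonneg_of_normalize_eq_self (normalize_idem g)
  have hgpos : 0 < g := lt_of_le_of_ne hgnn hg0.symm
  have hmul : ∀ b ∈ B, g * ((b - m) / g) = b - m := fun b hb => Int.mul_ediv_cancel' (hgd b hb)
  set B' := B.image (fun b => (b - m) / g) with hB'
  have hinj : Set.InjOn (fun b => (b - m) / g) B := by
    intro x hx y hy h
    have h1 := hmul x hx
    have h2 := hmul y hy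
    simp only at h
    rw [h] at h1
    linarith
  have hB'c : B'.card = s + 2 := by rw [hB', Finset.card_image_of_injOn hinj, hs]
  have h0 : 0 ∈ B' := Finset.mem_image.2 ⟨m, hmB, by simp⟩
  have hB'nn : ∀ b ∈ B', 0 ≤ b := by
    intro b hb
    obtain ⟨c, hc, rfl⟩ := Finset.mem_image.1 hb
    apply Int.ediv_nonneg _ hgnn
    have := Finset.min'_le B c hc
    linarith
  set n := B'.max' ⟨0, h0⟩ with hn
  have hnB : n ∈ B' := Finset.max'_mem _ _
  have hle : ∀ b ∈ B', b ≤ n := fun b hb => Finset.le_max' _ _ hb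
  have hunit : ∀ d : ℤ, (∀ b ∈ B', d ∣ b) → IsUnit d := by
    intro d hd
    have h1 : g * d ∣ g := by
      nth_rewrite 2 [hg]
      apply Finset.dvd_gcd
      intro b hb
      rw [← hmul b hb]
      exact mul_dvd_mul_left g (hd _ (Finset.mem_image_of_mem _ hb))
    have h2 : g * d ∣ g * 1 := by rwa [mul_one]
    exact isUnit_of_dvd_one ((mul_dvd_mul_iff_left hg0).1 h2)
  have hmain := scaled B' n s (by omega) (hB'nn n hnB) hB'c h0 hnB
    (fun b hb => ⟨hB'nn b hb, hle b hb⟩) hunit g hg0 A.card A rfl hA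
  have hBimg : A + B = (A + B'.image (g * ·)).image (fun z => z + m) := by
    ext z
    simp only [Finset.mem_add, Finset.mem_image, hB']
    constructor
    · rintro ⟨a, ha, b, hb, rfl⟩
      refine ⟨a + (b - m), ⟨a, ha, b - m, ⟨_, ⟨b, hb, rfl⟩, hmul b hb⟩, rfl⟩, by ring⟩
    · rintro ⟨_, ⟨a, ha, _, ⟨_, ⟨b, hb, rfl⟩, rfl⟩, rfl⟩, rfl⟩
      refine ⟨a, ha, b, hb, ?_⟩
      rw [hmul b hb]; ring
  have hcard : (A + B).card = (A + B'.image (g * ·)).card := by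
    rw [hBimg, Finset.card_image_of_injective _ (add_left_injective m)]
  rw [← hcard] at hmain
  rcases hmain with h | h
  · exfalso
    rw [hs] at hsmall
    have e1 : ((s + 2 : ℕ) : ℝ) / 2 - 1 = s / 2 := by push_cast; ring
    rw [add_sub_assoc, e1] at hsmall
    have e2 : Real.sqrt (2 * A.card * s) = 2 * Real.sqrt ((A.card : ℝ) * (s / 2)) := by
      have : (2 * A.card * s : ℝ) = 2 ^ 2 * (A.card * (s / 2)) := by ring
      rw [this, Real.sqrt_mul (by norm_num), Real.sqrt_sq (by norm_num)]
    rw [e2] at h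
    linarith
  · have hn0 := hB'nn n hnB
    refine ⟨m, g, n.toNat + 1, hgpos, ?_, ?_⟩
    · intro b hb
      have hb' : (b - m) / g ∈ B' := Finset.mem_image_of_mem _ hb
      have h1 := hB'nn _ hb'
      have h2 := hle _ hb'
      refine Finset.mem_image.2 ⟨((b - m) / g).toNat, Finset.mem_range.2 (by omega), ?_⟩
      rw [Int.toNat_of_nonneg h1, mul_comm, hmul b hb]; ring
    · push_cast
      rw [Int.toNat_of_nonneg hn0]
      linarith
end
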